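/- arXiv:1302.4117 — 5 statements merged into one kernel-verified Lean document; each statement's English description precedes it below -/
import Mathlib

section
/- Let θ > 1/2 and let S = (s_j) be a sequence of distinct points of ℂ_{1/2} with 1/2 < Re s_j ≤ θ for every j, which is an interpolating sequence for H²(ℂ_{1/2}), i.e. M_{H²(ℂ_{1/2})}(S) < ∞. Then there exists a constant C, depending only on θ, such that for every R ≥ θ + 1: M_{ℋ²}(S_R) ≤ C·[M_{H²(ℂ_{1/2})}(S)]^{2θ+6}·R^{2θ+7/2}, where S_R denotes the subsequence of those s_j with |Im s_j| < R. -/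
open Complex Filter MeasureTheory

noncomputable section

/-- The Hilbert space `ℋ²` of Dirichlet series with square-summable coefficients,
modeled by its coefficient sequences (indexed by `ℕ+`). -/
abbrev H2 := ↥(lp (fun _ : ℕ+ => ℂ) 2)

/-- The Dirichlet series attached to an element of `ℋ²`; it converges on `Re s > 1/2`. -/
noncomputable def H2series (x : H2) (s : ℂ) : ℂ := ∑' n : ℕ+, x n * (n : ℂ) ^ (-s)

/-- `T` is (the bounded operator realizing) the composition operator `C_φ` on `ℋ²`:
for every `f ∈ ℋ²`, the Dirichlet series of `T f` agrees with `f ∘ φ` on `ℂ_{1/2}`. -/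
def IsCompOp (φ : ℂ → ℂ) (T : H2 →L[ℂ] H2) : Prop :=
  ∀ (x : H2) (s : ℂ), 1 / 2 < s.re → H2series (T x) s = H2series x (φ s)

/-- The `n`-th approximation number of a bounded operator: the distance in operator
norm to the operators of rank `< n`. -/
noncomputable def approxNumber {E F : Type*} [NormedAddCommGroup E] [NormedSpace ℂ E]
    [NormedAddCommGroup F] [NormedSpace ℂ F] (T : E →L[ℂ] F) (n : ℕ) : ℝ :=
  sInf {c : ℝ | ∃ R : E →L[ℂ] F,
    FiniteDimensional ℂ (LinearMap.range (R : E →ₗ[ℂ] F)) ∧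
    Module.finrank ℂ (LinearMap.range (R : E →ₗ[ℂ] F)) < n ∧ c = ‖T - R‖}

/-- `h` is analytic on `Re s > 1/2` and its squared `H²(ℂ_{1/2})` norm
`sup_{σ>1/2} (1/2π) ∫ |h(σ+it)|² dt` is at most `B`. -/
def MemH2C (h : ℂ → ℂ) (B : ℝ) : Prop :=
  DifferentiableOn ℂ h {s : ℂ | 1 / 2 < s.re} ∧
    ∀ σ : ℝ, 1 / 2 < σ →
      (∫⁻ t : ℝ, (‖h (σ + t * Complex.I)‖₊ : ENNReal) ^ 2) ≤
        ENNReal.ofReal (2 * Real.pi * B)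

/-- `M` is an interpolation bound for the sequence `s` in `H²(ℂ_{1/2})`. -/
def IsInterpBoundC {ι : Type*} (s : ι → ℂ) (M : ℝ) : Prop :=
  ∀ a : ι → ℂ, Summable (fun j => ‖a j‖ ^ 2 * (2 * (s j).re - 1)) →
    ∃ (h : ℂ → ℂ) (B : ℝ), MemH2C h B ∧ (∀ j, h (s j) = a j) ∧
      B ≤ M ^ 2 * ∑' j, ‖a j‖ ^ 2 * (2 * (s j).re - 1)

/-- `M` is an interpolation bound for the sequence `s` in `ℋ²` (with weights
`1/ζ(2 Re s_j)`). -/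
def IsInterpBoundDir {ι : Type*} (s : ι → ℂ) (M : ℝ) : Prop :=
  ∀ a : ι → ℂ, Summable (fun j => ‖a j‖ ^ 2 / (riemannZeta (2 * (s j).re)).re) →
    ∃ F : H2, (∀ j, H2series F (s j) = a j) ∧
      ‖F‖ ^ 2 ≤ M ^ 2 * ∑' j, ‖a j‖ ^ 2 / (riemannZeta (2 * (s j).re)).re

/-- The constant of interpolation `M_{H²(ℂ_{1/2})}(S) ∈ [0,∞]`. -/
noncomputable def MH2C {ι : Type*} (s : ι → ℂ) : ENNReal :=
  ⨅ (M : NNReal) (_ : IsInterpBoundC s (M : ℝ)), (M : ENNReal)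

/-- The constant of interpolation `M_{ℋ²}(S) ∈ [0,∞]`. -/
noncomputable def MH2Dir {ι : Type*} (s : ι → ℂ) : ENNReal :=
  ⨅ (M : NNReal) (_ : IsInterpBoundDir s (M : ℝ)), (M : ENNReal)

lemma contour_tendsto_zero {f : ℂ → ℂ} {ε K r : ℝ} (hε : 0 < ε)
    (hf : DifferentiableOn ℂ f {z | -ε < z.re})
    (hK : ∀ z : ℂ, 0 ≤ z.re → r ≤ ‖z‖ → ‖f z‖ ≤ K / ‖z‖ ^ 2) :
    Tendsto (fun T : ℝ => ∫ t in (-T)..T, f (t * I)) atTop (nhds 0) := by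
  have key : ∀ T : ℝ, max r 1 ≤ T → ‖∫ t in (-T)..T, f (t * I)‖ ≤ 4 * K / T := by
    intro T hT
    have hT0 : 0 < T := lt_of_lt_of_le one_pos ((le_max_right _ _).trans hT)
    have hrT : r ≤ T := (le_max_left _ _).trans hT
    have hb : ∀ z : ℂ, 0 ≤ z.re → T ≤ ‖z‖ → ‖f z‖ ≤ K / T ^ 2 := by
      intro z hz hTz
      have h1 := hK z hz (hrT.trans hTz)
      have hz0 : 0 < ‖z‖ := hT0.trans_le hTz
      have hK0 : 0 ≤ K := by
        by_contra hneg
        push Not at hneg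
        have : K / ‖z‖ ^ 2 < 0 := div_neg_of_neg_of_pos hneg (by positivity)
        linarith [norm_nonneg (f z)]
      refine h1.trans (div_le_div_of_nonneg_left hK0 (by positivity) ?_)
      gcongr
    have h := integral_boundary_rect_eq_zero_of_differentiableOn f (-T * I) (T + T * I)
      (hf.mono (by
        intro z hz
        have := hz.1
        simp [Set.uIcc_of_le hT0.le] at this
        simp only [Set.mem_ofPred_eq]
        linarith [this.1]))
    simp at h
    have b1 : ‖∫ x in (0:ℝ)..T, f (x + -(T * I))‖ ≤ K / T ^ 2 * |T - 0| := by
      refine intervalIntegral.norm_integral_le_of_norm_le_const fun x hx => ?_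
      rw [Set.uIoc_of_le hT0.le] at hx
      refine hb _ (by simp [hx.1.le]) ?_
      have := abs_im_le_norm ((x : ℂ) + -(T * I))
      simpa [abs_of_pos hT0] using this
    have b2 : ‖∫ x in (0:ℝ)..T, f (x + T * I)‖ ≤ K / T ^ 2 * |T - 0| := by
      refine intervalIntegral.norm_integral_le_of_norm_le_const fun x hx => ?_
      rw [Set.uIoc_of_le hT0.le] at hx
      refine hb _ (by simp [hx.1.le]) ?_
      have := abs_im_le_norm ((x : ℂ) + T * I)
      simpa [abs_of_pos hT0] using this
    have b3 : ‖∫ y in (-T)..T, f (T + y * I)‖ ≤ K / T ^ 2 * |T - (-T)| := by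
      refine intervalIntegral.norm_integral_le_of_norm_le_const fun x hx => ?_
      refine hb _ (by simp [hT0.le]) ?_
      have := abs_re_le_norm ((T : ℂ) + x * I)
      simpa [abs_of_pos hT0] using this
    have e : ∫ t in (-T)..T, f (t * I) =
        -I * ((∫ x in (0:ℝ)..T, f (x + -(T * I))) - (∫ x in (0:ℝ)..T, f (x + T * I)))
          + ∫ y in (-T)..T, f (T + y * I) := by
      linear_combination I * h + ((∫ t in (-T)..T, f (t * I)) -
        ∫ y in (-T)..T, f (T + y * I)) * I_sq
    rw [e]
    have : |T - 0| = T := by rw [sub_zero, abs_of_pos hT0]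
    have h2 : |T - (-T)| = 2 * T := by rw [sub_neg_eq_add, abs_of_pos (by linarith)]; ring
    rw [this] at b1 b2
    rw [h2] at b3
    calc _ ≤ ‖-I * ((∫ x in (0:ℝ)..T, f (x + -(T * I))) - (∫ x in (0:ℝ)..T, f (x + T * I)))‖
          + ‖∫ y in (-T)..T, f (T + y * I)‖ := norm_add_le _ _
      _ ≤ (K / T ^ 2 * T + K / T ^ 2 * T) + K / T ^ 2 * (2 * T) := by
        gcongr
        rw [norm_mul, norm_neg, norm_I, one_mul]
        exact (norm_sub_le _ _).trans (add_le_add b1 b2)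
      _ = 4 * K / T := by field_simp; ring
  refine squeeze_zero_norm' (eventually_atTop.2 ⟨max r 1, key⟩) ?_
  exact tendsto_const_nhds.div_atTop tendsto_id

lemma memLp_inv_sub_mul_I {p : ℂ} (hp : 0 < p.re) :
    MemLp (fun t : ℝ => 1 / (p - t * I)) 2 volume := by
  have hne : ∀ t : ℝ, p - t * I ≠ 0 := fun t h => by
    have := congrArg re h; simp at this; linarith
  have hc : Continuous fun t : ℝ => 1 / (p - t * I) :=
    continuous_const.div (by fun_prop) hne
  rw [memLp_two_iff_integrable_sq_norm hc.aestronglyMeasurable]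
  have h1 : Integrable fun t : ℝ => (1 + ((p.re)⁻¹ * (t - p.im)) ^ 2)⁻¹ := by
    have := (integrable_inv_one_add_sq.comp_mul_left' (R := (p.re)⁻¹) (by positivity))
    exact this.comp_sub_right p.im
  refine (h1.const_mul ((p.re)⁻¹ ^ 2)).congr (Eventually.of_forall fun t => ?_)
  have : ‖p - t * I‖ ^ 2 = p.re ^ 2 + (t - p.im) ^ 2 := by
    rw [Complex.sq_norm, normSq_apply]; simp; ring
  simp only [norm_div, norm_one, div_pow, one_pow, this]
  field_simp

lemma integral_poisson {p : ℂ} (hp : 0 < p.re) :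
    ∫ t : ℝ, ((2 * p.re : ℝ) : ℂ) / ((t * I + (starRingEnd ℂ) p) * (p - t * I)) = 2 * Real.pi := by
  have e : ∀ t : ℝ, ((2 * p.re : ℝ) : ℂ) / ((t * I + (starRingEnd ℂ) p) * (p - t * I)) =
      ((2 * (p.re)⁻¹ * (1 + ((p.re)⁻¹ * (t - p.im)) ^ 2)⁻¹ : ℝ) : ℂ) := by
    intro t
    have h1 : (t * I + (starRingEnd ℂ) p) * (p - t * I) = ((p.re ^ 2 + (t - p.im) ^ 2 : ℝ) : ℂ) := by
      apply Complex.ext <;> simp [pow_two] <;> ring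
    rw [h1, ← ofReal_div]
    congr 1
    field_simp
  simp_rw [e]
  rw [integral_complex_ofReal, integral_const_mul,
    integral_sub_right_eq_self (fun t : ℝ => (1 + ((p.re)⁻¹ * t) ^ 2)⁻¹) p.im,
    Measure.integral_comp_mul_left (fun t : ℝ => (1 + t ^ 2)⁻¹), integral_univ_inv_one_add_sq]
  have : (p.re : ℂ) ≠ 0 := by exact_mod_cast hp.ne'
  simp [abs_of_pos hp]
  field_simp

lemma norm_sub_ge_half {z p : ℂ} (h : 2 * ‖p‖ ≤ ‖z‖) : ‖z‖ / 2 ≤ ‖z - p‖ := by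
  have := norm_sub_norm_le z p
  linarith [norm_nonneg p]

/-- Functions analytic on a neighbourhood of the closed right half-plane and decaying like
`1 / |z|` there. -/
structure HalfPlaneDecay (g : ℂ → ℂ) : Prop where
  diff : ∃ ε : ℝ, 0 < ε ∧ DifferentiableOn ℂ g {z | -ε < z.re}
  decay : ∃ K : ℝ, ∀ z : ℂ, 0 ≤ z.re → ‖g z‖ ≤ K / ‖1 + z‖

lemma HalfPlaneDecay.continuous {g : ℂ → ℂ} (hg : HalfPlaneDecay g) :
    Continuous fun t : ℝ => g (t * I) := by
  obtain ⟨ε, hε, hd⟩ := hg.diff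
  refine hd.continuousOn.comp_continuous (by fun_prop) fun t => ?_
  simp [hε]

lemma HalfPlaneDecay.memLp {g : ℂ → ℂ} (hg : HalfPlaneDecay g) :
    MemLp (fun t : ℝ => g (t * I)) 2 volume := by
  obtain ⟨K, hK⟩ := hg.decay
  have h1 := (memLp_inv_sub_mul_I (p := 1) (by simp))
  refine MemLp.of_le_mul (c := K) h1 hg.continuous.aestronglyMeasurable
    (Eventually.of_forall fun t => ?_)
  have h2 := hK (t * I) (by simp)
  have h3 : ‖(1 : ℂ) + t * I‖ = ‖(1 : ℂ) - t * I‖ := by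
    rw [← Complex.norm_conj]; simp [sub_eq_add_neg]
  rw [h3] at h2
  simpa [div_eq_mul_inv] using h2

lemma halfPlaneDecay_inv {q : ℂ} (hq : 0 < q.re) : HalfPlaneDecay fun z => 1 / (z + q) := by
  refine ⟨⟨q.re, hq, ?_⟩, 1 + ‖1 - q‖ / q.re, ?_⟩
  · intro z hz
    have : z + q ≠ 0 := fun h => by
      have := congrArg re h; simp at this hz; linarith
    exact DifferentiableAt.differentiableWithinAt (by fun_prop (disch := exact this))
  · intro z hz
    have hq1 : q.re ≤ ‖z + q‖ := by
      have := re_le_norm (z + q); simp at this; linarith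
    have h0 : 0 < ‖z + q‖ := hq.trans_le hq1
    have h1 : 0 < ‖1 + z‖ := by
      have := re_le_norm (1 + z); simp at this; linarith
    rw [norm_div, norm_one, div_le_div_iff₀ h0 h1, one_mul]
    have h2 : ‖1 + z‖ ≤ ‖z + q‖ + ‖1 - q‖ := by
      have := norm_add_le (z + q) (1 - q); ring_nf at this ⊢; exact this
    have h3 : ‖1 - q‖ / q.re * q.re ≤ ‖1 - q‖ / q.re * ‖z + q‖ := by gcongr
    rw [div_mul_cancel₀ _ hq.ne'] at h3
    linarith

lemma cauchy_halfPlane {g : ℂ → ℂ} (hg : HalfPlaneDecay g) {p : ℂ} (hp : 0 < p.re) :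
    ∫ t : ℝ, g (t * I) * (1 / (p - t * I)) = 2 * Real.pi * g p := by
  set q : ℂ := (starRingEnd ℂ) p with hq
  have hqre : 0 < q.re := by simpa [hq] using hp
  have hpq : p + q = ((2 * p.re : ℝ) : ℂ) := by rw [hq, add_conj]
  set P : ℂ → ℂ := fun z => 1 / (z + q) with hP
  have hPd : HalfPlaneDecay P := halfPlaneDecay_inv hqre
  obtain ⟨ε₁, hε₁, hd₁⟩ := hg.diff
  obtain ⟨ε₂, hε₂, hd₂⟩ := hPd.diff
  obtain ⟨K₁, hK₁⟩ := hg.decay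
  obtain ⟨K₂, hK₂⟩ := hPd.decay
  set G : ℂ → ℂ := fun z => g z - (p + q) * g p * P z with hG
  have hpq0 : p + q ≠ 0 := by rw [hpq]; exact_mod_cast (by positivity)
  have hGp : G p = 0 := by simp [hG, hP]; field_simp; ring
  set ε := min ε₁ ε₂
  have hε : 0 < ε := lt_min hε₁ hε₂
  have hGd : DifferentiableOn ℂ G {z | -ε < z.re} := by
    refine DifferentiableOn.sub (hd₁.mono ?_) ((hd₂.mono ?_).const_mul _)
    · exact fun z (hz : -ε < z.re) => lt_of_le_of_lt (neg_le_neg (min_le_left _ _)) hz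
    · exact fun z (hz : -ε < z.re) => lt_of_le_of_lt (neg_le_neg (min_le_right _ _)) hz
  have hfd : DifferentiableOn ℂ (dslope G p) {z | -ε < z.re} := by
    rw [Complex.differentiableOn_dslope]
    · exact hGd
    · exact (isOpen_lt continuous_const continuous_re).mem_nhds (by simp; linarith)
  set L := ‖(p + q) * g p‖
  have hlim := contour_tendsto_zero (f := dslope G p) (r := 2 * (‖p‖ + 1))
    (K := 4 * (|K₁| + L * |K₂|)) hε hfd (by
      intro z hz hr
      have hz0 : 0 < ‖z‖ := by linarith [norm_nonneg p]
      have hzp : ‖z‖ / 2 ≤ ‖z - p‖ := norm_sub_ge_half (by linarith)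
      have hne : z ≠ p := by
        rintro rfl
        simp at hzp; linarith
      have hz1 : ‖z‖ / 2 ≤ ‖1 + z‖ := by
        have := norm_sub_ge_half (z := z) (p := -1) (by rw [norm_neg, norm_one]; linarith [norm_nonneg p])
        rwa [sub_neg_eq_add, add_comm z] at this
      rw [dslope_of_ne _ hne, slope_def_field, hGp, sub_zero, norm_div]
      have hn : ‖G z‖ ≤ (|K₁| + L * |K₂|) / (‖z‖ / 2) := by
        calc ‖G z‖ ≤ ‖g z‖ + L * ‖P z‖ := by
              rw [← norm_mul]; exact norm_sub_le _ _
          _ ≤ |K₁| / ‖1 + z‖ + L * (|K₂| / ‖1 + z‖) := by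
              gcongr
              · exact (hK₁ z hz).trans (by gcongr; exact le_abs_self _)
              · exact (hK₂ z hz).trans (by gcongr; exact le_abs_self _)
          _ = (|K₁| + L * |K₂|) / ‖1 + z‖ := by ring
          _ ≤ _ := by gcongr
      calc _ ≤ ((|K₁| + L * |K₂|) / (‖z‖ / 2)) / (‖z‖ / 2) := by gcongr
        _ = _ := by field_simp; ring)
  have hmem := memLp_inv_sub_mul_I hp
  have i1 : Integrable (fun t : ℝ => g (t * I) * (1 / (p - t * I))) := hg.memLp.integrable_mul hmem
  have i2 : Integrable (fun t : ℝ => P (t * I) * (1 / (p - t * I))) := hPd.memLp.integrable_mul hmem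
  have hInt := i1.sub (i2.const_mul ((p + q) * g p))
  have hlim2 := intervalIntegral_tendsto_integral hInt tendsto_neg_atTop_atBot tendsto_id
  have heq : ∀ t : ℝ, dslope G p (t * I) =
      -(g (t * I) * (1 / (p - t * I)) - (p + q) * g p * (P (t * I) * (1 / (p - t * I)))) := by
    intro t
    have hne : (t * I : ℂ) ≠ p := by rintro rfl; simp at hp
    have h1 : p - t * I ≠ 0 := sub_ne_zero.2 hne.symm
    have h2 : t * I - p ≠ 0 := sub_ne_zero.2 hne
    rw [dslope_of_ne _ hne, slope_def_field, hGp, sub_zero, hG]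
    rw [show t * I - p = -(p - t * I) by ring, div_neg]
    ring
  have hzero : ∫ t : ℝ, (g (t * I) * (1 / (p - t * I)) -
      (p + q) * g p * (P (t * I) * (1 / (p - t * I)))) = 0 := by
    have h3 : Tendsto (fun T : ℝ => ∫ t in (-T)..T, dslope G p (t * I)) atTop
        (nhds (-∫ t : ℝ, (g (t * I) * (1 / (p - t * I)) -
      (p + q) * g p * (P (t * I) * (1 / (p - t * I)))))) := by
      simp_rw [heq, intervalIntegral.integral_neg]
      exact hlim2.neg
    have := tendsto_nhds_unique h3 hlim
    simpa using this
  rw [integral_sub i1 (i2.const_mul _), integral_const_mul, sub_eq_zero] at hzero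
  rw [hzero]
  have hpo := integral_poisson hp
  have : ∫ t : ℝ, P (t * I) * (1 / (p - t * I)) = 2 * Real.pi / (p + q) := by
    rw [eq_div_iff hpq0, ← hpo, mul_comm, ← integral_const_mul]
    congr 1
    ext t
    rw [hpq]
    simp only [hP]
    rw [div_mul_div_comm, one_mul, mul_one_div]
  rw [this]
  field_simp

/-- The Hermitian form with kernel `1 / (a j + conj (a k))`, the Gram form of the reproducing
kernels of the Hardy space of the right half-plane. -/
def cauchyForm {ι : Type*} (F : Finset ι) (a c : ι → ℂ) : ℂ :=
  ∑ j ∈ F, ∑ k ∈ F, c j * (starRingEnd ℂ) (c k) / (a j + (starRingEnd ℂ) (a k))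

/-- The Gram form of Cauchy kernels is the squared norm of their combination. -/
lemma integral_norm_sq_sum_inv {ι : Type*} (F : Finset ι) (a c : ι → ℂ)
    (ha : ∀ j ∈ F, 0 < (a j).re) :
    ∫ t : ℝ, ‖∑ j ∈ F, c j * (1 / (a j - t * I))‖ ^ 2 =
      2 * Real.pi * (cauchyForm F a c).re := by
  set k : ℝ → ℂ := fun t => ∑ j ∈ F, c j * (1 / (a j - t * I)) with hk
  have hconj : ∀ i, ∀ t : ℝ, (starRingEnd ℂ) (1 / (a i - t * I)) =
      1 / (t * I + (starRingEnd ℂ) (a i)) := by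
    intro i t
    simp [add_comm]
  have h2 : ∫ t : ℝ, ((‖k t‖ ^ 2 : ℝ) : ℂ) = 2 * Real.pi * cauchyForm F a c := by
    have e : ∀ t : ℝ, ((‖k t‖ ^ 2 : ℝ) : ℂ) = ∑ j ∈ F, ∑ i ∈ F, c j * (starRingEnd ℂ) (c i) *
        ((1 / (t * I + (starRingEnd ℂ) (a i))) * (1 / (a j - t * I))) := by
      intro t
      rw [← normSq_eq_norm_sq, ← mul_conj, hk, map_sum, Finset.sum_mul_sum]
      refine Finset.sum_congr rfl fun j _ => Finset.sum_congr rfl fun i _ => ?_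
      rw [map_mul, hconj]
      ring
    have hpos : ∀ i ∈ F, 0 < ((starRingEnd ℂ) (a i)).re := fun i hi => by simpa using ha i hi
    have hii : ∀ j ∈ F, ∀ i ∈ F, Integrable fun t : ℝ => c j * (starRingEnd ℂ) (c i) *
        ((1 / (t * I + (starRingEnd ℂ) (a i))) * (1 / (a j - t * I))) := fun j hj i hi =>
      ((halfPlaneDecay_inv (hpos i hi)).memLp.integrable_mul
        (memLp_inv_sub_mul_I (ha j hj))).const_mul _
    simp_rw [e]
    rw [integral_finsetSum _ fun j hj => integrable_finsetSum _ (hii j hj), cauchyForm,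
      Finset.mul_sum]
    refine Finset.sum_congr rfl fun j hj => ?_
    rw [integral_finsetSum _ (hii j hj), Finset.mul_sum]
    refine Finset.sum_congr rfl fun i hi => ?_
    rw [integral_const_mul, cauchy_halfPlane (halfPlaneDecay_inv (hpos i hi)) (ha j hj)]
    ring
  rw [integral_complex_ofReal] at h2
  have := congrArg re h2
  rw [ofReal_re] at this
  rw [this, show (2 * Real.pi : ℂ) = ((2 * Real.pi : ℝ) : ℂ) by push_cast; rfl, re_ofReal_mul]

lemma cauchyForm_re_nonneg {ι : Type*} (F : Finset ι) (a c : ι → ℂ)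
    (ha : ∀ j ∈ F, 0 < (a j).re) : 0 ≤ (cauchyForm F a c).re := by
  have h := integral_norm_sq_sum_inv F a c ha
  have h0 : 0 ≤ 2 * Real.pi * (cauchyForm F a c).re :=
    h ▸ integral_nonneg fun t => by positivity
  exact nonneg_of_mul_nonneg_right h0 (by positivity)

lemma norm_sum_sq_le_of_halfPlaneDecay {ι : Type*} (F : Finset ι) (a c : ι → ℂ)
    (ha : ∀ j ∈ F, 0 < (a j).re) {g : ℂ → ℂ} (hg : HalfPlaneDecay g) :
    2 * Real.pi * ‖∑ j ∈ F, c j * g (a j)‖ ^ 2 ≤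
      (∫ t : ℝ, ‖g (t * I)‖ ^ 2) * (cauchyForm F a c).re := by
  set k : ℝ → ℂ := fun t => ∑ j ∈ F, c j * (1 / (a j - t * I)) with hk
  have hkm : MemLp k 2 volume :=
    memLp_finsetSum _ fun j hj => (memLp_inv_sub_mul_I (ha j hj)).const_mul (c j)
  have hgi : ∀ j ∈ F, Integrable fun t : ℝ => g (t * I) * (1 / (a j - t * I)) :=
    fun j hj => hg.memLp.integrable_mul (memLp_inv_sub_mul_I (ha j hj))
  have h1 : ∫ t : ℝ, g (t * I) * k t = 2 * Real.pi * ∑ j ∈ F, c j * g (a j) := by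
    have : ∀ t : ℝ, g (t * I) * k t = ∑ j ∈ F, c j * (g (t * I) * (1 / (a j - t * I))) := by
      intro t
      rw [hk, Finset.mul_sum]
      exact Finset.sum_congr rfl fun j _ => by ring
    simp_rw [this]
    rw [integral_finsetSum _ fun j hj => (hgi j hj).const_mul _, Finset.mul_sum]
    refine Finset.sum_congr rfl fun j hj => ?_
    rw [integral_const_mul, cauchy_halfPlane hg (ha j hj)]
    ring
  have h3 : ∫ t : ℝ, ‖k t‖ ^ 2 = 2 * Real.pi * (cauchyForm F a c).re :=
    integral_norm_sq_sum_inv F a c ha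
  have h4 : ‖∫ t : ℝ, g (t * I) * k t‖ ^ 2 ≤ (∫ t : ℝ, ‖g (t * I)‖ ^ 2) * ∫ t : ℝ, ‖k t‖ ^ 2 := by
    have hH := integral_mul_norm_le_Lp_mul_Lq (μ := volume) (p := 2) (q := 2)
      Real.HolderConjugate.two_two (f := fun t : ℝ => g (t * I)) (g := k)
      (by simpa using hg.memLp) (by simpa using hkm)
    have hn : ‖∫ t : ℝ, g (t * I) * k t‖ ≤ ∫ t : ℝ, ‖g (t * I)‖ * ‖k t‖ :=
      (norm_integral_le_integral_norm _).trans_eq (by simp only [norm_mul])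
    have h5 := hn.trans hH
    simp only [Real.rpow_two] at h5
    rw [← Real.sqrt_eq_rpow, ← Real.sqrt_eq_rpow, ← Real.sqrt_mul
      (integral_nonneg fun t => by positivity)] at h5
    calc _ ≤ _ := pow_le_pow_left₀ (norm_nonneg _) h5 2
      _ = _ := Real.sq_sqrt (mul_nonneg (integral_nonneg fun t => by positivity)
        (integral_nonneg fun t => by positivity))
  rw [h1, h3, norm_mul, mul_pow] at h4
  have h6 : ‖(2 * Real.pi : ℂ)‖ = 2 * Real.pi := by
    simp [abs_of_pos Real.pi_pos]
  rw [h6] at h4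
  have : 0 < 2 * Real.pi := by positivity
  nlinarith

lemma two_pi_mul_enorm_sq_le {h : ℂ → ℂ} {z : ℂ} {ρ : ℝ} (hρ : 0 < ρ)
    (hd : DifferentiableOn ℂ h (Metric.closedBall z ρ)) :
    ENNReal.ofReal (2 * Real.pi) * ‖h z‖ₑ ^ 2 ≤
      ∫⁻ φ in Set.Ioo (-Real.pi) Real.pi, ‖h (z + ρ * (Real.cos φ + Real.sin φ * I))‖ₑ ^ 2 := by
  have hd2 : DiffContOnCl ℂ (fun w => h w ^ 2) (Metric.ball z |ρ|) := by
    rw [abs_of_pos hρ]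
    exact DifferentiableOn.diffContOnCl ((hd.pow 2).mono Metric.closure_ball_subset_closedBall)
  have h1 := hd2.circleAverage
  rw [Real.circleAverage_eq_integral_add (-Real.pi)] at h1
  simp only [intervalIntegral.integral_comp_add_right
    (fun θ => h (circleMap z ρ θ) ^ 2)] at h1
  rw [zero_add, show 2 * Real.pi + -Real.pi = Real.pi by ring,
    inv_smul_eq_iff₀ (by positivity)] at h1
  rw [intervalIntegral.integral_of_le (by linarith [Real.pi_pos])] at h1
  have h2 : ‖(2 * Real.pi) • h z ^ 2‖ₑ = ENNReal.ofReal (2 * Real.pi) * ‖h z‖ₑ ^ 2 := by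
    rw [enorm_smul, enorm_pow, Real.enorm_of_nonneg (by positivity)]
  rw [← h2, ← h1]
  refine (enorm_integral_le_lintegral_enorm _).trans_eq ?_
  rw [← restrict_Ioo_eq_restrict_Ioc]
  refine lintegral_congr fun φ => ?_
  rw [enorm_pow, circleMap, exp_mul_I, ofReal_cos, ofReal_sin]

lemma MemH2C.bounded {h : ℂ → ℂ} {B : ℝ} (hh : MemH2C h B) {ε : ℝ} (hε : 0 < ε) :
    ∃ K : ℝ, ∀ z : ℂ, 1 / 2 + ε ≤ z.re → ‖h z‖ ≤ K := by
  obtain ⟨hd, hB⟩ := hh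
  set r := ε / 2 with hr
  have hr0 : 0 < r := by positivity
  set U : Set ℂ := {s : ℂ | 1 / 2 < s.re} with hU
  have hUm : MeasurableSet U := (isOpen_lt continuous_const continuous_re).measurableSet
  classical
  set H : ℂ → ℂ := U.piecewise h 0 with hH
  have hHm : Measurable H :=
    hd.continuousOn.measurable_piecewise continuousOn_const hUm
  have hHeq : ∀ s ∈ U, H s = h s := fun s hs => Set.piecewise_eq_of_mem _ _ _ hs
  set A : ENNReal := ENNReal.ofReal (2 * r) * ENNReal.ofReal (2 * Real.pi * B) with hA
  have key : ∀ z : ℂ, 1 / 2 + ε ≤ z.re →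
      ENNReal.ofReal (r / 2 * (r / 2) * (2 * Real.pi)) * ‖h z‖ₑ ^ 2 ≤ A := by
    intro z hz
    set V : Set ℂ := {w : ℂ | w.re ∈ Set.Ioo (-r) r} with hV
    have hVm : MeasurableSet V := measurable_re measurableSet_Ioo
    set f : ℂ → ENNReal := V.indicator fun w => ‖H (z + w)‖ₑ ^ 2 with hf
    have hfm : Measurable f :=
      ((hHm.comp (measurable_const_add z)).enorm.pow_const 2).indicator hVm
    have hup : ∫⁻ w, f w ≤ A := by
      rw [← (volume_preserving_equiv_real_prod.symm).lintegral_comp_emb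
        measurableEquivRealProd.symm.measurableEmbedding, Measure.volume_eq_prod]
      refine (lintegral_prod_le _).trans ?_
      have : ∀ x : ℝ, ∫⁻ y : ℝ, f (measurableEquivRealProd.symm (x, y)) ≤
          (Set.Ioo (-r) r).indicator (fun _ => ENNReal.ofReal (2 * Real.pi * B)) x := by
        intro x
        by_cases hx : x ∈ Set.Ioo (-r) r
        · rw [Set.indicator_of_mem hx]
          have hσ : 1 / 2 < z.re + x := by linarith [hx.1]
          refine le_trans (le_of_eq ?_) (hB (z.re + x) hσ)
          rw [← lintegral_add_left_eq_self
            (fun t : ℝ => (‖h (((z.re + x : ℝ) : ℂ) + t * I)‖₊ : ENNReal) ^ 2) z.im]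
          refine lintegral_congr fun y => ?_
          have hVmem : measurableEquivRealProd.symm (x, y) ∈ V := by
            simpa [hV] using hx
          rw [hf, Set.indicator_of_mem hVmem, hHeq]
          · have : z + measurableEquivRealProd.symm (x, y) =
                ((z.re + x : ℝ) : ℂ) + ((z.im + y : ℝ) : ℂ) * I := by
              apply Complex.ext <;> simp
            rw [this]; rfl
          · simp only [hU, Set.mem_ofPred_eq, add_re, measurableEquivRealProd_symm_apply]
            exact hσ
        · rw [Set.indicator_of_notMem hx]
          refine le_of_eq ?_
          rw [lintegral_eq_zero_of_ae_eq_zero]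
          refine Eventually.of_forall fun y => ?_
          have hVmem : measurableEquivRealProd.symm (x, y) ∉ V := by
            simpa [hV] using hx
          exact Set.indicator_of_notMem hVmem _
      refine (lintegral_mono this).trans_eq ?_
      rw [lintegral_indicator_const measurableSet_Ioo, Real.volume_Ioo, mul_comm, hA]
      congr 2; ring
    refine le_trans ?_ hup
    rw [← Complex.lintegral_comp_polarCoord_symm]
    have hsub : Set.Ioo (r / 2) r ×ˢ Set.Ioo (-Real.pi) Real.pi ⊆ polarCoord.target := by
      rintro ⟨ρ, φ⟩ ⟨h1, h2⟩
      exact ⟨lt_trans (by positivity : 0 < r / 2) h1.1, h2⟩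
    refine le_trans ?_ (lintegral_mono_set hsub)
    have hm : Measurable fun p : ℝ × ℝ => ENNReal.ofReal p.1 • f (Complex.polarCoord.symm p) := by
      have : Measurable fun p : ℝ × ℝ => Complex.polarCoord.symm p := by
        simp only [Complex.polarCoord_symm_apply]
        fun_prop
      exact (measurable_fst.ennreal_ofReal).smul (hfm.comp this)
    rw [Measure.volume_eq_prod, ← Measure.prod_restrict, lintegral_prod _ hm.aemeasurable]
    have hlow : ∀ ρ ∈ Set.Ioo (r / 2) r, ENNReal.ofReal (r / 2) *
        (ENNReal.ofReal (2 * Real.pi) * ‖h z‖ₑ ^ 2) ≤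
        ∫⁻ φ in Set.Ioo (-Real.pi) Real.pi,
          ENNReal.ofReal ρ • f (Complex.polarCoord.symm (ρ, φ)) := by
      intro ρ hρ
      have hρ0 : 0 < ρ := lt_trans (by positivity) hρ.1
      have hball : Metric.closedBall z ρ ⊆ U := by
        intro w hw
        have h1 : |(w - z).re| ≤ ρ :=
          (abs_re_le_norm _).trans (by simpa [dist_eq_norm] using hw)
        have h2 := (abs_le.1 h1).1
        simp only [sub_re] at h2
        simp only [hU, Set.mem_ofPred_eq]
        linarith [hρ.2]
      calc _ ≤ ENNReal.ofReal ρ * ∫⁻ φ in Set.Ioo (-Real.pi) Real.pi,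
              ‖h (z + ρ * (Real.cos φ + Real.sin φ * I))‖ₑ ^ 2 := by
            gcongr
            · exact hρ.1.le
            · exact two_pi_mul_enorm_sq_le hρ0 (hd.mono hball)
        _ = ∫⁻ φ in Set.Ioo (-Real.pi) Real.pi,
              ENNReal.ofReal ρ * ‖h (z + ρ * (Real.cos φ + Real.sin φ * I))‖ₑ ^ 2 := by
            rw [lintegral_const_mul' _ _ ENNReal.ofReal_ne_top]
        _ = _ := by
            refine lintegral_congr fun φ => ?_
            have hw : z + ρ * (Real.cos φ + Real.sin φ * I) ∈ U := hball (by
              rw [mem_closedBall_iff_norm]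
              rw [add_sub_cancel_left]
              simp [abs_of_pos hρ0])
            have hwV : (ρ * (Real.cos φ + Real.sin φ * I) : ℂ) ∈ V := by
              have : ‖(ρ * (Real.cos φ + Real.sin φ * I) : ℂ)‖ = |ρ| := by
                simp
              have h3 := abs_re_le_norm (ρ * (Real.cos φ + Real.sin φ * I) : ℂ)
              rw [this, abs_of_pos hρ0] at h3
              exact abs_lt.1 (h3.trans_lt hρ.2)
            rw [Complex.polarCoord_symm_apply, hf, Set.indicator_of_mem hwV, hHeq _ hw, smul_eq_mul]
    calc _ = ∫⁻ _ in Set.Ioo (r / 2) r, ENNReal.ofReal (r / 2) *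
        (ENNReal.ofReal (2 * Real.pi) * ‖h z‖ₑ ^ 2) := by
          rw [setLIntegral_const, Real.volume_Ioo, show r - r / 2 = r / 2 by ring,
            ENNReal.ofReal_mul (by positivity), ENNReal.ofReal_mul (by positivity)]
          ring
      _ ≤ _ := setLIntegral_mono' measurableSet_Ioo hlow
  have hc0 : 0 < r / 2 * (r / 2) * (2 * Real.pi) := by positivity
  refine ⟨Real.sqrt (A.toReal / (r / 2 * (r / 2) * (2 * Real.pi))), fun z hz => ?_⟩
  apply Real.le_sqrt_of_sq_le
  rw [le_div_iff₀ hc0, mul_comm]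
  have h1 := ENNReal.toReal_mono (ENNReal.mul_ne_top ENNReal.ofReal_ne_top ENNReal.ofReal_ne_top)
    (key z hz)
  rwa [ENNReal.toReal_mul, ENNReal.toReal_ofReal hc0.le, ENNReal.toReal_pow, toReal_enorm] at h1

lemma MemH2C.norm_sum_sq_le {h : ℂ → ℂ} {B : ℝ} (hB : 0 ≤ B) (hh : MemH2C h B) {ι : Type*}
    (F : Finset ι) (a c : ι → ℂ) (ha : ∀ j ∈ F, 0 < (a j).re) :
    ‖∑ j ∈ F, c j * h (1 / 2 + a j)‖ ^ 2 ≤ B * (cauchyForm F a c).re := by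
  have hstep : ∀ ε : ℝ, 0 < ε → ε < 1 → (∀ j ∈ F, ε < (a j).re) →
      ‖∑ j ∈ F, c j * (h (1 / 2 + a j) / (1 + ε * (a j - ε)))‖ ^ 2 ≤
        B * (cauchyForm F (fun j => a j - ε) c).re := by
    intro ε hε hε1 hεa
    obtain ⟨K, hK⟩ := hh.bounded hε
    have hden : ∀ z : ℂ, -ε < z.re → 0 < (1 + ε * z).re := by
      intro z hz
      simp
      nlinarith
    set g : ℂ → ℂ := fun z => h (1 / 2 + ε + z) / (1 + ε * z) with hgdef
    have hg : HalfPlaneDecay g := by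
      refine ⟨⟨ε, hε, ?_⟩, |K| * (1 + 1 / ε), ?_⟩
      · refine DifferentiableOn.div ?_ (by fun_prop) ?_
        · refine hh.1.comp (by fun_prop) ?_
          intro z hz
          simp at hz ⊢
          linarith
        · intro z hz h0
          have := hden z hz
          rw [h0] at this
          simp at this
      · intro z hz
        have h1 := hK (1 / 2 + ε + z) (by simp [hz])
        have hre : 1 ≤ (1 + ε * z).re := by simp; positivity
        have hd1 : 1 ≤ ‖1 + ε * z‖ := hre.trans (re_le_norm _)
        have hd2 : ‖z‖ ≤ ‖1 + ε * z‖ / ε := by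
          rw [le_div_iff₀ hε]
          refine le_of_sq_le_sq ?_ (norm_nonneg _)
          rw [mul_pow, Complex.sq_norm, Complex.sq_norm, normSq_apply, normSq_apply]
          simp
          nlinarith [mul_nonneg hε.le hz]
        have hz1 : 0 < ‖1 + z‖ := by
          have := re_le_norm (1 + z); simp at this; linarith
        rw [hgdef]
        simp only [norm_div]
        rw [div_le_div_iff₀ (by linarith) hz1]
        calc _ ≤ |K| * ((1 + 1 / ε) * ‖1 + ε * z‖) := by
              refine mul_le_mul (h1.trans (le_abs_self _)) ?_ (norm_nonneg _) (abs_nonneg _)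
              calc ‖1 + z‖ ≤ 1 + ‖z‖ := by simpa using norm_add_le 1 z
                _ ≤ ‖1 + ε * z‖ + ‖1 + ε * z‖ / ε := add_le_add hd1 hd2
                _ = _ := by ring
          _ = _ := by ring
    have hmain := norm_sum_sq_le_of_halfPlaneDecay F (fun j => a j - ε) c
      (fun j hj => by simpa using hεa j hj) hg
    have hInt : ∫ t : ℝ, ‖g (t * I)‖ ^ 2 ≤ 2 * Real.pi * B := by
      have hi : Integrable fun t : ℝ => ‖g (t * I)‖ ^ 2 := by
        have := hg.memLp
        rwa [memLp_two_iff_integrable_sq_norm this.1] at this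
      rw [integral_eq_lintegral_of_nonneg_ae (Eventually.of_forall fun t => by positivity) hi.1]
      refine ENNReal.toReal_le_of_le_ofReal (by positivity) (le_trans ?_ (hh.2 (1 / 2 + ε)
        (by linarith)))
      refine lintegral_mono fun t => ?_
      rw [← enorm_eq_nnnorm, ← ofReal_norm, ← ENNReal.ofReal_pow (norm_nonneg _)]
      refine ENNReal.ofReal_le_ofReal ?_
      refine pow_le_pow_left₀ (norm_nonneg _) ?_ 2
      rw [hgdef]
      simp only [norm_div]
      have hd1 : 1 ≤ ‖(1 + ε * (t * I) : ℂ)‖ := by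
        refine le_trans ?_ (re_le_norm _); simp
      refine (div_le_self (norm_nonneg _) hd1).trans_eq ?_
      push_cast
      rfl
    have hgram : 0 ≤ (cauchyForm F (fun j => a j - ε) c).re := by
      exact cauchyForm_re_nonneg F _ c fun j hj => by simpa using hεa j hj
    have hsum : ∑ j ∈ F, c j * g (a j - ε) =
        ∑ j ∈ F, c j * (h (1 / 2 + a j) / (1 + ε * (a j - ε))) := by
      refine Finset.sum_congr rfl fun j _ => ?_
      rw [hgdef]
      simp only
      rw [show (1 / 2 + ε + (a j - ε) : ℂ) = 1 / 2 + a j by ring]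
    rw [hsum] at hmain
    have h2 := hmain.trans (mul_le_mul_of_nonneg_right hInt hgram)
    have : 0 < 2 * Real.pi := by positivity
    nlinarith
  have hev : ∀ᶠ ε : ℝ in nhdsWithin 0 (Set.Ioi 0), 0 < ε ∧ ε < 1 ∧ ∀ j ∈ F, ε < (a j).re := by
    have h1 : ∀ᶠ ε : ℝ in nhdsWithin 0 (Set.Ioi 0), 0 < ε := self_mem_nhdsWithin
    have h2 : ∀ x : ℝ, 0 < x → ∀ᶠ ε : ℝ in nhdsWithin 0 (Set.Ioi 0), ε < x := fun x hx =>
      nhdsWithin_le_nhds (Iio_mem_nhds hx)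
    exact h1.and ((h2 1 one_pos).and ((Finset.eventually_all F).2 fun j hj => h2 _ (ha j hj)))
  have hofReal : Tendsto (fun ε : ℝ => (ε : ℂ)) (nhdsWithin 0 (Set.Ioi 0)) (nhds 0) :=
    (continuous_ofReal.tendsto' 0 0 rfl).mono_left nhdsWithin_le_nhds
  have hL : Tendsto (fun ε : ℝ => ‖∑ j ∈ F, c j * (h (1 / 2 + a j) / (1 + ε * (a j - ε)))‖ ^ 2)
      (nhdsWithin 0 (Set.Ioi 0)) (nhds (‖∑ j ∈ F, c j * h (1 / 2 + a j)‖ ^ 2)) := by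
    refine (Tendsto.norm (tendsto_finsetSum _ fun j _ => ?_)).pow 2
    refine Tendsto.const_mul _ ?_
    have : Tendsto (fun ε : ℝ => (1 + ε * (a j - ε) : ℂ)) (nhdsWithin 0 (Set.Ioi 0))
        (nhds (1 + 0 * (a j - 0))) :=
      tendsto_const_nhds.add (hofReal.mul (tendsto_const_nhds.sub hofReal))
    have h2 : Tendsto (fun ε : ℝ => h (1 / 2 + a j) / (1 + ε * (a j - ε)))
        (nhdsWithin 0 (Set.Ioi 0)) (nhds (h (1 / 2 + a j) / (1 + 0 * (a j - 0)))) :=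
      tendsto_const_nhds.div this (by simp)
    simpa using h2
  have hR : Tendsto (fun ε : ℝ => B * (cauchyForm F (fun j => a j - ε) c).re)
      (nhdsWithin 0 (Set.Ioi 0)) (nhds (B * (cauchyForm F a c).re)) := by
    refine Tendsto.const_mul _ ((continuous_re.tendsto _).comp ?_)
    refine tendsto_finsetSum _ fun j hj => tendsto_finsetSum _ fun k hk => ?_
    refine Tendsto.div tendsto_const_nhds ?_ ?_
    · have : Tendsto (fun ε : ℝ => (a j - ε + (starRingEnd ℂ) (a k - ε) : ℂ))
          (nhdsWithin 0 (Set.Ioi 0)) (nhds (a j - 0 + (starRingEnd ℂ) (a k - 0))) :=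
        (tendsto_const_nhds.sub hofReal).add
          ((continuous_conj.tendsto _).comp (tendsto_const_nhds.sub hofReal))
      simpa using this
    · intro h0
      have := congrArg re h0
      simp at this
      linarith [ha j hj, ha k hk]
  exact le_of_tendsto_of_tendsto hL hR (hev.mono fun ε hε => hstep ε hε.1 hε.2.1 hε.2.2)

lemma MemH2C.mono {h : ℂ → ℂ} {B B' : ℝ} (hh : MemH2C h B) (hB : B ≤ B') : MemH2C h B' :=
  ⟨hh.1, fun σ hσ => (hh.2 σ hσ).trans <| ENNReal.ofReal_le_ofReal <|
    mul_le_mul_of_nonneg_left hB (by positivity)⟩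

/-- An interpolation bound yields a lower (Riesz) bound for the Gram form. -/
lemma IsInterpBoundC.sum_le_cauchyForm {ι : Type*} {s : ι → ℂ} {M : ℝ} (hM : IsInterpBoundC s M)
    (hs : ∀ j, 1 / 2 < (s j).re) (F : Finset ι) (c : ι → ℂ) :
    ∑ j ∈ F, ‖c j‖ ^ 2 / (2 * (s j).re - 1) ≤
      M ^ 2 * (cauchyForm F (fun j => s j - 1 / 2) c).re := by
  classical
  have hw : ∀ j, 0 < 2 * (s j).re - 1 := fun j => by linarith [hs j]
  set G := ∑ j ∈ F, ‖c j‖ ^ 2 / (2 * (s j).re - 1) with hG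
  have hG0 : 0 ≤ G := Finset.sum_nonneg fun j _ => div_nonneg (by positivity) (hw j).le
  have ha : ∀ j ∈ F, 0 < (s j - 1 / 2).re := fun j _ => by
    have := hs j
    norm_num at this ⊢
    linarith
  have hpos := cauchyForm_re_nonneg F (fun j => s j - 1 / 2) c ha
  set α : ι → ℂ := fun j => if j ∈ F then (starRingEnd ℂ) (c j) / ((2 * (s j).re - 1 : ℝ) : ℂ)
    else 0 with hα
  have hα0 : ∀ j ∉ F, ‖α j‖ ^ 2 * (2 * (s j).re - 1) = 0 := fun j hj => by simp [hα, hj]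
  have hsum : ∑' j, ‖α j‖ ^ 2 * (2 * (s j).re - 1) = G := by
    rw [tsum_eq_sum hα0]
    refine Finset.sum_congr rfl fun j hj => ?_
    simp only [hα, hj, if_true, norm_div, norm_conj, norm_real, Real.norm_of_nonneg (hw j).le]
    have := (hw j).ne'
    field_simp
  obtain ⟨h, B, hh, hval, hB⟩ := hM α (summable_of_ne_finset_zero hα0)
  rw [hsum] at hB
  have key := (hh.mono hB).norm_sum_sq_le (by positivity) F (fun j => s j - 1 / 2) c ha
  have hsum2 : ∑ j ∈ F, c j * h (1 / 2 + (s j - 1 / 2)) = (G : ℂ) := by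
    rw [hG, ofReal_sum]
    refine Finset.sum_congr rfl fun j hj => ?_
    rw [add_sub_cancel, hval]
    simp only [hα, hj, if_true]
    rw [mul_div_assoc', mul_conj, normSq_eq_norm_sq]
    push_cast
    rfl
  rw [hsum2, norm_real, Real.norm_of_nonneg hG0] at key
  rcases hG0.eq_or_lt with h0 | h0
  · rw [← h0]; positivity
  · nlinarith

/-- Multiplying by a Blaschke factor: coefficients of an orthogonal projection whose Gram form is
that of a single kernel. -/
lemma exists_cauchyForm_eq {ι : Type*} [DecidableEq ι] (a : ι → ℂ) (hinj : Function.Injective a)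
    (ha : ∀ j, 0 < (a j).re) (j : ι) (F : Finset ι) (hj : j ∉ F) :
    ∃ c : ι → ℂ, cauchyForm (insert j F) a c = 1 / (2 * (a j).re : ℝ) ∧
      ‖c j‖ ^ 2 = ∏ k ∈ F, ‖(a j + (starRingEnd ℂ) (a k)) / (a j - a k)‖ ^ 2 := by
  induction F using Finset.induction_on with
  | empty =>
    refine ⟨fun _ => 1, ?_, by simp⟩
    simp [cauchyForm, add_conj]
  | insert b F hb ih =>
    obtain ⟨c, hc1, hc2⟩ := ih fun h => hj (Finset.mem_insert_of_mem h)
    have hjb : j ≠ b := fun h => hj (h ▸ Finset.mem_insert_self b F)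
    have hbG : b ∉ insert j F := by simp [hb, hjb.symm]
    set G := insert j F with hG
    set P : ι → ℂ := fun k => (a k + (starRingEnd ℂ) (a b)) / (a k - a b) with hP
    set Q : ι → ℂ := fun k => (a b + (starRingEnd ℂ) (a b)) / (a b - a k) with hQ
    set c' : ι → ℂ := fun k => if k = b then ∑ i ∈ G, c i * Q i else c k * P k with hc'
    have hc'b : c' b = ∑ i ∈ G, c i * Q i := by simp [hc']
    have hc'G : ∀ k ∈ G, c' k = c k * P k := fun k hk => by
      have : k ≠ b := fun h => hbG (h ▸ hk)
      simp [hc', this]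
    refine ⟨c', ?_, ?_⟩
    · rw [← hc1, Finset.insert_comm, ← hG]
      have hne : ∀ i k, a i + (starRingEnd ℂ) (a k) ≠ 0 := fun i k h0 => by
        have := congrArg re h0
        simp at this
        linarith [ha i, ha k]
      unfold cauchyForm
      rw [Finset.sum_insert hbG, Finset.sum_insert hbG]
      simp_rw [Finset.sum_insert hbG]
      have e1 : c' b * (starRingEnd ℂ) (c' b) / (a b + (starRingEnd ℂ) (a b)) =
          ∑ i ∈ G, ∑ k ∈ G, c i * (starRingEnd ℂ) (c k) *
            (Q i * (starRingEnd ℂ) (Q k) / (a b + (starRingEnd ℂ) (a b))) := by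
        rw [hc'b, map_sum, Finset.sum_mul_sum, Finset.sum_div]
        refine Finset.sum_congr rfl fun i _ => ?_
        rw [Finset.sum_div]
        refine Finset.sum_congr rfl fun k _ => ?_
        rw [map_mul]; ring
      have e2 : ∑ k ∈ G, c' b * (starRingEnd ℂ) (c' k) / (a b + (starRingEnd ℂ) (a k)) =
          ∑ i ∈ G, ∑ k ∈ G, c i * (starRingEnd ℂ) (c k) *
            (Q i * (starRingEnd ℂ) (P k) / (a b + (starRingEnd ℂ) (a k))) := by
        rw [Finset.sum_comm]
        refine Finset.sum_congr rfl fun k hk => ?_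
        rw [hc'b, hc'G k hk, Finset.sum_mul, Finset.sum_div]
        refine Finset.sum_congr rfl fun i _ => ?_
        rw [map_mul]; ring
      rw [e1, e2, ← Finset.sum_add_distrib, ← Finset.sum_add_distrib]
      refine Finset.sum_congr rfl fun i hi => ?_
      have e3 : c' i * (starRingEnd ℂ) (c' b) / (a i + (starRingEnd ℂ) (a b)) =
          ∑ k ∈ G, c i * (starRingEnd ℂ) (c k) *
            (P i * (starRingEnd ℂ) (Q k) / (a i + (starRingEnd ℂ) (a b))) := by
        rw [hc'b, hc'G i hi, map_sum, Finset.mul_sum, Finset.sum_div]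
        refine Finset.sum_congr rfl fun k _ => ?_
        rw [map_mul]; ring
      rw [e3, ← Finset.sum_add_distrib, ← Finset.sum_add_distrib, ← Finset.sum_add_distrib]
      refine Finset.sum_congr rfl fun k hk => ?_
      rw [hc'G i hi, hc'G k hk]
      have hib : a i - a b ≠ 0 := sub_ne_zero.2 fun h => hbG (hinj h ▸ hi)
      have hkb : (starRingEnd ℂ) (a k) - (starRingEnd ℂ) (a b) ≠ 0 := by
        rw [← map_sub]
        exact (map_ne_zero _).2 (sub_ne_zero.2 fun h => hbG (hinj h ▸ hk))
      have h1 := hne i k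
      have h2 := hne i b
      have h3 := hne b k
      have h4 := hne b b
      simp only [hP, hQ, map_mul, map_div₀, map_add, map_sub, conj_conj]
      generalize (starRingEnd ℂ) (a k) = x at *
      generalize (starRingEnd ℂ) (a b) = y at *
      generalize (starRingEnd ℂ) (c k) = z at *
      have hib' : a b - a i ≠ 0 := fun h => hib (by rw [← neg_sub, h, neg_zero])
      have hkb' : y - x ≠ 0 := fun h => hkb (by rw [← neg_sub, h, neg_zero])
      rw [show a b - a i = -(a i - a b) by ring, show y - x = -(x - y) by ring]
      field_simp
      ring
    · rw [Finset.prod_insert hb, hc'G j (Finset.mem_insert_self j F), norm_mul, mul_pow, hc2,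
        mul_comm]

lemma norm_add_conj_sq (x y : ℂ) :
    ‖x + (starRingEnd ℂ) y‖ ^ 2 = ‖x - y‖ ^ 2 + 4 * x.re * y.re := by
  rw [Complex.sq_norm, Complex.sq_norm, normSq_apply, normSq_apply]
  simp
  ring

lemma one_add_sum_le_prod {ι : Type*} (F : Finset ι) (x : ι → ℝ) (hx : ∀ i ∈ F, 0 ≤ x i) :
    1 + ∑ i ∈ F, x i ≤ ∏ i ∈ F, (1 + x i) := by
  classical
  induction F using Finset.induction_on with
  | empty => simp
  | insert b F hb ih =>
    have h1 := ih fun i hi => hx i (Finset.mem_insert_of_mem hi)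
    have h2 : 0 ≤ ∑ i ∈ F, x i := Finset.sum_nonneg fun i hi => hx i (Finset.mem_insert_of_mem hi)
    have h3 := hx b (Finset.mem_insert_self b F)
    rw [Finset.sum_insert hb, Finset.prod_insert hb]
    nlinarith

/-- The Carleson-type bound for the pseudohyperbolic quantities of an interpolating sequence. -/
lemma IsInterpBoundC.sum_le {ι : Type*} {s : ι → ℂ} {M : ℝ} (hM : IsInterpBoundC s M)
    (hs : ∀ j, 1 / 2 < (s j).re) (hinj : Function.Injective s) (j : ι) (F : Finset ι)
    (hj : j ∉ F) :
    1 + ∑ k ∈ F, (2 * (s j).re - 1) * (2 * (s k).re - 1) /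
      ‖s j - 1 / 2 + (starRingEnd ℂ) (s k - 1 / 2)‖ ^ 2 ≤ M ^ 2 := by
  classical
  set a : ι → ℂ := fun j => s j - 1 / 2 with ha_def
  have hw : ∀ k, 2 * (a k).re = 2 * (s k).re - 1 := fun k => by simp [ha_def]; ring
  have ha : ∀ k, 0 < (a k).re := fun k => by linarith [hw k, hs k]
  have hainj : Function.Injective a := fun x y h => hinj (sub_left_injective h)
  obtain ⟨c, hc1, hc2⟩ := exists_cauchyForm_eq a hainj ha j F hj
  have h := hM.sum_le_cauchyForm hs (insert j F) c
  rw [← ha_def, hc1, show (1 / ((2 * (a j).re : ℝ) : ℂ)).re = 1 / (2 * (a j).re) by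
    rw [← ofReal_one, ← ofReal_div, ofReal_re]] at h
  have h1 : ‖c j‖ ^ 2 / (2 * (s j).re - 1) ≤ M ^ 2 * (1 / (2 * (a j).re)) :=
    le_trans (Finset.single_le_sum (f := fun j => ‖c j‖ ^ 2 / (2 * (s j).re - 1))
      (fun k _ => div_nonneg (by positivity) (by linarith [hs k]))
      (Finset.mem_insert_self j F)) h
  rw [← hw, mul_one_div, div_le_div_iff_of_pos_right (by linarith [ha j])] at h1
  refine le_trans ?_ (hc2 ▸ h1)
  refine (one_add_sum_le_prod F _ fun k _ => ?_).trans (Finset.prod_le_prod ?_ ?_)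
  · exact div_nonneg (mul_nonneg (by linarith [hs j]) (by linarith [hs k])) (by positivity)
  · intro k _
    have := div_nonneg (mul_nonneg (by linarith [hs j] : 0 ≤ 2 * (s j).re - 1)
      (by linarith [hs k] : 0 ≤ 2 * (s k).re - 1))
      (sq_nonneg ‖a j + (starRingEnd ℂ) (a k)‖)
    simp only [ha_def] at this
    linarith
  · intro k hk
    have hjk : 0 < ‖a j - a k‖ ^ 2 := by
      have : a j - a k ≠ 0 := sub_ne_zero.2 fun h => hj (hainj h ▸ hk)
      positivity
    have hE := norm_add_conj_sq (a j) (a k)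
    have hpos : 0 < 4 * (a j).re * (a k).re := by
      have := mul_pos (ha j) (ha k); linarith
    change 1 + _ / ‖a j + (starRingEnd ℂ) (a k)‖ ^ 2 ≤ _
    rw [norm_div, div_pow, ← hw, ← hw, le_div_iff₀ hjk]
    set E := ‖a j + (starRingEnd ℂ) (a k)‖ ^ 2
    have hE0 : 0 < E := by linarith
    rw [show (1 + 2 * (a j).re * (2 * (a k).re) / E) * ‖a j - a k‖ ^ 2 =
      (E ^ 2 - (4 * (a j).re * (a k).re) ^ 2) / E by
        rw [show ‖a j - a k‖ ^ 2 = E - 4 * (a j).re * (a k).re by linarith]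
        field_simp; ring]
    rw [div_le_iff₀ hE0]
    nlinarith

lemma IsInterpBoundC.one_le_sq {ι : Type*} {s : ι → ℂ} {M : ℝ} (hM : IsInterpBoundC s M)
    (hs : ∀ j, 1 / 2 < (s j).re) (hinj : Function.Injective s) (j : ι) : 1 ≤ M ^ 2 := by
  simpa using hM.sum_le hs hinj j ∅ (by simp)

/-- Points of an interpolating sequence lying below and near a given point have
total height bounded by a multiple of its height. -/
lemma IsInterpBoundC.local_sum_le {ι : Type*} {s : ι → ℂ} {M : ℝ} (hM : IsInterpBoundC s M)
    (hs : ∀ j, 1 / 2 < (s j).re) (hinj : Function.Injective s) (j : ι) (F : Finset ι)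
    (h1 : ∀ k ∈ F, (s k).re ≤ (s j).re)
    (h2 : ∀ k ∈ F, |(s k).im - (s j).im| ≤ 2 * (2 * (s j).re - 1)) :
    ∑ k ∈ F, (2 * (s k).re - 1) ≤ 5 * M ^ 2 * (2 * (s j).re - 1) := by
  classical
  have hw : ∀ k, 0 < 2 * (s k).re - 1 := fun k => by linarith [hs k]
  have key := hM.sum_le hs hinj j (F.erase j) (by simp)
  have hpt : ∀ k ∈ F.erase j, (2 * (s k).re - 1) / (5 * (2 * (s j).re - 1)) ≤
      (2 * (s j).re - 1) * (2 * (s k).re - 1) /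
      ‖s j - 1 / 2 + (starRingEnd ℂ) (s k - 1 / 2)‖ ^ 2 := by
    intro k hk
    have hkF := Finset.mem_of_mem_erase hk
    have hE : ‖s j - 1 / 2 + (starRingEnd ℂ) (s k - 1 / 2)‖ ^ 2 =
        ((s j).re + (s k).re - 1) ^ 2 + ((s k).im - (s j).im) ^ 2 := by
      rw [Complex.sq_norm, normSq_apply]
      simp
      ring
    have hpos : 0 < ((s j).re + (s k).re - 1) ^ 2 := by
      have : 0 < (s j).re + (s k).re - 1 := by linarith [hs j, hs k]
      positivity
    have hub : ((s j).re + (s k).re - 1) ^ 2 + ((s k).im - (s j).im) ^ 2 ≤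
        5 * (2 * (s j).re - 1) ^ 2 := by
      have e1 : ((s j).re + (s k).re - 1) ^ 2 ≤ (2 * (s j).re - 1) ^ 2 :=
        pow_le_pow_left₀ (by linarith [hs j, hs k]) (by linarith [h1 k hkF]) 2
      have e2 : ((s k).im - (s j).im) ^ 2 ≤ (2 * (2 * (s j).re - 1)) ^ 2 := by
        rw [← sq_abs]
        exact pow_le_pow_left₀ (abs_nonneg _) (h2 k hkF) 2
      linarith
    rw [hE, div_le_div_iff₀ (by linarith [hw j]) (by positivity)]
    calc _ ≤ (2 * (s k).re - 1) * (5 * (2 * (s j).re - 1) ^ 2) :=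
          mul_le_mul_of_nonneg_left hub (hw k).le
      _ = _ := by ring
  have h3 := add_le_add_right (Finset.sum_le_sum hpt) 1
  have h4 : 1 + ∑ k ∈ F.erase j, (2 * (s k).re - 1) / (5 * (2 * (s j).re - 1)) ≤ M ^ 2 :=
    le_trans h3 key
  rw [← Finset.sum_div] at h4
  have h5 : ∑ k ∈ F, (2 * (s k).re - 1) ≤
      (2 * (s j).re - 1) + ∑ k ∈ F.erase j, (2 * (s k).re - 1) := by
    by_cases hj : j ∈ F
    · exact (Finset.add_sum_erase F (fun k => 2 * (s k).re - 1) hj).ge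
    · rw [Finset.erase_eq_of_notMem hj]; linarith [hw j]
  have h6 : 0 < 5 * (2 * (s j).re - 1) := by linarith [hw j]
  have h7 := div_le_iff₀ h6 |>.1 (by linarith : (∑ k ∈ F.erase j, (2 * (s k).re - 1)) /
    (5 * (2 * (s j).re - 1)) ≤ M ^ 2 - 1)
  nlinarith [hw j]

/-- Greedy selection of points with disjoint shadows carrying the whole mass. -/
lemma exists_disjoint_shadow {ι : Type*} (y w : ι → ℝ) (hw : ∀ j, 0 < w j) {K : ℝ}
    (hloc : ∀ (j : ι) (F : Finset ι), (∀ k ∈ F, w k ≤ w j) → (∀ k ∈ F, |y k - y j| ≤ 2 * w j) →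
      ∑ k ∈ F, w k ≤ K * w j) (F : Finset ι) :
    ∃ G ⊆ F, (G : Set ι).PairwiseDisjoint (fun j => Set.Ioo (y j - w j) (y j + w j)) ∧
      ∑ k ∈ F, w k ≤ K * ∑ k ∈ G, w k := by
  classical
  induction F using Finset.strongInduction with
  | H F ih =>
    rcases F.eq_empty_or_nonempty with rfl | hF
    · exact ⟨∅, by simp⟩
    obtain ⟨j, hjF, hj⟩ := F.exists_max_image w hF
    set N := F.filter fun k => |y k - y j| ≤ 2 * w j with hN
    set F' := F.filter fun k => ¬ |y k - y j| ≤ 2 * w j with hF'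
    have hjN : j ∈ N := by simp [hN, hjF, (hw j).le]
    have hjF' : j ∉ F' := by simp [hF', (hw j).le]
    have hss : F' ⊂ F := by
      refine (Finset.ssubset_iff_of_subset (Finset.filter_subset _ _)).2 ⟨j, hjF, hjF'⟩
    obtain ⟨G, hGF, hGd, hGs⟩ := ih F' hss
    have hjG : j ∉ G := fun h => hjF' (hGF h)
    refine ⟨insert j G, ?_, ?_, ?_⟩
    · exact Finset.insert_subset hjF (hGF.trans (Finset.filter_subset _ _))
    · rw [Finset.coe_insert, Set.pairwiseDisjoint_insert]
      refine ⟨hGd, fun k hk _ => ?_⟩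
      have hkF := hGF hk
      rw [hF', Finset.mem_filter, not_le] at hkF
      rw [Set.disjoint_left]
      rintro x ⟨h1, h2⟩ ⟨h3, h4⟩
      have := hj k hkF.1
      rcases abs_cases (y k - y j) with h | h <;> linarith [hkF.2]
    · rw [Finset.sum_insert hjG, mul_add,
        ← Finset.sum_filter_add_sum_filter_not F (fun k => |y k - y j| ≤ 2 * w j) w]
      refine add_le_add (hloc j N ?_ ?_) hGs
      · exact fun k hk => hj k (Finset.mem_of_mem_filter k hk)
      · exact fun k hk => (Finset.mem_filter.1 hk).2

lemma sum_le_of_disjoint_Ioo {ι : Type*} (y w : ι → ℝ) (hw : ∀ j, 0 < w j) (G : Finset ι) {L : ℝ}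
    (hL : 0 ≤ L) (hG : ∀ j ∈ G, |y j| + w j ≤ L)
    (hd : (G : Set ι).PairwiseDisjoint (fun j => Set.Ioo (y j - w j) (y j + w j))) :
    ∑ k ∈ G, w k ≤ L := by
  have h1 : volume (⋃ j ∈ G, Set.Ioo (y j - w j) (y j + w j)) ≤ volume (Set.Ioo (-L) L) := by
    refine measure_mono (Set.iUnion₂_subset fun j hj => Set.Ioo_subset_Ioo ?_ ?_)
    · linarith [hG j hj, neg_abs_le (y j)]
    · linarith [hG j hj, le_abs_self (y j)]
  rw [measure_biUnion_finset hd fun _ _ => measurableSet_Ioo] at h1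
  simp_rw [Real.volume_Ioo] at h1
  rw [← ENNReal.ofReal_sum_of_nonneg fun j _ => by linarith [hw j],
    ENNReal.ofReal_le_ofReal_iff (by linarith)] at h1
  have : ∑ k ∈ G, (y k + w k - (y k - w k)) = 2 * ∑ k ∈ G, w k := by
    rw [Finset.mul_sum]; exact Finset.sum_congr rfl fun _ _ => by ring
  linarith

/-- The Carleson measure bound on a box. -/
lemma IsInterpBoundC.sum_box_le {ι : Type*} {s : ι → ℂ} {M : ℝ} (hM : IsInterpBoundC s M)
    (hs : ∀ j, 1 / 2 < (s j).re) (hinj : Function.Injective s) (F : Finset ι) {L : ℝ} (hL : 0 ≤ L)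
    (hF : ∀ j ∈ F, |(s j).im| + (2 * (s j).re - 1) ≤ L) :
    ∑ k ∈ F, (2 * (s k).re - 1) ≤ 5 * M ^ 2 * L := by
  have hw : ∀ k, 0 < 2 * (s k).re - 1 := fun k => by linarith [hs k]
  obtain ⟨G, hGF, hGd, hGs⟩ := exists_disjoint_shadow (fun j => (s j).im)
    (fun j => 2 * (s j).re - 1) hw (K := 5 * M ^ 2)
    (fun j F h1 h2 => hM.local_sum_le hs hinj j F (fun k hk => by linarith [h1 k hk]) h2) F
  refine hGs.trans (mul_le_mul_of_nonneg_left ?_ (by positivity))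
  exact sum_le_of_disjoint_Ioo _ _ hw G hL (fun j hj => hF j (hGF hj)) hGd

lemma norm_natCast_cpow_sub_le {n : ℕ} (hn : 1 ≤ n) {s : ℂ} (hs : 0 < s.re) {x : ℝ}
    (hx : x ∈ Set.Icc (n : ℝ) (n + 1)) :
    ‖(x : ℂ) ^ (-s) - (n : ℂ) ^ (-s)‖ ≤ ‖s‖ * (n : ℝ) ^ (-s.re - 1) := by
  have hn0 : (0 : ℝ) < n := by exact_mod_cast hn
  have hs0 : s ≠ 0 := fun h => by simp [h] at hs
  have hd : ∀ y ∈ Set.Icc (n : ℝ) (n + 1),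
      HasDerivWithinAt (fun y : ℝ => (y : ℂ) ^ (-s)) (-s * (y : ℂ) ^ (-s - 1))
        (Set.Icc (n : ℝ) (n + 1)) y := by
    intro y hy
    have hy0 : y ≠ 0 := (hn0.trans_le hy.1).ne'
    exact (hasDerivAt_ofReal_cpow_const hy0 (by simpa using hs0)).hasDerivWithinAt
  have hb : ∀ y ∈ Set.Icc (n : ℝ) (n + 1),
      ‖-s * (y : ℂ) ^ (-s - 1)‖ ≤ ‖s‖ * (n : ℝ) ^ (-s.re - 1) := by
    intro y hy
    have hy0 : 0 < y := hn0.trans_le hy.1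
    rw [norm_mul, norm_neg, norm_cpow_eq_rpow_re_of_pos hy0]
    refine mul_le_mul_of_nonneg_left ?_ (norm_nonneg _)
    simpa using Real.rpow_le_rpow_of_nonpos hn0 hy.1 (by linarith : -s.re - 1 ≤ 0)
  have h := (convex_Icc (n : ℝ) (n + 1)).norm_image_sub_le_of_norm_hasDerivWithin_le hd hb
    (Set.left_mem_Icc.2 (by linarith)) hx
  rw [ofReal_natCast] at h
  refine h.trans (mul_le_of_le_one_right (by positivity) ?_)
  rw [Real.norm_of_nonneg (by linarith [hx.1])]
  linarith [hx.2]

lemma conj_ofReal_cpow {x : ℝ} (hx : 0 < x) (s : ℂ) :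
    (starRingEnd ℂ) ((x : ℂ) ^ s) = (x : ℂ) ^ ((starRingEnd ℂ) s) := by
  rw [cpow_conj _ _ (by rw [arg_ofReal_of_nonneg hx.le]; exact Real.pi_pos.ne), conj_ofReal]

/-- The squared norm on a half-line of a combination of powers is a Gram form of Cauchy kernels. -/
lemma integral_norm_sq_sum_cpow {ι : Type*} (F : Finset ι) {s : ι → ℂ} (c : ι → ℂ)
    (hs : ∀ j, 1 / 2 < (s j).re) {N : ℝ} (hN : 0 < N) :
    IntegrableOn (fun x : ℝ => ‖∑ j ∈ F, c j * (x : ℂ) ^ (-s j)‖ ^ 2) (Set.Ioi N) ∧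
    ∫ x in Set.Ioi N, ‖∑ j ∈ F, c j * (x : ℂ) ^ (-s j)‖ ^ 2 =
      (cauchyForm F (fun j => s j - 1 / 2) (fun j => c j * (N : ℂ) ^ (-(s j - 1 / 2)))).re := by
  have e : ∀ x ∈ Set.Ioi N, ((‖∑ j ∈ F, c j * (x : ℂ) ^ (-s j)‖ ^ 2 : ℝ) : ℂ) =
      ∑ j ∈ F, ∑ k ∈ F, c j * (starRingEnd ℂ) (c k) *
        (x : ℂ) ^ (-(s j + (starRingEnd ℂ) (s k))) := by
    intro x hx
    have hx0 : 0 < x := hN.trans hx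
    rw [← normSq_eq_norm_sq, ← mul_conj, map_sum, Finset.sum_mul_sum]
    refine Finset.sum_congr rfl fun j _ => Finset.sum_congr rfl fun k _ => ?_
    rw [map_mul, conj_ofReal_cpow hx0, neg_add, cpow_add _ _ (by exact_mod_cast hx0.ne'), map_neg]
    ring
  have hre : ∀ j k, (-(s j + (starRingEnd ℂ) (s k))).re < -1 := fun j k => by
    simp; linarith [hs j, hs k]
  have hi : ∀ j k, IntegrableOn (fun x : ℝ => c j * (starRingEnd ℂ) (c k) *
      (x : ℂ) ^ (-(s j + (starRingEnd ℂ) (s k)))) (Set.Ioi N) := fun j k =>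
    (integrableOn_Ioi_cpow_of_lt (hre j k) hN).const_mul _
  have hI : IntegrableOn (fun x : ℝ => ∑ j ∈ F, ∑ k ∈ F, c j * (starRingEnd ℂ) (c k) *
      (x : ℂ) ^ (-(s j + (starRingEnd ℂ) (s k)))) (Set.Ioi N) :=
    integrable_finsetSum _ fun j _ => integrable_finsetSum _ fun k _ => hi j k
  have hI2 : IntegrableOn (fun x : ℝ => ((‖∑ j ∈ F, c j * (x : ℂ) ^ (-s j)‖ ^ 2 : ℝ) : ℂ))
      (Set.Ioi N) := hI.congr_fun (fun x hx => (e x hx).symm) measurableSet_Ioi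
  refine ⟨?_, ?_⟩
  · have h := Integrable.re hI2
    simp only [RCLike.re_eq_complex_re, ofReal_re] at h
    exact h
  · rw [← ofReal_re (∫ x in Set.Ioi N, _), ← integral_complex_ofReal,
      setIntegral_congr_fun measurableSet_Ioi e,
      integral_finsetSum _ fun j _ => integrable_finsetSum _ fun k _ => hi j k, cauchyForm]
    congr 1
    refine Finset.sum_congr rfl fun j _ => ?_
    rw [integral_finsetSum _ fun k _ => hi j k]
    refine Finset.sum_congr rfl fun k _ => ?_
    have hN0 : (N : ℂ) ≠ 0 := by exact_mod_cast hN.ne'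
    rw [integral_const_mul, integral_Ioi_cpow_of_lt (hre j k) hN, map_mul, conj_ofReal_cpow hN,
      show c j * (N : ℂ) ^ (-(s j - 1 / 2)) * ((starRingEnd ℂ) (c k) *
        (N : ℂ) ^ ((starRingEnd ℂ) (-(s k - 1 / 2)))) = c j * (starRingEnd ℂ) (c k) *
        ((N : ℂ) ^ (-(s j - 1 / 2)) * (N : ℂ) ^ ((starRingEnd ℂ) (-(s k - 1 / 2)))) by ring,
      ← cpow_add _ _ hN0, mul_div_assoc]
    congr 1
    have hconj2 : (starRingEnd ℂ) 2 = 2 := conj_ofNat 2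
    have e1 : -(s j + (starRingEnd ℂ) (s k)) + 1 =
        -(s j - 1 / 2) + (starRingEnd ℂ) (-(s k - 1 / 2)) := by
      simp [hconj2]; ring
    rw [e1, neg_div, ← div_neg]
    congr 1
    simp [hconj2]; ring

/-- Discretization: the Riesz lower bound passes from the half-plane to tails of Dirichlet
polynomials. -/
lemma IsInterpBoundC.sum_le_of_tail {ι : Type*} {s : ι → ℂ} {M : ℝ} (hM : IsInterpBoundC s M)
    (hinj : Function.Injective s) {θ R : ℝ} (hs : ∀ j, 1 / 2 < (s j).re ∧ (s j).re ≤ θ)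
    (hR : θ + 1 ≤ R) (F : Finset ι) (hF : ∀ j ∈ F, |(s j).im| < R) (c : ι → ℂ) {m : ℕ}
    (hN : 480 * M ^ 4 * R ^ 3 ≤ ((m + 1 : ℕ) : ℝ) ^ 2) {T : ℝ}
    (hT : ∀ L : ℕ, ∑ n ∈ Finset.Ico (m + 1) L, ‖∑ j ∈ F, c j * (n : ℂ) ^ (-s j)‖ ^ 2 ≤ T) :
    ∑ j ∈ F, ‖c j * ((m + 1 : ℕ) : ℂ) ^ (-(s j - 1 / 2))‖ ^ 2 / (2 * (s j).re - 1) ≤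
      4 * M ^ 2 * T := by
  rcases F.eq_empty_or_nonempty with rfl | ⟨j₀, hj₀⟩
  · have := hT 0
    simp at this ⊢
    positivity
  have hs1 : ∀ j, 1 / 2 < (s j).re := fun j => (hs j).1
  have hw : ∀ j, 0 < 2 * (s j).re - 1 := fun j => by linarith [hs1 j]
  have hR0 : 0 < R := by linarith [hs1 j₀, (hs j₀).2]
  set N : ℕ := m + 1 with hNdef
  have hN1 : (1 : ℝ) ≤ N := by exact_mod_cast Nat.succ_pos m
  have hN0 : (0 : ℝ) < N := by linarith
  set d : ι → ℂ := fun j => c j * (N : ℂ) ^ (-(s j - 1 / 2)) with hd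
  set G := ∑ j ∈ F, ‖d j‖ ^ 2 / (2 * (s j).re - 1) with hG
  have hG0 : 0 ≤ G := Finset.sum_nonneg fun j _ => div_nonneg (by positivity) (hw j).le
  have hbox : ∑ k ∈ F, (2 * (s k).re - 1) ≤ 15 * M ^ 2 * R := by
    have := hM.sum_box_le hs1 hinj F (L := 3 * R) (by positivity) fun j hj => by
      linarith [hF j hj, (hs j).2]
    linarith
  have hdsum : (∑ j ∈ F, ‖d j‖) ^ 2 ≤ G * (15 * M ^ 2 * R) := by
    refine (Finset.sum_sq_le_sum_mul_sum_of_sq_le_mul F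
      (f := fun j => ‖d j‖ ^ 2 / (2 * (s j).re - 1)) (g := fun j => 2 * (s j).re - 1)
      (fun j _ => div_nonneg (by positivity) (hw j).le) (fun j _ => (hw j).le)
      (fun j _ => (div_mul_cancel₀ _ (hw j).ne').ge)).trans ?_
    exact mul_le_mul_of_nonneg_left hbox hG0
  set E : ℝ → ℂ := fun x => ∑ j ∈ F, c j * (x : ℂ) ^ (-s j) with hE
  obtain ⟨hEi, hEI⟩ := integral_norm_sq_sum_cpow F c hs1 hN0
  have hgram : G ≤ M ^ 2 * ∫ x in Set.Ioi (N : ℝ), ‖E x‖ ^ 2 := by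
    rw [hEI]
    simpa only [ofReal_natCast] using hM.sum_le_cauchyForm hs1 F d
  have hpt : ∀ n : ℕ, N ≤ n → ∀ x ∈ Set.Icc (n : ℝ) (n + 1),
      ‖E x‖ ^ 2 ≤ 2 * ‖∑ j ∈ F, c j * (n : ℂ) ^ (-s j)‖ ^ 2 +
        2 * (G * (15 * M ^ 2 * R)) * (4 * R ^ 2 / N) * ((n : ℝ) ^ 2)⁻¹ := by
    intro n hn x hx
    have hn1 : 1 ≤ n := le_trans (Nat.succ_pos m) hn
    have hn0 : (0 : ℝ) < n := by exact_mod_cast hn1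
    have hD : ‖E x - ∑ j ∈ F, c j * (n : ℂ) ^ (-s j)‖ ≤
        (∑ j ∈ F, ‖d j‖) * (2 * R * (N : ℝ) ^ (-(1 / 2) : ℝ) * (n : ℝ)⁻¹) := by
      rw [hE, ← Finset.sum_sub_distrib, Finset.sum_mul]
      refine norm_sum_le_of_le F fun j hj => ?_
      rw [← mul_sub, norm_mul]
      have h1 := norm_natCast_cpow_sub_le hn1 (s := s j) (by linarith [hs1 j]) hx
      have h2 : ‖s j‖ ≤ 2 * R := by
        refine (norm_le_abs_re_add_abs_im _).trans ?_
        rw [abs_of_pos (by linarith [hs1 j] : 0 < (s j).re)]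
        linarith [hF j hj, (hs j).2]
      have h3 : (n : ℝ) ^ (-(s j).re - 1) ≤ (N : ℝ) ^ (-(s j).re) * (n : ℝ)⁻¹ := by
        rw [Real.rpow_sub hn0, Real.rpow_one, div_eq_mul_inv]
        refine mul_le_mul_of_nonneg_right ?_ (by positivity)
        exact Real.rpow_le_rpow_of_nonpos hN0 (by exact_mod_cast hn) (by linarith [hs1 j])
      have h4 : ‖d j‖ = ‖c j‖ * (N : ℝ) ^ (-(s j).re + 1 / 2) := by
        rw [hd, norm_mul, ← ofReal_natCast, norm_cpow_eq_rpow_re_of_pos hN0]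
        congr 2
        norm_num
        ring
      calc ‖c j‖ * ‖(x : ℂ) ^ (-s j) - (n : ℂ) ^ (-s j)‖
          ≤ ‖c j‖ * (2 * R * ((N : ℝ) ^ (-(s j).re) * (n : ℝ)⁻¹)) := by
            gcongr
            exact h1.trans (mul_le_mul h2 h3 (by positivity) (by positivity))
        _ = _ := by
            rw [h4, Real.rpow_add hN0, Real.rpow_neg hN0.le (1 / 2)]
            have : (N : ℝ) ^ (1 / 2 : ℝ) ≠ 0 := by positivity
            field_simp
    have hD2 : ‖E x - ∑ j ∈ F, c j * (n : ℂ) ^ (-s j)‖ ^ 2 ≤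
        G * (15 * M ^ 2 * R) * (4 * R ^ 2 / N * ((n : ℝ) ^ 2)⁻¹) := by
      refine (pow_le_pow_left₀ (norm_nonneg _) hD 2).trans ?_
      rw [mul_pow]
      refine mul_le_mul hdsum (le_of_eq ?_) (by positivity) (by positivity)
      rw [mul_pow, mul_pow, ← Real.rpow_natCast, ← Real.rpow_natCast, ← Real.rpow_mul hN0.le]
      rw [show (-(1 / 2) : ℝ) * (2 : ℕ) = -1 by norm_num, Real.rpow_neg_one, Real.rpow_natCast]
      ring
    have h5 : ‖E x‖ ≤ ‖∑ j ∈ F, c j * (n : ℂ) ^ (-s j)‖ +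
        ‖E x - ∑ j ∈ F, c j * (n : ℂ) ^ (-s j)‖ := norm_le_norm_add_norm_sub' _ _
    nlinarith [pow_le_pow_left₀ (norm_nonneg _) h5 2,
      sq_nonneg (‖∑ j ∈ F, c j * (n : ℂ) ^ (-s j)‖ - ‖E x - ∑ j ∈ F, c j * (n : ℂ) ^ (-s j)‖)]
  have hii : ∀ x y : ℝ, (N : ℝ) ≤ x → x ≤ y →
      IntervalIntegrable (fun x => ‖E x‖ ^ 2) volume x y := by
    intro x y hx hxy
    rw [intervalIntegrable_iff_integrableOn_Ioc_of_le hxy]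
    exact hEi.mono_set fun z hz => lt_of_le_of_lt hx hz.1
  have hfin : ∀ L : ℕ, N ≤ L → ∫ x in (N : ℝ)..L, ‖E x‖ ^ 2 ≤
      2 * T + G * (240 * M ^ 2 * R ^ 3) / (N : ℝ) ^ 2 := by
    intro L hL
    have h1 := intervalIntegral.sum_integral_adjacent_intervals_Ico (a := fun k : ℕ => (k : ℝ))
      (f := fun x => ‖E x‖ ^ 2) (μ := volume) hL fun k hk =>
        hii _ _ (by exact_mod_cast hk.1) (by simp)
    rw [← h1]
    have h2 : ∀ n ∈ Finset.Ico N L, ∫ x in (n : ℝ)..((n + 1 : ℕ) : ℝ), ‖E x‖ ^ 2 ≤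
        2 * ‖∑ j ∈ F, c j * (n : ℂ) ^ (-s j)‖ ^ 2 +
        2 * (G * (15 * M ^ 2 * R)) * (4 * R ^ 2 / N) * ((n : ℝ) ^ 2)⁻¹ := by
      intro n hn
      have hn' := (Finset.mem_Ico.1 hn).1
      refine (intervalIntegral.integral_mono_on (by simp) (hii _ _ (by exact_mod_cast hn')
        (by simp)) intervalIntegrable_const fun x hx => hpt n hn' x (by simpa using hx)).trans ?_
      simp
    refine (Finset.sum_le_sum h2).trans ?_
    rw [Finset.sum_add_distrib, ← Finset.mul_sum, ← Finset.mul_sum]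
    refine add_le_add (mul_le_mul_of_nonneg_left (hT L) two_pos.le) ?_
    have h3 : ∑ n ∈ Finset.Ico N L, ((n : ℝ) ^ 2)⁻¹ ≤ 2 / N := by
      rw [hNdef, Finset.Ico_add_one_left_eq_Ioo]
      push_cast
      exact sum_Ioo_inv_sq_le (α := ℝ) m L
    refine (mul_le_mul_of_nonneg_left h3 (by positivity)).trans_eq ?_
    field_simp
    ring
  have hlim := intervalIntegral_tendsto_integral_Ioi (N : ℝ) hEi
    (tendsto_natCast_atTop_atTop (R := ℝ))
  have hInt : ∫ x in Set.Ioi (N : ℝ), ‖E x‖ ^ 2 ≤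
      2 * T + G * (240 * M ^ 2 * R ^ 3) / (N : ℝ) ^ 2 :=
    le_of_tendsto hlim (eventually_atTop.2 ⟨N, hfin⟩)
  have h6 : M ^ 2 * (G * (240 * M ^ 2 * R ^ 3) / (N : ℝ) ^ 2) ≤ G / 2 := by
    rw [mul_div_assoc', div_le_div_iff₀ (by positivity) two_pos]
    nlinarith [mul_le_mul_of_nonneg_left hN hG0]
  have h7 := hgram.trans (mul_le_mul_of_nonneg_left hInt (sq_nonneg M))
  rw [mul_add] at h7
  linarith

open scoped InnerProductSpace in
/-- Riesz's solution of the moment problem in a Hilbert space. -/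
lemma exists_inner_eq_of_norm_linearCombination_le {H ι : Type*} [NormedAddCommGroup H]
    [InnerProductSpace ℂ H] [CompleteSpace H] (v : ι → H) (b : ι → ℂ) {K : ℝ} (hK : 0 ≤ K)
    (h : ∀ l : ι →₀ ℂ, ‖Finsupp.linearCombination ℂ b l‖ ≤ K * ‖Finsupp.linearCombination ℂ v l‖) :
    ∃ φ : H, (∀ j, ⟪φ, v j⟫_ℂ = b j) ∧ ‖φ‖ ≤ K := by
  set f := Finsupp.linearCombination ℂ v with hf
  obtain ⟨g, hg⟩ := f.rangeRestrict.exists_rightInverse_of_surjective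
    (LinearMap.range_eq_top.2 f.surjective_rangeRestrict)
  have hg' : ∀ y : LinearMap.range f, f (g y) = y := fun y =>
    congrArg Subtype.val (LinearMap.congr_fun hg y)
  have hbd : ∀ y : LinearMap.range f, ‖(Finsupp.linearCombination ℂ b ∘ₗ g) y‖ ≤ K * ‖y‖ := by
    intro y
    refine (h (g y)).trans_eq ?_
    rw [hg' y]
    rfl
  obtain ⟨ℓ, hℓ, hℓn⟩ := exists_extension_norm_eq _
    (LinearMap.mkContinuous (Finsupp.linearCombination ℂ b ∘ₗ g) K hbd)
  refine ⟨(InnerProductSpace.toDual ℂ H).symm ℓ, fun j => ?_, ?_⟩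
  · rw [InnerProductSpace.toDual_symm_apply]
    have hmem : f (Finsupp.single j 1) ∈ LinearMap.range f := LinearMap.mem_range_self _ _
    have hvj : v j = f (Finsupp.single j 1) := by simp [hf]
    rw [hvj]
    have h1 := hℓ ⟨_, hmem⟩
    change ℓ (f (Finsupp.single j 1)) =
      Finsupp.linearCombination ℂ b (g ⟨f (Finsupp.single j 1), hmem⟩) at h1
    have h2 := h (g ⟨f (Finsupp.single j 1), hmem⟩ - Finsupp.single j 1)
    rw [map_sub, map_sub, hg', sub_self, norm_zero, mul_zero, norm_le_zero_iff,
      sub_eq_zero] at h2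
    rw [h1, h2]
    simp
  · rw [LinearIsometryEquiv.norm_map, hℓn]
    exact LinearMap.mkContinuous_norm_le _ hK _

lemma memℓp_natCast_cpow {s : ℂ} (hs : 1 / 2 < s.re) :
    Memℓp (fun n : ℕ+ => (starRingEnd ℂ) ((n : ℂ) ^ (-s))) 2 := by
  refine memℓp_gen ?_
  have h1 : Summable fun n : ℕ => (n : ℝ) ^ (-(2 * s.re)) :=
    Real.summable_nat_rpow.2 (by linarith)
  refine (h1.comp_injective PNat.coe_injective).congr fun n => ?_
  have hn : (0 : ℝ) < (n : ℕ) := by exact_mod_cast n.pos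
  rw [Function.comp_apply, RCLike.norm_conj, ← ofReal_natCast,
    norm_cpow_eq_rpow_re_of_pos hn, ← Real.rpow_mul hn.le]
  congr 1
  simp
  ring

/-- Interpolation in `ℋ²` follows from a dual inequality for tails of Dirichlet polynomials. -/
lemma exists_H2series_eq {ι : Type*} {s : ι → ℂ} (hs : ∀ j, 1 / 2 < (s j).re) (b : ι → ℂ) {K : ℝ}
    (hK : 0 ≤ K) (m : ℕ)
    (h : ∀ (F : Finset ι) (c : ι → ℂ) (T : ℝ),
      (∀ L : ℕ, ∑ n ∈ Finset.Ico (m + 1) L, ‖∑ j ∈ F, c j * (n : ℂ) ^ (-s j)‖ ^ 2 ≤ T) →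
      ‖∑ j ∈ F, c j * b j‖ ^ 2 ≤ K ^ 2 * T) :
    ∃ x : H2, (∀ j, H2series x (s j) = b j) ∧ ‖x‖ ≤ K := by
  set v : ι → H2 := fun j => ⟨_, memℓp_natCast_cpow (hs j)⟩ with hv
  have hvn : ∀ j (n : ℕ+), v j n = (starRingEnd ℂ) ((n : ℂ) ^ (-s j)) := fun j n => rfl
  have hcoe : ∀ (l : ι →₀ ℂ) (n : ℕ+), (Finsupp.linearCombination ℂ v l) n =
      ∑ j ∈ l.support, l j * v j n := fun l n =>
    (congrFun (lp.coeFn_sum (fun j => l j • v j) l.support) n).trans (Finset.sum_apply n _ _)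
  obtain ⟨x, hx, hxK⟩ := exists_inner_eq_of_norm_linearCombination_le v
    (fun j => (starRingEnd ℂ) (b j)) hK fun l => by
      refine le_of_sq_le_sq ?_ (by positivity)
      have h1 := h l.support (fun j => (starRingEnd ℂ) (l j))
        (‖Finsupp.linearCombination ℂ v l‖ ^ 2) fun L => by
          have h2 := lp.sum_rpow_le_norm_rpow (p := 2) (by norm_num)
            (Finsupp.linearCombination ℂ v l)
            ((Finset.Ico (m + 1) L).subtype fun n => 0 < n)
          simp only [ENNReal.toReal_ofNat, Real.rpow_two] at h2
          refine le_trans (le_of_eq ?_) h2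
          rw [← Finset.sum_subtype_of_mem (p := fun n => 0 < n) _ fun n hn => by
            have := (Finset.mem_Ico.1 hn).1; omega]
          refine Finset.sum_congr rfl fun n _ => ?_
          congr 1
          rw [← RCLike.norm_conj, map_sum]
          refine congrArg _ (Eq.trans ?_ (hcoe l n).symm)
          refine Finset.sum_congr rfl fun j _ => ?_
          rw [map_mul, conj_conj]
          rfl
      rw [mul_pow]
      refine le_trans (le_of_eq ?_) h1
      rw [← RCLike.norm_conj, Finsupp.linearCombination_apply, Finsupp.sum, map_sum]
      simp
  refine ⟨x, fun j => ?_, hxK⟩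
  have h1 := congrArg (starRingEnd ℂ) (hx j)
  rw [inner_conj_symm, lp.inner_eq_tsum, conj_conj] at h1
  rw [← h1, H2series]
  refine tsum_congr fun n => ?_
  rw [hvn]
  simp

lemma riemannZeta_re_pos_and_mul_sub_one_le {x : ℝ} (hx : 1 < x) :
    0 < (riemannZeta x).re ∧ (riemannZeta x).re * (x - 1) ≤ x := by
  have h1 : riemannZeta x = ((∑' n : ℕ, 1 / (n + 1 : ℝ) ^ x : ℝ) : ℂ) := by
    rw [zeta_eq_tsum_one_div_nat_add_one_cpow (by simpa using hx), ofReal_tsum]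
    refine tsum_congr fun n => ?_
    rw [ofReal_div, ofReal_one, ofReal_cpow (by positivity)]
    push_cast
    rfl
  have h2 := ZetaAsymptotics.zeta_limit_aux1 hx
  have h3 : 0 ≤ ZetaAsymptotics.termTSum x := tsum_nonneg fun n => ZetaAsymptotics.term_nonneg _ _
  rw [h1, ofReal_re]
  set Z := ∑' n : ℕ, 1 / (n + 1 : ℝ) ^ x
  constructor
  · have hsum : Summable fun n : ℕ => 1 / (n + 1 : ℝ) ^ x := by
      have := (summable_nat_add_iff 1).2 (Real.summable_one_div_nat_rpow.2 hx)
      simpa using this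
    exact hsum.tsum_pos (fun n => by positivity) 0 (by positivity)
  · have hx0 : 0 < x - 1 := by linarith
    have h4 : Z ≤ 1 + 1 / (x - 1) := by nlinarith
    calc Z * (x - 1) ≤ (1 + 1 / (x - 1)) * (x - 1) := mul_le_mul_of_nonneg_right h4 hx0.le
      _ = x := by field_simp; ring

/-- Interpolation bounds pass to subsequences. -/
lemma IsInterpBoundC.comp {ι κ : Type*} {s : ι → ℂ} {M : ℝ} (hM : IsInterpBoundC s M) {e : κ → ι}
    (he : Function.Injective e) : IsInterpBoundC (fun k => s (e k)) M := by
  intro a ha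
  set a' : ι → ℂ := Function.extend e a (0 : ι → ℂ) with ha'
  have hext : ∀ k, a' (e k) = a k := fun k => he.extend_apply a (0 : ι → ℂ) k
  have h0 : ∀ j ∉ Set.range e, ‖a' j‖ ^ 2 * (2 * (s j).re - 1) = 0 := fun j hj => by
    have : a' j = 0 := Function.extend_apply' a (0 : ι → ℂ) j fun ⟨k, hk⟩ => hj ⟨k, hk⟩
    simp [this]
  have hcomp : (fun j => ‖a' j‖ ^ 2 * (2 * (s j).re - 1)) ∘ e =
      fun k => ‖a k‖ ^ 2 * (2 * (s (e k)).re - 1) := funext fun k => by simp [hext]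
  obtain ⟨h, B, hh, hv, hB⟩ := hM a' ((he.summable_iff h0).1 (hcomp ▸ ha))
  refine ⟨h, B, hh, fun k => (hv (e k)).trans (hext k), ?_⟩
  rwa [← he.tsum_eq (Function.support_subset_iff'.2 h0),
    show (fun k => ‖a' (e k)‖ ^ 2 * (2 * (s (e k)).re - 1)) = _ from hcomp] at hB

lemma IsInterpBoundC.isInterpBoundDir {ι : Type*} {s : ι → ℂ} {M : ℝ} (hM : IsInterpBoundC s M)
    (hinj : Function.Injective s) {θ R : ℝ} (hs : ∀ j, 1 / 2 < (s j).re ∧ (s j).re ≤ θ)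
    (hθ : 1 / 2 < θ) (hR : θ + 1 ≤ R) (hF : ∀ j, |(s j).im| < R) {m : ℕ}
    (hN : 480 * M ^ 4 * R ^ 3 ≤ ((m + 1 : ℕ) : ℝ) ^ 2) :
    IsInterpBoundDir s (Real.sqrt (8 * θ) * ((m + 1 : ℕ) : ℝ) ^ (θ - 1 / 2) * M) := by
  intro b hb
  set A := ∑' j, ‖b j‖ ^ 2 / (riemannZeta (2 * (s j).re)).re with hA
  have hw : ∀ j, 0 < 2 * (s j).re - 1 := fun j => by linarith [(hs j).1]
  have hζ : ∀ j, 0 < (riemannZeta (2 * (s j).re)).re ∧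
      (riemannZeta (2 * (s j).re)).re * (2 * (s j).re - 1) ≤ 2 * θ := fun j => by
    have := riemannZeta_re_pos_and_mul_sub_one_le (x := 2 * (s j).re) (by linarith [(hs j).1])
    push_cast at this
    exact ⟨this.1, this.2.trans (by linarith [(hs j).2])⟩
  have hA0 : 0 ≤ A := tsum_nonneg fun j => div_nonneg (by positivity) (hζ j).1.le
  set N : ℕ := m + 1 with hNdef
  have hN1 : (1 : ℝ) ≤ N := by exact_mod_cast Nat.succ_pos m
  have hN0 : (0 : ℝ) < N := by linarith
  have hNC : (N : ℂ) ≠ 0 := by exact_mod_cast hN0.ne'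
  set P : ℝ := (N : ℝ) ^ (θ - 1 / 2) with hP
  have hP0 : 0 ≤ P := by positivity
  have hsq : (Real.sqrt (8 * θ) * P * M) ^ 2 = 8 * θ * P ^ 2 * M ^ 2 := by
    rw [mul_pow, mul_pow, Real.sq_sqrt (by linarith)]
  rw [hsq]
  have hKA : 0 ≤ 8 * θ * P ^ 2 * M ^ 2 * A := by
    have : 0 ≤ θ := by linarith
    positivity
  obtain ⟨x, hx, hxK⟩ := exists_H2series_eq (fun j => (hs j).1) b
    (Real.sqrt_nonneg (8 * θ * P ^ 2 * M ^ 2 * A)) m fun F c T hT => by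
      rw [Real.sq_sqrt hKA]
      have h1 := hM.sum_le_of_tail hinj hs hR F (fun j _ => hF j) c hN hT
      rw [← hNdef] at h1
      have h2 : ∑ j ∈ F, ‖(N : ℂ) ^ (s j - 1 / 2) * b j‖ ^ 2 * (2 * (s j).re - 1) ≤
          2 * θ * P ^ 2 * A := by
        have h3 : ∀ j ∈ F, ‖(N : ℂ) ^ (s j - 1 / 2) * b j‖ ^ 2 * (2 * (s j).re - 1) ≤
            2 * θ * P ^ 2 * (‖b j‖ ^ 2 / (riemannZeta (2 * (s j).re)).re) := by
          intro j _
          have h4 : ‖(N : ℂ) ^ (s j - 1 / 2)‖ ≤ P := by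
            rw [← ofReal_natCast, norm_cpow_eq_rpow_re_of_pos hN0]
            refine Real.rpow_le_rpow_of_exponent_le hN1 ?_
            have := (hs j).2
            norm_num
            linarith
          rw [norm_mul, mul_pow, mul_div_assoc', le_div_iff₀ (hζ j).1]
          have h5 : ‖(N : ℂ) ^ (s j - 1 / 2)‖ ^ 2 ≤ P ^ 2 :=
            pow_le_pow_left₀ (norm_nonneg _) h4 2
          calc _ = (‖(N : ℂ) ^ (s j - 1 / 2)‖ ^ 2 * ‖b j‖ ^ 2) *
                ((riemannZeta (2 * (s j).re)).re * (2 * (s j).re - 1)) := by ring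
            _ ≤ (P ^ 2 * ‖b j‖ ^ 2) * (2 * θ) :=
                mul_le_mul (mul_le_mul_of_nonneg_right h5 (by positivity)) (hζ j).2
                  (mul_nonneg (hζ j).1.le (hw j).le) (by positivity)
            _ = _ := by ring
        refine (Finset.sum_le_sum h3).trans ?_
        rw [← Finset.mul_sum]
        refine mul_le_mul_of_nonneg_left ?_ (by positivity)
        exact hb.sum_le_tsum F fun j _ => div_nonneg (by positivity) (hζ j).1.le
      have h6 : ‖∑ j ∈ F, c j * b j‖ ≤ ∑ j ∈ F, ‖c j * (N : ℂ) ^ (-(s j - 1 / 2))‖ *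
          ‖(N : ℂ) ^ (s j - 1 / 2) * b j‖ := by
        refine norm_sum_le_of_le F fun j _ => le_of_eq ?_
        rw [← norm_mul]
        congr 1
        rw [cpow_neg]
        have hz : (N : ℂ) ^ (s j - 1 / 2) ≠ 0 := by simp [cpow_eq_zero_iff, hNC]
        generalize (N : ℂ) ^ (s j - 1 / 2) = z at hz ⊢
        field_simp
      have h7 := Finset.sum_sq_le_sum_mul_sum_of_sq_le_mul F
        (r := fun j => ‖c j * (N : ℂ) ^ (-(s j - 1 / 2))‖ * ‖(N : ℂ) ^ (s j - 1 / 2) * b j‖)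
        (f := fun j => ‖c j * (N : ℂ) ^ (-(s j - 1 / 2))‖ ^ 2 / (2 * (s j).re - 1))
        (g := fun j => ‖(N : ℂ) ^ (s j - 1 / 2) * b j‖ ^ 2 * (2 * (s j).re - 1))
        (fun j _ => div_nonneg (by positivity) (hw j).le)
        (fun j _ => mul_nonneg (by positivity) (hw j).le)
        (fun j _ => by have := (hw j).ne'; field_simp; rfl)
      calc _ ≤ _ := pow_le_pow_left₀ (norm_nonneg _) h6 2
        _ ≤ _ := h7
        _ ≤ (4 * M ^ 2 * T) * (2 * θ * P ^ 2 * A) :=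
          mul_le_mul h1 h2 (Finset.sum_nonneg fun j _ => mul_nonneg (by positivity) (hw j).le)
            (le_trans (Finset.sum_nonneg fun j _ => div_nonneg (by positivity) (hw j).le) h1)
        _ = _ := by ring
  refine ⟨x, hx, ?_⟩
  calc _ ≤ _ := pow_le_pow_left₀ (norm_nonneg _) hxK 2
    _ = _ := Real.sq_sqrt hKA

lemma MH2Dir_le_of_isInterpBoundC {θ : ℝ} (hθ : 1 / 2 < θ) {s : ℕ → ℂ}
    (hinj : Function.Injective s) (hs : ∀ j, 1 / 2 < (s j).re ∧ (s j).re ≤ θ) {R : ℝ}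
    (hR : θ + 1 ≤ R) {M : NNReal} (hM : IsInterpBoundC s M) :
    MH2Dir (fun j : {j : ℕ // |(s j).im| < R} => s j.1) ≤
      ENNReal.ofReal (Real.sqrt (8 * θ) * 24 ^ (θ - 1 / 2)) * (M : ENNReal) ^ (2 * θ + 6 : ℝ) *
        ENNReal.ofReal (R ^ (2 * θ + 7 / 2 : ℝ)) := by
  have hM1 : (1 : ℝ) ≤ M := by
    have := hM.one_le_sq (fun j => (hs j).1) hinj 0
    exact (one_le_sq_iff₀ M.2).1 this
  have hR1 : 1 ≤ R := by linarith
  have hM0 : (0 : ℝ) < M := by linarith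
  have hR0 : 0 < R := by linarith
  set X : ℝ := M ^ 2 * R ^ (3 / 2 : ℝ) with hX
  have hX1 : 1 ≤ X := by
    have h1 : (1 : ℝ) ≤ (M : ℝ) ^ 2 := one_le_pow₀ hM1
    have h2 : (1 : ℝ) ≤ R ^ (3 / 2 : ℝ) := Real.one_le_rpow hR1 (by norm_num)
    nlinarith
  set m : ℕ := ⌈22 * X⌉₊ with hm
  have hlo : 22 * X ≤ ((m + 1 : ℕ) : ℝ) := by
    push_cast
    linarith [Nat.le_ceil (22 * X)]
  have hhi : ((m + 1 : ℕ) : ℝ) ≤ 24 * X := by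
    push_cast
    linarith [Nat.ceil_lt_add_one (by linarith : 0 ≤ 22 * X)]
  have hX2 : X ^ 2 = M ^ 4 * R ^ 3 := by
    rw [hX, mul_pow, ← pow_mul, ← Real.rpow_natCast (R ^ (3 / 2 : ℝ)), ← Real.rpow_mul hR0.le,
      show (3 / 2 : ℝ) * (2 : ℕ) = (3 : ℕ) by norm_num, Real.rpow_natCast]
  have hN : 480 * (M : ℝ) ^ 4 * R ^ 3 ≤ ((m + 1 : ℕ) : ℝ) ^ 2 := by
    have := pow_le_pow_left₀ (by positivity) hlo 2
    rw [mul_pow, hX2] at this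
    have : 0 ≤ (M : ℝ) ^ 4 * R ^ 3 := by positivity
    linarith
  have hD := (hM.comp Subtype.val_injective).isInterpBoundDir
    (hinj.comp Subtype.val_injective) (fun j => hs j.1) hθ hR
    (fun j : {j : ℕ // |(s j).im| < R} => j.2) hN
  set M' : NNReal := ⟨Real.sqrt (8 * θ) * ((m + 1 : ℕ) : ℝ) ^ (θ - 1 / 2) * M, by positivity⟩
    with hM'
  refine (iInf₂_le M' hD).trans ?_
  have hreal : (M' : ℝ) ≤ Real.sqrt (8 * θ) * 24 ^ (θ - 1 / 2) * (M : ℝ) ^ (2 * θ + 6 : ℝ) *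
      R ^ (2 * θ + 7 / 2 : ℝ) := by
    have h1 : ((m + 1 : ℕ) : ℝ) ^ (θ - 1 / 2) ≤
        24 ^ (θ - 1 / 2) * ((M : ℝ) ^ (2 * θ - 1) * R ^ (3 / 2 * (θ - 1 / 2))) := by
      refine (Real.rpow_le_rpow (by positivity) hhi (by linarith)).trans_eq ?_
      rw [Real.mul_rpow (by norm_num) (by linarith), hX,
        Real.mul_rpow (by positivity) (by positivity), ← Real.rpow_natCast (M : ℝ) 2,
        ← Real.rpow_mul hM0.le, ← Real.rpow_mul hR0.le]
      congr 3
      push_cast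
      ring
    have h2 : (M : ℝ) ^ (2 * θ - 1) * M ≤ (M : ℝ) ^ (2 * θ + 6) := by
      rw [← Real.rpow_add_one hM0.ne']
      exact Real.rpow_le_rpow_of_exponent_le hM1 (by linarith)
    have h3 : R ^ (3 / 2 * (θ - 1 / 2)) ≤ R ^ (2 * θ + 7 / 2) :=
      Real.rpow_le_rpow_of_exponent_le hR1 (by linarith)
    calc (M' : ℝ) = Real.sqrt (8 * θ) * ((m + 1 : ℕ) : ℝ) ^ (θ - 1 / 2) * M := rfl
      _ ≤ Real.sqrt (8 * θ) *
          (24 ^ (θ - 1 / 2) * ((M : ℝ) ^ (2 * θ - 1) * R ^ (3 / 2 * (θ - 1 / 2)))) * M := by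
          gcongr
      _ = Real.sqrt (8 * θ) * 24 ^ (θ - 1 / 2) *
          (((M : ℝ) ^ (2 * θ - 1) * M) * R ^ (3 / 2 * (θ - 1 / 2))) := by ring
      _ ≤ Real.sqrt (8 * θ) * 24 ^ (θ - 1 / 2) *
          ((M : ℝ) ^ (2 * θ + 6) * R ^ (2 * θ + 7 / 2)) := by gcongr
      _ = _ := by ring
  rw [← ENNReal.ofReal_coe_nnreal, ← ENNReal.ofReal_coe_nnreal (p := M),
    ENNReal.ofReal_rpow_of_pos hM0, ← ENNReal.ofReal_mul (by positivity),
    ← ENNReal.ofReal_mul (by positivity)]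
  exact ENNReal.ofReal_le_ofReal hreal

theorem stmt13 (θ : ℝ) (hθ : 1 / 2 < θ) :
    ∃ C : ℝ, 0 < C ∧
      ∀ s : ℕ → ℂ, Function.Injective s →
        (∀ j, 1 / 2 < (s j).re ∧ (s j).re ≤ θ) → MH2C s < ⊤ →
        ∀ R : ℝ, θ + 1 ≤ R →
          MH2Dir (fun j : {j : ℕ // |(s j).im| < R} => s j.1) ≤
            ENNReal.ofReal C * MH2C s ^ (2 * θ + 6 : ℝ) *
              ENNReal.ofReal (R ^ (2 * θ + 7 / 2 : ℝ)) := by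
  refine ⟨Real.sqrt (8 * θ) * 24 ^ (θ - 1 / 2), ?_, fun s hinj hs hfin R hR => ?_⟩
  · have : 0 < 8 * θ := by linarith
    positivity
  have hlim : Tendsto (fun x : ENNReal => ENNReal.ofReal (Real.sqrt (8 * θ) * 24 ^ (θ - 1 / 2)) *
      x ^ (2 * θ + 6 : ℝ) * ENNReal.ofReal (R ^ (2 * θ + 7 / 2 : ℝ)))
      (nhdsWithin (MH2C s) (Set.Ioi (MH2C s)))
      (nhds (ENNReal.ofReal (Real.sqrt (8 * θ) * 24 ^ (θ - 1 / 2)) *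
        MH2C s ^ (2 * θ + 6 : ℝ) * ENNReal.ofReal (R ^ (2 * θ + 7 / 2 : ℝ)))) := by
    refine ENNReal.Tendsto.mul_const (ENNReal.Tendsto.const_mul ?_ (Or.inr ENNReal.ofReal_ne_top))
      (Or.inr ENNReal.ofReal_ne_top)
    exact (ENNReal.continuous_rpow_const.tendsto _).mono_left nhdsWithin_le_nhds
  have : (nhdsWithin (MH2C s) (Set.Ioi (MH2C s))).NeBot := nhdsGT_neBot_of_exists_gt ⟨⊤, hfin⟩
  refine ge_of_tendsto hlim ?_
  filter_upwards [self_mem_nhdsWithin] with x hx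
  obtain ⟨M, hM⟩ := iInf_lt_iff.1 (show MH2C s < x from hx)
  obtain ⟨hMb, hMx⟩ := iInf_lt_iff.1 hM
  refine (MH2Dir_le_of_isInterpBoundC hθ hinj hs hR hMb).trans ?_
  gcongr
end
end

section
/- Let φ(s) = c₀·s + ∑_{n≥1} c_n n^{−s}, where c₀ is a nonnegative integer, and suppose the composition operator C_φ is bounded on ℋ². Let S = (s_j)_{j=1}^n and S′ = (s′_j)_{j=1}^n each consist of n distinct points of ℂ_{1/2} with φ(s′_j) = s_j for every j. Then a_n(C_φ) ≥ [M_{ℋ²}(S)]^{−1}·‖μ_{S′,ℋ²}‖_C^{−1/2}·min_{1≤j≤n} (ζ(2 Re s_j)/ζ(2 Re s′_j))^{1/2}. -/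
open Complex Filter MeasureTheory

noncomputable section

/-- The Dirichlet series with coefficients `c` converges uniformly on `ℂ_ε = {Re s > ε}`
for every `ε > 0`, with sum `φ`. -/
def DSConvUnif (c : ℕ → ℂ) (φ : ℂ → ℂ) : Prop :=
  ∀ ε : ℝ, 0 < ε →
    TendstoUniformlyOn (fun N s => ∑ n ∈ Finset.range N, LSeries.term c s n) φ
      atTop {s : ℂ | ε < s.re}

/-- `K` is a Carleson embedding bound for the finite sequence `s` with respect to `ℋ²`,
i.e. `∑_j |f(s_j)|²/ζ(2 Re s_j) ≤ K ‖f‖²` for every `f ∈ ℋ²`. -/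
def CarlesonBoundDir {ι : Type*} [Fintype ι] (s : ι → ℂ) (K : ℝ) : Prop :=
  ∀ F : H2, ∑ j, ‖H2series F (s j)‖ ^ 2 / (riemannZeta (2 * (s j).re)).re ≤ K * ‖F‖ ^ 2

/-- The Dirichlet series reproducing kernel of `ℋ²` at `s` has square-summable coefficients. -/
theorem memLp_kernel {s : ℂ} (hs : 1 / 2 < s.re) :
    Memℓp (fun n : ℕ+ => starRingEnd ℂ ((n : ℂ) ^ (-s))) 2 := by
  apply memℓp_gen
  have hsum : Summable fun n : ℕ => ((n : ℝ) ^ (2 * s.re))⁻¹ :=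
    Real.summable_nat_rpow_inv.2 (by linarith)
  refine (hsum.comp_injective PNat.coe_injective).congr fun n => ?_
  have hn : (0 : ℝ) ≤ (n : ℕ) := Nat.cast_nonneg _
  rw [RCLike.norm_conj, Complex.norm_natCast_cpow_of_pos n.pos, ← Real.rpow_mul hn,
    Function.comp_apply, ← Real.rpow_neg hn]
  congr 1
  simp [mul_comm]

/-- The reproducing kernel of `ℋ²` at a point of `ℂ_{1/2}`. -/
def H2kernel (s : ℂ) (hs : 1 / 2 < s.re) : H2 := ⟨_, memLp_kernel hs⟩

theorem inner_H2kernel {s : ℂ} (hs : 1 / 2 < s.re) (x : H2) :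
    inner ℂ (H2kernel s hs) x = H2series x s := by
  rw [lp.inner_eq_tsum, H2series]
  refine tsum_congr fun n => ?_
  simp [H2kernel]

theorem riemannZeta_re_pos {σ : ℝ} (hσ : 1 / 2 < σ) : 0 < (riemannZeta (2 * σ)).re := by
  have h := riemannZeta_re_pos_of_one_lt (x := 2 * σ) (by linarith)
  rwa [Complex.ofReal_mul, Complex.ofReal_ofNat] at h

theorem linearIndependent_H2kernel {ι : Type*} [Fintype ι] {s : ι → ℂ}
    (hs : ∀ j, 1 / 2 < (s j).re) {M : ℝ} (hM : IsInterpBoundDir s M) :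
    LinearIndependent ℂ fun j => H2kernel (s j) (hs j) := by
  rw [Fintype.linearIndependent_iff]
  intro g hg
  obtain ⟨F, hF, -⟩ := hM g Summable.of_finite
  have h : inner ℂ (∑ j, g j • H2kernel (s j) (hs j)) F = 0 := by rw [hg, inner_zero_left]
  simp only [sum_inner, inner_smul_left, inner_H2kernel, hF, RCLike.conj_mul] at h
  have h' : ∑ j, ‖g j‖ ^ 2 = 0 := by
    apply Complex.ofReal_injective
    simpa using h
  intro j
  simpa using (Finset.sum_eq_zero_iff_of_nonneg fun i _ => sq_nonneg ‖g i‖).1 h' j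
    (Finset.mem_univ j)

/-- Elements of the span of the kernels are interpolants of minimal norm, so the interpolation
bound applies to them. -/
theorem norm_sq_le_of_mem_span_H2kernel {ι : Type*} [Fintype ι] {s : ι → ℂ}
    (hs : ∀ j, 1 / 2 < (s j).re) {M : ℝ} (hM : IsInterpBoundDir s M) {x : H2}
    (hx : x ∈ Submodule.span ℂ (Set.range fun j => H2kernel (s j) (hs j))) :
    ‖x‖ ^ 2 ≤ M ^ 2 * ∑ j, ‖H2series x (s j)‖ ^ 2 / (riemannZeta (2 * (s j).re)).re := by
  obtain ⟨F, hF, hFM⟩ := hM (fun j => H2series x (s j)) Summable.of_finite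
  rw [tsum_fintype] at hFM
  refine le_trans ?_ hFM
  have horth : inner ℂ x (F - x) = 0 := by
    have hle : Submodule.span ℂ (Set.range fun j => H2kernel (s j) (hs j)) ≤
        (Submodule.span ℂ {F - x})ᗮ := by
      rw [Submodule.span_le]
      rintro _ ⟨j, rfl⟩
      rw [SetLike.mem_coe, Submodule.mem_orthogonal_singleton_iff_inner_left, inner_sub_right,
        inner_H2kernel, inner_H2kernel, hF, sub_self]
    exact Submodule.mem_orthogonal_singleton_iff_inner_left.1 (hle hx)
  have hadd := norm_add_sq_eq_norm_sq_add_norm_sq_of_inner_eq_zero x (F - x) horth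
  rw [add_sub_cancel] at hadd
  nlinarith [mul_self_nonneg ‖F - x‖]

theorem exists_mem_span_ne_zero_map_eq_zero {ι E F : Type*} [Fintype ι] [AddCommGroup E]
    [Module ℂ E] [AddCommGroup F] [Module ℂ F] {v : ι → E} (hv : LinearIndependent ℂ v)
    (R : E →ₗ[ℂ] F) [FiniteDimensional ℂ (LinearMap.range R)]
    (hR : Module.finrank ℂ (LinearMap.range R) < Fintype.card ι) :
    ∃ x ∈ Submodule.span ℂ (Set.range v), x ≠ 0 ∧ R x = 0 := by
  set f := R.rangeRestrict.comp (Submodule.span ℂ (Set.range v)).subtype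
  have : FiniteDimensional ℂ (Submodule.span ℂ (Set.range v)) :=
    FiniteDimensional.span_of_finite ℂ (Set.finite_range v)
  have hker : LinearMap.ker f ≠ ⊥ :=
    LinearMap.ker_ne_bot_of_finrank_lt (by rwa [finrank_span_eq_card hv])
  obtain ⟨x, hx, hx0⟩ := Submodule.exists_mem_ne_zero_of_ne_bot hker
  exact ⟨x, x.2, by simpa using hx0, by simpa [f, Subtype.ext_iff] using hx⟩

theorem stmt14 (c₀ : ℕ) (ψ : ℂ → ℂ) (c : ℕ → ℂ) (hψ : DSConvUnif c ψ)
    (T : H2 →L[ℂ] H2) (hT : IsCompOp (fun s => (c₀ : ℂ) * s + ψ s) T)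
    (n : ℕ) (hn : 1 ≤ n) (s s' : Fin n → ℂ)
    (hs : ∀ j, 1 / 2 < (s j).re) (hs' : ∀ j, 1 / 2 < (s' j).re)
    (hsinj : Function.Injective s) (hs'inj : Function.Injective s')
    (himg : ∀ j, (c₀ : ℂ) * s' j + ψ (s' j) = s j)
    (M : ℝ) (hM : 0 < M) (hMb : IsInterpBoundDir s M)
    (K : ℝ) (hK : 0 < K) (hKb : CarlesonBoundDir s' K) :
    M⁻¹ * K ^ (-(1 / 2) : ℝ) *
        (⨅ j : Fin n, Real.sqrt
          ((riemannZeta (2 * (s j).re)).re / (riemannZeta (2 * (s' j).re)).re)) ≤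
      approxNumber T n := by
  refine le_csInf ⟨_, 0, ?_, ?_, rfl⟩ ?_
  · rw [ContinuousLinearMap.toLinearMap_zero, LinearMap.range_zero]
    infer_instance
  · rw [ContinuousLinearMap.toLinearMap_zero, LinearMap.range_zero, finrank_bot]
    exact hn
  rintro _ ⟨R, hfin, hrank, rfl⟩
  obtain ⟨x, hx, hx0, hRx⟩ := exists_mem_span_ne_zero_map_eq_zero
    (linearIndependent_H2kernel hs hMb) (R : H2 →ₗ[ℂ] H2) (by simpa using hrank)
  set m := ⨅ j : Fin n, Real.sqrt
    ((riemannZeta (2 * (s j).re)).re / (riemannZeta (2 * (s' j).re)).re)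
  have hm0 : 0 ≤ m := Real.iInf_nonneg fun j => Real.sqrt_nonneg _
  have hm (j : Fin n) :
      m ^ 2 ≤ (riemannZeta (2 * (s j).re)).re / (riemannZeta (2 * (s' j).re)).re := by
    rw [← Real.le_sqrt hm0
      (div_nonneg (riemannZeta_re_pos (hs j)).le (riemannZeta_re_pos (hs' j)).le)]
    exact ciInf_le (Set.finite_range _).bddBelow j
  have hTx (j : Fin n) : H2series (T x) (s' j) = H2series x (s j) := by
    rw [hT x (s' j) (hs' j), ← himg j]
  have hxM := norm_sq_le_of_mem_span_H2kernel hs hMb hx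
  have hxK : m ^ 2 * ∑ j, ‖H2series x (s j)‖ ^ 2 / (riemannZeta (2 * (s j).re)).re ≤
      K * ‖T x‖ ^ 2 := by
    refine le_trans ?_ (hKb (T x))
    rw [Finset.mul_sum]
    refine Finset.sum_le_sum fun j _ => ?_
    have h1 := riemannZeta_re_pos (hs j)
    calc _ ≤ (riemannZeta (2 * (s j).re)).re / (riemannZeta (2 * (s' j).re)).re *
          (‖H2series x (s j)‖ ^ 2 / (riemannZeta (2 * (s j).re)).re) := by
          gcongr
          exact hm j
      _ = _ := by
          rw [hTx]
          field_simp
  have hTR : ‖T x‖ ≤ ‖T - R‖ * ‖x‖ := by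
    have h := (T - R).le_opNorm x
    rwa [sub_apply, show R x = 0 from hRx, sub_zero] at h
  have hxpos : 0 < ‖x‖ := norm_pos_iff.2 hx0
  have hmain : m ^ 2 ≤ M ^ 2 * K * ‖T - R‖ ^ 2 := by
    refine le_of_mul_le_mul_right ?_ (pow_pos hxpos 2)
    calc m ^ 2 * ‖x‖ ^ 2 ≤ m ^ 2 * (M ^ 2 * ∑ j, ‖H2series x (s j)‖ ^ 2 /
          (riemannZeta (2 * (s j).re)).re) := by gcongr
      _ = M ^ 2 * (m ^ 2 * ∑ j, ‖H2series x (s j)‖ ^ 2 /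
          (riemannZeta (2 * (s j).re)).re) := by ring
      _ ≤ M ^ 2 * (K * (‖T - R‖ * ‖x‖) ^ 2) := by
          gcongr ?_ * ?_
          exact hxK.trans (by gcongr)
      _ = _ := by ring
  have hsqrt : m ≤ M * Real.sqrt K * ‖T - R‖ := by
    refine le_of_sq_le_sq ?_ (by positivity)
    rwa [mul_pow, mul_pow, Real.sq_sqrt hK.le]
  rw [Real.rpow_neg hK.le, ← Real.sqrt_eq_rpow, ← mul_inv, inv_mul_le_iff₀ (by positivity)]
  exact hsqrt
end
end

section
/- Let ξ and γ be points of ℂ_{1/2}. Then there exist complex numbers c₁ and c₂ with c₂ ≠ 0 such that the Dirichlet polynomial χ(s) = c₁ + c₂·2^{−s} satisfies χ(ℂ₀) ⊂ ℂ_{1/2}, χ(γ) = ξ, and χ′(γ) ≠ 0. -/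
open Complex

/-- On the right half-plane `0 < re s`, the function `2^{-s}` takes values in the open unit disc. -/
lemma norm_two_cpow_neg_lt_one {s : ℂ} (hs : 0 < s.re) : ‖(2 : ℂ) ^ (-s)‖ < 1 := by
  have h := norm_cpow_eq_rpow_re_of_pos (two_pos : (0 : ℝ) < 2) (-s)
  rw [ofReal_ofNat] at h
  rw [h, neg_re]
  exact Real.rpow_lt_one_of_one_lt_of_neg one_lt_two (neg_lt_zero.mpr hs)

lemma hasDerivAt_two_cpow_neg (s : ℂ) :
    HasDerivAt (fun z : ℂ => (2 : ℂ) ^ (-z)) ((2 : ℂ) ^ (-s) * log 2 * (-1)) s :=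
  (hasDerivAt_neg s).const_cpow (Or.inl two_ne_zero)

/-- For any points `ξ, γ` in `ℂ_{1/2}` there is a Dirichlet polynomial
`χ(s) = c₁ + c₂ 2^{-s}` mapping `ℂ₀` into `ℂ_{1/2}` with `χ(γ) = ξ` and `χ'(γ) ≠ 0`. -/
theorem stmt15 (ξ γ : ℂ) (hξ : 1 / 2 < ξ.re) (hγ : 1 / 2 < γ.re) :
    ∃ c₁ c₂ : ℂ, c₂ ≠ 0 ∧
      (∀ s : ℂ, 0 < s.re → 1 / 2 < (c₁ + c₂ * (2 : ℂ) ^ (-s)).re) ∧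
      c₁ + c₂ * (2 : ℂ) ^ (-γ) = ξ ∧
      deriv (fun s : ℂ => c₁ + c₂ * (2 : ℂ) ^ (-s)) γ ≠ 0 := by
  obtain ⟨δ, hδ, hξδ⟩ : ∃ δ : ℝ, 0 < δ ∧ ξ.re = 1 / 2 + 2 * δ :=
    ⟨(ξ.re - 1 / 2) / 2, by linarith, by ring⟩
  have hδ' : (δ : ℂ) ≠ 0 := ofReal_ne_zero.mpr hδ.ne'
  refine ⟨ξ - δ * (2 : ℂ) ^ (-γ), δ, hδ', fun s hs => ?_, by ring, ?_⟩
  · have h₁ := neg_lt_of_abs_lt ((abs_re_le_norm _).trans_lt (norm_two_cpow_neg_lt_one hs))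
    have h₂ := lt_of_abs_lt ((abs_re_le_norm _).trans_lt
      (norm_two_cpow_neg_lt_one (show 0 < γ.re by linarith)))
    rw [add_re, sub_re, re_ofReal_mul, re_ofReal_mul, hξδ]
    nlinarith
  · rw [(((hasDerivAt_two_cpow_neg γ).const_mul (δ : ℂ)).const_add _).deriv]
    have hlog : log (2 : ℂ) ≠ 0 := by
      rw [← ofReal_ofNat, ← ofReal_log zero_le_two, ofReal_ne_zero]
      exact (Real.log_pos one_lt_two).ne'
    have hpow : (2 : ℂ) ^ (-γ) ≠ 0 := cpow_ne_zero_iff.mpr (Or.inl two_ne_zero)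
    exact mul_ne_zero hδ' (mul_ne_zero (mul_ne_zero hpow hlog) (neg_ne_zero.mpr one_ne_zero))
end

section
/- Let φ(s) = ∑_{n≥1} c_n n^{−s} be a Dirichlet series converging uniformly on ℂ_ε for every ε > 0 such that for some θ > 1/2 and B > 0 one has Re φ(s) ≥ θ and |φ(s)| ≤ B for all s ∈ ℂ₀ (i.e., the closure of φ(ℂ₀) is a compact subset of ℂ_{1/2}). Then the composition operator C_φ is bounded on ℋ² and there exist C > 0 and r ∈ (0,1) with a_n(C_φ) ≤ C·rⁿ for all n ≥ 1. -/
open Complex Filter MeasureTheory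

noncomputable section

open scoped Topology ComplexConjugate

/-- The bilinear pairing `x ↦ ∑ x n * w n` on square-summable sequences. -/
def pairing (w : H2) : H2 →L[ℂ] ℂ := innerSL ℂ (star w)

lemma pairing_apply (w x : H2) : pairing w x = ∑' n : ℕ+, x n * w n := by
  simp [pairing, lp.inner_eq_tsum]

lemma pairing_comm (w x : H2) : pairing w x = pairing x w := by
  simp only [pairing_apply, mul_comm]

lemma norm_pairing (w : H2) : ‖pairing w‖ = ‖w‖ := by
  rw [pairing, innerSL_apply_norm, norm_star]

lemma norm_pnat_cpow (n : ℕ+) (z : ℂ) : ‖(n : ℂ) ^ z‖ = (n : ℝ) ^ z.re :=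
  norm_natCast_cpow_of_pos n.pos z

lemma pnat_cpow_eq_exp (n : ℕ+) (z : ℂ) : (n : ℂ) ^ z = exp ((Real.log n : ℝ) * z) := by
  rw [cpow_def_of_ne_zero (by exact_mod_cast n.ne_zero), ← natCast_log]

lemma memℓp_cpow {z : ℂ} (hz : 1 / 2 < z.re) :
    Memℓp (fun n : ℕ+ => (n : ℂ) ^ (-z)) 2 := by
  refine memℓp_gen ?_
  have h : Summable fun n : ℕ => (n : ℝ) ^ (-(2 * z.re)) :=
    Real.summable_nat_rpow.2 (by linarith)
  refine (h.comp_injective PNat.coe_injective).congr fun n => ?_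
  rw [norm_pnat_cpow, Function.comp_apply, ENNReal.toReal_ofNat, ← Real.rpow_mul (by positivity)]
  congr 1
  simp [mul_comm]

/-- The sequence `n ^ (-z)`, representing evaluation at `z`. -/
def evalKernel (z : ℂ) (hz : 1 / 2 < z.re) : H2 := ⟨fun n => (n : ℂ) ^ (-z), memℓp_cpow hz⟩

lemma evalKernel_apply (z : ℂ) (hz : 1 / 2 < z.re) (n : ℕ+) :
    evalKernel z hz n = (n : ℂ) ^ (-z) := rfl

lemma H2series_eq_pairing (x : H2) (z : ℂ) (hz : 1 / 2 < z.re) :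
    H2series x z = pairing (evalKernel z hz) x := by
  rw [pairing_apply]; rfl

/-- Averages of the powers of a unimodular number. -/
lemma tendsto_average_pow {w : ℂ} (hw : ‖w‖ = 1) :
    Tendsto (fun J : ℕ => (J : ℂ)⁻¹ * ∑ j ∈ Finset.range J, w ^ j) atTop
      (𝓝 (if w = 1 then 1 else 0)) := by
  split_ifs with h
  · refine tendsto_const_nhds.congr' ?_
    filter_upwards [eventually_gt_atTop 0] with J hJ
    have : (J : ℂ) ≠ 0 := by exact_mod_cast hJ.ne'
    simp [h, this]
  · refine squeeze_zero_norm (a := fun J : ℕ => (J : ℝ)⁻¹ * (2 / ‖w - 1‖)) (fun J => ?_) ?_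
    · rw [norm_mul, norm_inv, Complex.norm_natCast, geom_sum_eq h, norm_div]
      gcongr
      calc ‖w ^ J - 1‖ ≤ ‖w ^ J‖ + ‖(1 : ℂ)‖ := norm_sub_le _ _
        _ = 2 := by rw [norm_pow, hw]; norm_num
    · simpa using (tendsto_inv_atTop_nhds_zero_nat (𝕜 := ℝ)).mul_const (2 / ‖w - 1‖)

lemma sum_norm_sq_le_of_exponential_sum_le {ι : Type*} (S : Finset ι) (a z : ι → ℂ)
    (hz : ∀ n ∈ S, ‖z n‖ = 1) (hinj : Set.InjOn z S) {M : ℝ}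
    (hM : ∀ j : ℕ, ‖∑ n ∈ S, a n * z n ^ j‖ ≤ M) : ∑ n ∈ S, ‖a n‖ ^ 2 ≤ M ^ 2 := by
  have hlim : Tendsto (fun J : ℕ => (J : ℂ)⁻¹ * ∑ j ∈ Finset.range J,
      (∑ n ∈ S, a n * z n ^ j) * conj (∑ n ∈ S, a n * z n ^ j)) atTop
      (𝓝 ((∑ n ∈ S, ‖a n‖ ^ 2 : ℝ) : ℂ)) := by
    have h1 : Tendsto (fun J : ℕ => ∑ m ∈ S, ∑ n ∈ S, a m * conj (a n) *
        ((J : ℂ)⁻¹ * ∑ j ∈ Finset.range J, (z m * conj (z n)) ^ j)) atTop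
        (𝓝 (∑ m ∈ S, ∑ n ∈ S, a m * conj (a n) * if z m * conj (z n) = 1 then 1 else 0)) := by
      refine tendsto_finsetSum _ fun m hm => tendsto_finsetSum _ fun n hn => ?_
      refine (tendsto_average_pow ?_).const_mul _
      rw [norm_mul, RCLike.norm_conj, hz m hm, hz n hn, one_mul]
    convert h1 using 1
    · ext J
      simp only [map_sum, map_mul, map_pow, Finset.sum_mul_sum, mul_pow]
      simp only [Finset.mul_sum]
      rw [Finset.sum_comm]
      refine Finset.sum_congr rfl fun m _ => ?_
      rw [Finset.sum_comm]
      refine Finset.sum_congr rfl fun n _ => Finset.sum_congr rfl fun j _ => ?_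
      ring
    · congr 1
      push_cast
      refine Finset.sum_congr rfl fun m hm => ?_
      rw [Finset.sum_eq_single_of_mem m hm]
      · simp [mul_conj', hz m hm]
      · intro n hn hnm
        rw [if_neg, mul_zero]
        intro h
        apply hnm
        apply hinj hn hm
        have h2 : z n * conj (z n) = 1 := by simp [mul_conj', hz n hn]
        have h3 : conj (z n) ≠ 0 := right_ne_zero_of_mul_eq_one h2
        exact mul_right_cancel₀ h3 (h2.trans h.symm)
  have hM0 : 0 ≤ M := (norm_nonneg _).trans (hM 0)
  have := le_of_tendsto hlim.norm (b := M ^ 2) (Eventually.of_forall fun J => ?_)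
  · rwa [norm_real, Real.norm_of_nonneg (by positivity)] at this
  · rw [norm_mul, norm_inv, Complex.norm_natCast]
    have h1 : ‖∑ j ∈ Finset.range J,
        (∑ n ∈ S, a n * z n ^ j) * conj (∑ n ∈ S, a n * z n ^ j)‖ ≤ J * M ^ 2 := by
      have h2 : (J : ℝ) * M ^ 2 = ∑ j ∈ Finset.range J, M ^ 2 := by simp
      rw [h2]
      refine norm_sum_le_of_le _ fun j _ => ?_
      rw [norm_mul, RCLike.norm_conj, ← sq]
      exact pow_le_pow_left₀ (norm_nonneg _) (hM j) 2
    rcases Nat.eq_zero_or_pos J with rfl | hJ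
    · simp; positivity
    · rw [inv_mul_le_iff₀ (by exact_mod_cast hJ)]
      exact h1

/-- Dirichlet polynomials, as elements of the monoid algebra of `ℕ+`. -/
abbrev DPoly := MonoidAlgebra ℂ ℕ+

/-- Evaluation of Dirichlet polynomials. -/
def dEval (s : ℂ) : DPoly →ₐ[ℂ] ℂ :=
  MonoidAlgebra.lift ℂ ℂ ℕ+
    { toFun := fun n => (n : ℂ) ^ (-s)
      map_one' := by simp
      map_mul' := fun m n => by
        rw [PNat.mul_coe, Nat.cast_mul, natCast_mul_natCast_cpow] }

lemma dEval_apply (s : ℂ) (p : DPoly) :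
    dEval s p = ∑ n ∈ p.coeff.support, p.coeff n * (n : ℂ) ^ (-s) := by
  rw [dEval, MonoidAlgebra.lift_apply]; rfl

lemma dEval_single (s : ℂ) (n : ℕ+) (a : ℂ) :
    dEval s (MonoidAlgebra.single n a) = a * (n : ℂ) ^ (-s) := by
  rw [dEval, MonoidAlgebra.lift_single]; rfl

/-- The coefficient sequence of the vertical translate of a Dirichlet polynomial. -/
def twist (σ : ℝ) (p : DPoly) : H2 :=
  ⟨fun n => p.coeff n * (n : ℂ) ^ (-(σ : ℂ)), by
    refine Memℓp.of_exponent_ge (memℓp_zero ?_) zero_le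
    refine p.coeff.hasFiniteSupport.subset fun n hn => ?_
    exact left_ne_zero_of_mul hn⟩

lemma twist_apply (σ : ℝ) (p : DPoly) (n : ℕ+) :
    twist σ p n = p.coeff n * (n : ℂ) ^ (-(σ : ℂ)) := rfl

lemma twist_sub (σ : ℝ) (p q : DPoly) : twist σ (p - q) = twist σ p - twist σ q := by
  ext n
  simp [twist_apply, sub_mul]

lemma norm_twist_le (σ : ℝ) (p : DPoly) {M : ℝ}
    (hM : ∀ t : ℝ, ‖dEval (σ + t * I) p‖ ≤ M) : ‖twist σ p‖ ≤ M := by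
  have hM0 : 0 ≤ M := (norm_nonneg _).trans (hM 0)
  refine lp.norm_le_of_tsum_le (by norm_num) hM0 ?_
  rw [tsum_eq_sum (s := p.coeff.support)]
  swap
  · intro n hn
    simp [twist_apply, Finsupp.notMem_support_iff.1 hn]
  simp only [ENNReal.toReal_ofNat, Real.rpow_ofNat]
  set S := p.coeff.support
  have hlog : ∀ n : ℕ+, 0 ≤ Real.log n := fun n => Real.log_nonneg (Nat.one_le_cast.2 n.pos)
  set L := 1 + ∑ n ∈ S, Real.log n
  have hL1 : ∀ n ∈ S, Real.log n < L := fun n hn => by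
    have := Finset.single_le_sum (f := fun n : ℕ+ => Real.log n) (fun n _ => hlog n) hn
    linarith
  have hL0 : 0 < L := by
    have := Finset.sum_nonneg fun n (_ : n ∈ S) => hlog n
    linarith
  have hbd : ∀ n ∈ S, Real.log n / L < 1 := fun n hn => (div_lt_one hL0).2 (hL1 n hn)
  have hbd0 : ∀ n : ℕ+, 0 ≤ Real.log n / L := fun n => div_nonneg (hlog n) hL0.le
  refine sum_norm_sq_le_of_exponential_sum_le S _ (fun n => exp ((Real.log n / L : ℝ) * I))
    (fun n _ => norm_exp_ofReal_mul_I _) ?_ (fun j => ?_)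
  · intro m hm n hn h
    have hpi := Real.pi_gt_three
    have him : ∀ r : ℝ, ((r : ℂ) * I).im = r := fun r => by simp
    have := exp_inj_of_neg_pi_lt_of_le_pi (by rw [him]; linarith [hbd0 m])
      (by rw [him]; linarith [hbd m hm]) (by rw [him]; linarith [hbd0 n])
      (by rw [him]; linarith [hbd n hn]) h
    have h2 := ofReal_injective (mul_right_cancel₀ I_ne_zero this)
    have h3 : Real.log m = Real.log n := by field_simp at h2; exact h2
    have h4 := Real.log_injOn_pos (Set.mem_Ioi.2 (by exact_mod_cast m.pos))
      (Set.mem_Ioi.2 (by exact_mod_cast n.pos)) h3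
    exact_mod_cast h4
  · convert hM (-(j / L)) using 2
    rw [dEval_apply]
    refine Finset.sum_congr rfl fun n _ => ?_
    rw [twist_apply, ← exp_nat_mul, pnat_cpow_eq_exp, pnat_cpow_eq_exp, mul_assoc, ← exp_add]
    congr 2
    push_cast
    ring

lemma H2series_twist (σ : ℝ) (p : DPoly) (z : ℂ) :
    H2series (twist σ p) z = dEval (z + σ) p := by
  rw [H2series, dEval_apply, tsum_eq_sum (s := p.coeff.support)]
  · refine Finset.sum_congr rfl fun n _ => ?_
    rw [twist_apply, mul_assoc, ← cpow_add _ _ (by exact_mod_cast n.ne_zero)]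
    congr 2
    ring
  · intro n hn
    simp [twist_apply, Finsupp.notMem_support_iff.1 hn]

/-- The twists of a uniformly convergent sequence of Dirichlet polynomials converge. -/
lemma exists_tendsto_twist (p : ℕ → DPoly) (g : ℂ → ℂ) (M : ℝ)
    (hp : ∀ ε : ℝ, 0 < ε → TendstoUniformlyOn (fun j s => dEval s (p j)) g atTop {s | ε < s.re})
    (hg : ∀ s : ℂ, 0 < s.re → ‖g s‖ ≤ M) {σ : ℝ} (hσ : 0 < σ) :
    ∃ b : H2, Tendsto (fun j => twist σ (p j)) atTop (𝓝 b) ∧ ‖b‖ ≤ M := by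
  have hmem : ∀ t : ℝ, (σ + t * I : ℂ) ∈ {s : ℂ | σ / 2 < s.re} := fun t => by
    simp; linarith
  have hunif := hp (σ / 2) (by positivity)
  have hcauchy : CauchySeq fun j => twist σ (p j) := by
    refine Metric.cauchySeq_iff.2 fun η hη => ?_
    obtain ⟨N, hN⟩ := Metric.uniformCauchySeqOn_iff.1 hunif.uniformCauchySeqOn (η / 2) (by positivity)
    refine ⟨N, fun i hi j hj => ?_⟩
    rw [dist_eq_norm, ← twist_sub]
    refine (norm_twist_le σ _ fun t => ?_).trans_lt (half_lt_self hη)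
    rw [map_sub, ← dist_eq_norm]
    exact (hN i hi j hj _ (hmem t)).le
  obtain ⟨b, hb⟩ := cauchySeq_tendsto_of_complete hcauchy
  refine ⟨b, hb, le_of_forall_pos_le_add fun η hη => le_of_tendsto hb.norm ?_⟩
  filter_upwards [Metric.tendstoUniformlyOn_iff.1 hunif η hη] with j hj
  refine norm_twist_le σ _ fun t => ?_
  have h1 := hj _ (hmem t)
  have h2 := hg (σ + t * I) (by simpa using hσ)
  rw [dist_eq_norm, norm_sub_rev] at h1
  calc ‖dEval (σ + t * I) (p j)‖
      = ‖g (σ + t * I) + (dEval (σ + t * I) (p j) - g (σ + t * I))‖ := by ring_nf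
    _ ≤ ‖g (σ + t * I)‖ + ‖dEval (σ + t * I) (p j) - g (σ + t * I)‖ := norm_add_le _ _
    _ ≤ M + η := add_le_add h2 h1.le

/-- A function bounded by `M` on the right half-plane that is a limit of Dirichlet polynomials,
uniformly on each smaller half-plane, belongs to `ℋ²` with norm at most `M`. -/
lemma exists_H2_of_bounded (p : ℕ → DPoly) (g : ℂ → ℂ) (M : ℝ)
    (hp : ∀ ε : ℝ, 0 < ε → TendstoUniformlyOn (fun j s => dEval s (p j)) g atTop {s | ε < s.re})
    (hg : ∀ s : ℂ, 0 < s.re → ‖g s‖ ≤ M) :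
    ∃ x : H2, ‖x‖ ≤ M ∧ ∀ s : ℂ, 1 / 2 < s.re → H2series x s = g s := by
  choose! b hb hbM using fun σ (hσ : 0 < σ) => exists_tendsto_twist p g M hp hg (σ := σ) hσ
  have hcoord : ∀ σ : ℝ, 0 < σ → ∀ n : ℕ+,
      Tendsto (fun j => (p j).coeff n * (n : ℂ) ^ (-(σ : ℂ))) atTop (𝓝 (b σ n)) := fun σ hσ n =>
    ((lp.evalCLM ℂ (fun _ : ℕ+ => ℂ) 2 n).continuous.tendsto _).comp (hb σ hσ)
  have hne : ∀ (n : ℕ+) (z : ℂ), (n : ℂ) ^ z ≠ 0 := fun n z =>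
    norm_ne_zero_iff.1 (by rw [norm_pnat_cpow]; have := n.pos; positivity)
  set d : ℕ+ → ℂ := fun n => b 1 n * ((n : ℂ) ^ (-((1 : ℝ) : ℂ)))⁻¹
  have hd : ∀ n, Tendsto (fun j => (p j).coeff n) atTop (𝓝 (d n)) := fun n => by
    refine ((hcoord 1 one_pos n).mul_const _).congr fun j => ?_
    rw [mul_inv_cancel_right₀ (hne _ _)]
  have hbd : ∀ σ : ℝ, 0 < σ → ∀ n : ℕ+, b σ n = d n * (n : ℂ) ^ (-(σ : ℂ)) := fun σ hσ n =>
    tendsto_nhds_unique (hcoord σ hσ n) ((hd n).mul_const _)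
  have hpos : ∀ k : ℕ, (0 : ℝ) < 1 / ((k : ℝ) + 1) := fun k => by positivity
  have hlim : Tendsto (id fun k : ℕ => (b (1 / ((k : ℝ) + 1)) : ℕ+ → ℂ)) atTop (𝓝 d) := by
    refine tendsto_pi_nhds.2 fun n => ?_
    have h0 : Tendsto (fun k : ℕ => ((1 / ((k : ℝ) + 1) : ℝ) : ℂ)) atTop (𝓝 ((0 : ℝ) : ℂ)) :=
      (continuous_ofReal.tendsto _).comp tendsto_one_div_add_atTop_nhds_zero_nat
    have h1 : Tendsto (fun k : ℕ => d n * (n : ℂ) ^ (-((1 / ((k : ℝ) + 1) : ℝ) : ℂ))) atTop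
        (𝓝 (d n * (n : ℂ) ^ (-((0 : ℝ) : ℂ)))) :=
      (h0.neg.const_cpow (Or.inl (by exact_mod_cast n.ne_zero))).const_mul _
    simp only [ofReal_zero, neg_zero, cpow_zero, mul_one] at h1
    exact h1.congr fun k => (hbd _ (hpos k) n).symm
  have hmem : Memℓp d 2 := by
    refine lp.memℓp_of_tendsto ?_ hlim
    exact isBounded_iff_forall_norm_le.2 ⟨M, by rintro _ ⟨k, rfl⟩; exact hbM _ (hpos k)⟩
  refine ⟨⟨d, hmem⟩, lp.norm_le_of_tendsto (Eventually.of_forall fun k => hbM _ (hpos k)) hlim,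
    fun s hs => ?_⟩
  set σ : ℝ := (s.re - 1 / 2) / 2 with hσdef
  have hσ : 0 < σ := by linarith
  have hz : 1 / 2 < (s - σ).re := by simp; linarith
  have h1 : H2series ⟨d, hmem⟩ s = H2series (b σ) (s - σ) := by
    refine tsum_congr fun n => ?_
    change d n * (n : ℂ) ^ (-s) = _
    have h2 : (n : ℂ) ^ (-s) = (n : ℂ) ^ (-(σ : ℂ)) * (n : ℂ) ^ (-(s - σ)) := by
      rw [← cpow_add _ _ (by exact_mod_cast n.ne_zero)]
      congr 1
      ring
    rw [hbd σ hσ, h2, ← mul_assoc]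
  have h2 := ((pairing (evalKernel _ hz)).continuous.tendsto _).comp (hb σ hσ)
  rw [h1, H2series_eq_pairing _ _ hz]
  refine tendsto_nhds_unique h2 ?_
  refine ((hp (1 / 2) (by norm_num)).tendsto_at hs).congr fun j => ?_
  rw [Function.comp_apply, ← H2series_eq_pairing, H2series_twist, sub_add_cancel]

/-- The Taylor expansion at `a` of the evaluation kernel. -/
lemma exists_taylor_evalKernel {a θ : ℝ} (hθ : 1 / 2 < θ) (ha : θ < a) :
    ∃ (F : ℕ → H2) (A : ℝ), 0 ≤ A ∧ (∀ k, ‖F k‖ ≤ A / (a - θ) ^ k) ∧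
      ∀ (z : ℂ) (hz : 1 / 2 < z.re), ‖z - a‖ < a - θ →
        HasSum (fun k => (z - a) ^ k • F k) (evalKernel z hz) := by
  have hR : 0 < a - θ := sub_pos.2 ha
  set f : ℕ → ℕ+ → ℂ := fun k n =>
    (n : ℂ) ^ (-(a : ℂ)) * ((-(Real.log n : ℂ)) ^ k / (k.factorial : ℂ)) with hf
  have hθ' : 1 / 2 < (θ : ℂ).re := by simpa using hθ
  set K := evalKernel θ hθ'
  have hfK : ∀ k n, ‖f k n‖ ≤ ‖((((a - θ) ^ k)⁻¹ : ℝ) • K) n‖ := fun k n => by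
    have hlog : 0 ≤ Real.log n := Real.log_nonneg (Nat.one_le_cast.2 n.pos)
    have hn : (0 : ℝ) < n := by exact_mod_cast n.pos
    have h1 := Real.pow_div_factorial_le_exp ((a - θ) * Real.log n) (by positivity) k
    have h2 : Real.exp ((a - θ) * Real.log n) = (n : ℝ) ^ (a - θ) := by
      rw [Real.rpow_def_of_pos hn, mul_comm]
    rw [lp.coeFn_smul, Pi.smul_apply, norm_smul, evalKernel_apply, norm_pnat_cpow,
      Real.norm_of_nonneg (by positivity), hf]
    simp only [norm_mul, norm_div, norm_pow, norm_neg, norm_real, norm_natCast, norm_pnat_cpow,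
      neg_re, ofReal_re, Real.norm_of_nonneg hlog]
    rw [← div_eq_inv_mul, le_div_iff₀ (by positivity)]
    calc (n : ℝ) ^ (-a) * (Real.log n ^ k / k.factorial) * (a - θ) ^ k
        = (n : ℝ) ^ (-a) * (((a - θ) * Real.log n) ^ k / k.factorial) := by
          rw [mul_pow]; ring
      _ ≤ (n : ℝ) ^ (-a) * (n : ℝ) ^ (a - θ) := by rw [← h2]; gcongr
      _ = (n : ℝ) ^ (-θ) := by rw [← Real.rpow_add hn]; congr 1; ring
  have hmem : ∀ k, Memℓp (f k) 2 := fun k =>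
    (lp.memℓp ((((a - θ) ^ k)⁻¹ : ℝ) • K)).mono' (hfK k)
  refine ⟨fun k => ⟨f k, hmem k⟩, ‖K‖, norm_nonneg _, fun k => ?_, fun z hz hza => ?_⟩
  · refine (lp.norm_mono (by norm_num) (hfK k)).trans (le_of_eq ?_)
    rw [norm_smul, Real.norm_of_nonneg (by positivity), div_eq_inv_mul]
  · have hsum : Summable fun k => (z - a) ^ k • (⟨f k, hmem k⟩ : H2) := by
      refine Summable.of_norm_bounded (g := fun k => ‖K‖ * (‖z - a‖ / (a - θ)) ^ k) ?_ fun k => ?_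
      · exact (summable_geometric_of_lt_one (by positivity) ((div_lt_one hR).2 hza)).mul_left _
      · rw [norm_smul, norm_pow]
        have : ‖(⟨f k, hmem k⟩ : H2)‖ ≤ ‖K‖ / (a - θ) ^ k := by
          refine (lp.norm_mono (by norm_num) (hfK k)).trans (le_of_eq ?_)
          rw [norm_smul, Real.norm_of_nonneg (by positivity), div_eq_inv_mul]
        calc ‖z - a‖ ^ k * _ ≤ ‖z - a‖ ^ k * (‖K‖ / (a - θ) ^ k) := by gcongr
          _ = _ := by rw [div_pow]; ring
    convert hsum.hasSum
    refine lp.ext (funext fun n => ?_)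
    refine HasSum.unique ?_ ((lp.evalCLM ℂ (fun _ : ℕ+ => ℂ) 2 n).hasSum hsum.hasSum)
    have h1 := (NormedSpace.expSeries_div_hasSum_exp (-(Real.log n : ℂ) * (z - a))).mul_left
      ((n : ℂ) ^ (-(a : ℂ)))
    rw [← exp_eq_exp_ℂ] at h1
    have hval : evalKernel z hz n = (n : ℂ) ^ (-(a : ℂ)) * exp (-(Real.log n : ℂ) * (z - a)) := by
      rw [evalKernel_apply, pnat_cpow_eq_exp, pnat_cpow_eq_exp, ← exp_add]
      congr 1
      ring
    rw [hval]
    refine h1.congr_fun fun k => ?_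
    change (z - a) ^ k * f k n = _
    rw [hf, mul_pow]
    ring

/-- Operators given by geometrically convergent series of rank-one operators have
geometrically decaying approximation numbers. -/
lemma approxNumber_le_of_hasSum {E F : Type*} [NormedAddCommGroup E] [NormedSpace ℂ E]
    [NormedAddCommGroup F] [NormedSpace ℂ F] (T : E →L[ℂ] F) (u : ℕ → E →L[ℂ] ℂ) (g : ℕ → F)
    (hT : HasSum (fun k => (u k).smulRight (g k)) T) {A ρ : ℝ}
    (hρ0 : 0 ≤ ρ) (hρ : ρ < 1) (hu : ∀ k, ‖(u k).smulRight (g k)‖ ≤ A * ρ ^ k)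
    (n : ℕ) : approxNumber T (n + 1) ≤ A * (1 - ρ)⁻¹ * ρ ^ n := by
  classical
  set R := ∑ k ∈ Finset.range n, (u k).smulRight (g k) with hR
  set V := Submodule.span ℂ (((Finset.range n).image g : Finset F) : Set F)
  have hRV : LinearMap.range (R : E →ₗ[ℂ] F) ≤ V := by
    rintro _ ⟨x, rfl⟩
    simp only [hR, ContinuousLinearMap.coe_coe, sum_apply,
      ContinuousLinearMap.smulRight_apply]
    exact Submodule.sum_mem _ fun k hk => Submodule.smul_mem _ _
      (Submodule.subset_span (by simpa using ⟨k, Finset.mem_range.1 hk, rfl⟩))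
  have hV : FiniteDimensional ℂ V := FiniteDimensional.span_finset ℂ _
  have hfin : Module.finrank ℂ V ≤ n :=
    (finrank_span_finset_le_card _).trans (Finset.card_image_le.trans (by simp))
  have hle : approxNumber T (n + 1) ≤ ‖T - R‖ := by
    refine csInf_le ⟨0, ?_⟩ ⟨R, Submodule.finiteDimensional_of_le hRV,
      Nat.lt_succ_of_le ((Submodule.finrank_mono hRV).trans hfin), rfl⟩
    rintro _ ⟨_, _, _, rfl⟩
    exact norm_nonneg _
  refine hle.trans ?_
  have h1 : T - R = ∑' k, (u (k + n)).smulRight (g (k + n)) := by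
    rw [sub_eq_iff_eq_add', hR, ← hT.tsum_eq]
    exact (hT.summable.sum_add_tsum_nat_add n).symm
  rw [h1]
  refine tsum_of_norm_bounded (g := fun k => A * ρ ^ n * ρ ^ k) ?_ fun k => ?_
  · rw [mul_right_comm]
    exact (hasSum_geometric_of_lt_one hρ0 hρ).mul_left (A * ρ ^ n)
  · refine (hu _).trans (le_of_eq ?_)
    rw [pow_add]; ring

lemma exists_dPoly_partialSum (c : ℕ → ℂ) (N : ℕ) :
    ∃ p : DPoly, ∀ s, dEval s p = ∑ n ∈ Finset.range N, LSeries.term c s n := by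
  induction N with
  | zero => exact ⟨0, by simp⟩
  | succ N ih =>
    obtain ⟨p, hp⟩ := ih
    rcases Nat.eq_zero_or_pos N with rfl | hN
    · exact ⟨0, by simp⟩
    · obtain ⟨m, rfl⟩ : ∃ m : ℕ+, (m : ℕ) = N := ⟨⟨N, hN⟩, rfl⟩
      refine ⟨p + MonoidAlgebra.single m (c m), fun s => ?_⟩
      rw [map_add, hp, dEval_single, Finset.sum_range_succ, LSeries.term_of_ne_zero hN.ne',
        cpow_neg, div_eq_mul_inv]

/-- Powers of `φ - a` belong to `ℋ²` when `φ` is a bounded Dirichlet series. -/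
lemma exists_H2_pow_sub {φ : ℂ → ℂ} {c : ℕ → ℂ} (hconv : DSConvUnif c φ) {B : ℝ}
    (hB : ∀ s : ℂ, 0 < s.re → ‖φ s‖ ≤ B) {a : ℂ} {M : ℝ}
    (hM : ∀ s : ℂ, 0 < s.re → ‖φ s - a‖ ≤ M) (k : ℕ) :
    ∃ x : H2, ‖x‖ ≤ M ^ k ∧ ∀ s : ℂ, 1 / 2 < s.re → H2series x s = (φ s - a) ^ k := by
  choose p hp using exists_dPoly_partialSum c
  refine exists_H2_of_bounded (fun N => (p N - algebraMap ℂ DPoly a) ^ k) _ _ (fun ε hε => ?_)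
    fun s hs => ?_
  · have hunif := hconv ε hε
    have huc : UniformContinuousOn (fun z : ℂ => (z - a) ^ k) (Metric.closedBall 0 (B + 1)) :=
      (isCompact_closedBall _ _).uniformContinuousOn_of_continuous (by fun_prop)
    have := huc.comp_tendstoUniformlyOn_eventually (t := {s : ℂ | ε < s.re})
      (F := fun N s => ∑ n ∈ Finset.range N, LSeries.term c s n) (f := φ) (p := atTop) ?_ ?_ hunif
    · convert this using 3
      rw [map_pow, map_sub, AlgHom.commutes, hp, Algebra.algebraMap_self_apply]
    · filter_upwards [Metric.tendstoUniformlyOn_iff.1 hunif 1 one_pos] with N hN s hs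
      have h1 := hN s hs
      have h2 := hB s (hε.trans hs)
      rw [dist_comm] at h1
      rw [Metric.mem_closedBall]
      refine (dist_triangle _ (φ s) _).trans ?_
      rw [dist_zero_right]
      linarith
    · intro s hs
      rw [Metric.mem_closedBall, dist_zero_right]
      linarith [hB s (hε.trans hs)]
  · rw [norm_pow]
    exact pow_le_pow_left₀ (norm_nonneg _) (hM s hs) k

/-- The intersection of a half-plane and a disc lies well inside a disc centred far to the right. -/
lemma exists_disc {θ' θ B : ℝ} (h : θ' < θ) (hθ' : 0 < θ') :
    ∃ a M : ℝ, θ' < a ∧ 0 < M ∧ M < a - θ' ∧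
      ∀ z : ℂ, θ ≤ z.re → ‖z‖ ≤ B → ‖z - a‖ ≤ M := by
  have hd : 0 < θ - θ' := sub_pos.2 h
  set a := 2 * θ + B ^ 2 / (2 * (θ - θ')) with ha
  have hq : 0 ≤ B ^ 2 / (2 * (θ - θ')) := by positivity
  have h2 : B ^ 2 = 2 * (a - 2 * θ) * (θ - θ') := by rw [ha]; field_simp; ring
  have ha2 : 2 * θ ≤ a := by linarith
  have haθ : 0 < a - θ' := by linarith
  have hM2 : B ^ 2 - 2 * a * θ + a ^ 2 < (a - θ') ^ 2 := by nlinarith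
  refine ⟨a, √(max (B ^ 2 - 2 * a * θ + a ^ 2) ((a - θ') ^ 2 / 2)), by linarith,
    Real.sqrt_pos.2 (lt_max_of_lt_right (by positivity)), ?_, fun z hz hzB => ?_⟩
  · rw [Real.sqrt_lt' haθ]
    exact max_lt hM2 (half_lt_self (by positivity))
  · refine Real.le_sqrt_of_sq_le (le_max_of_le_left ?_)
    have h3 : ‖z‖ ^ 2 ≤ B ^ 2 := pow_le_pow_left₀ (norm_nonneg _) hzB 2
    rw [Complex.sq_norm, normSq_apply] at h3 ⊢
    simp only [sub_re, sub_im, ofReal_re, ofReal_im]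
    nlinarith

theorem stmt16 (φ : ℂ → ℂ) (c : ℕ → ℂ) (hconv : DSConvUnif c φ)
    (θ B : ℝ) (hθ : 1 / 2 < θ) (hB : 0 < B)
    (hmap : ∀ s : ℂ, 0 < s.re → θ ≤ (φ s).re ∧ ‖φ s‖ ≤ B) :
    ∃ T : H2 →L[ℂ] H2, IsCompOp φ T ∧
      ∃ C : ℝ, 0 < C ∧ ∃ r ∈ Set.Ioo (0 : ℝ) 1, ∀ n : ℕ, 1 ≤ n →
        approxNumber T n ≤ C * r ^ n := by
  obtain ⟨θ', hθ'1, hθ'2⟩ := exists_between hθ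
  obtain ⟨a, M, ha, hM, hMR, hdisc⟩ := exists_disc (B := B) hθ'2 (by linarith)
  have hφ : ∀ s : ℂ, 0 < s.re → ‖φ s - a‖ ≤ M := fun s hs =>
    hdisc _ (hmap s hs).1 (hmap s hs).2
  obtain ⟨F, A, hA, hFA, hF⟩ := exists_taylor_evalKernel hθ'1 ha
  choose g hgM hg using exists_H2_pow_sub hconv (fun s hs => (hmap s hs).2) hφ
  have hR : 0 < a - θ' := sub_pos.2 ha
  set ρ := M / (a - θ') with hρ
  have hρ0 : 0 < ρ := div_pos hM hR
  have hρ1 : ρ < 1 := (div_lt_one hR).2 hMR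
  have hu : ∀ k, ‖(pairing (F k)).smulRight (g k)‖ ≤ A * ρ ^ k := fun k => by
    rw [ContinuousLinearMap.norm_smulRight_apply, norm_pairing]
    calc ‖F k‖ * ‖g k‖ ≤ A / (a - θ') ^ k * M ^ k := by gcongr; exacts [hFA k, hgM k]
      _ = A * ρ ^ k := by rw [hρ, div_pow]; ring
  have hsum : Summable fun k => (pairing (F k)).smulRight (g k) :=
    .of_norm_bounded ((summable_geometric_of_lt_one hρ0.le hρ1).mul_left A) hu
  refine ⟨∑' k, (pairing (F k)).smulRight (g k), fun x s hs => ?_,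
    (A + 1) * (1 - ρ)⁻¹ * ρ⁻¹, ?_, ρ, ⟨hρ0, hρ1⟩, fun n hn => ?_⟩
  · have hs0 : 0 < s.re := by linarith
    have hφs : 1 / 2 < (φ s).re := hθ.trans_le (hmap s hs0).1
    rw [H2series_eq_pairing _ _ hs, H2series_eq_pairing _ _ hφs, pairing_comm _ x]
    have h1 := (pairing x).hasSum (hF (φ s) hφs ((hφ s hs0).trans_lt hMR))
    have h2 := ((pairing (evalKernel s hs)).comp
      (ContinuousLinearMap.apply ℂ H2 x)).hasSum hsum.hasSum
    refine h2.unique (h1.congr_fun fun k => ?_)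
    simp only [map_smul, ContinuousLinearMap.comp_apply,
      ContinuousLinearMap.apply_apply, ContinuousLinearMap.smulRight_apply,
      ← H2series_eq_pairing, hg k s hs, smul_eq_mul]
    rw [pairing_comm x, mul_comm]
  · have : 0 < 1 - ρ := sub_pos.2 hρ1
    positivity
  · obtain ⟨m, rfl⟩ := Nat.exists_eq_add_of_le' hn
    refine (approxNumber_le_of_hasSum _ _ _ hsum.hasSum hρ0.le hρ1 hu m).trans ?_
    have h1 : 0 < 1 - ρ := sub_pos.2 hρ1
    calc A * (1 - ρ)⁻¹ * ρ ^ m ≤ (A + 1) * (1 - ρ)⁻¹ * ρ ^ m := by gcongr; linarith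
      _ = _ := by rw [pow_succ]; field_simp
end
end

section
/- Let c₁ ∈ ℂ with Re c₁ > 1/2 and define φ(s) = c₁ + (1 + 2^{−s})/(1 − 2^{−s}) for s ∈ ℂ₀ (a Dirichlet series in powers of 2^{−s}, with φ(ℂ₀) ⊂ ℂ_{Re c₁}). Then the composition operator C_φ is bounded on ℋ² and there exist constants A > 0 and c > 0 such that a_n(C_φ) ≥ c·n^{−A} for all n ≥ 1. -/
open Complex Filter MeasureTheory

noncomputable section

open scoped ComplexConjugate Nat Topology

/-! ### Parseval's identity for power series -/

theorem Real.tendsto_circleAverage_of_bounded {ι E : Type*} [NormedAddCommGroup E]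
    [NormedSpace ℝ E] {l : Filter ι} [l.IsCountablyGenerated] {f : ι → ℂ → E} {r : ι → ℝ}
    {g : ℂ → E} {R B : ℝ}
    (hf : ∀ᶠ i in l, Continuous fun θ => f i (circleMap 0 (r i) θ))
    (hB : ∀ᶠ i in l, ∀ θ, ‖f i (circleMap 0 (r i) θ)‖ ≤ B)
    (hlim : ∀ᵐ θ : ℝ, Tendsto (fun i => f i (circleMap 0 (r i) θ)) l (𝓝 (g (circleMap 0 R θ)))) :
    Tendsto (fun i => circleAverage (f i) 0 (r i)) l (𝓝 (circleAverage g 0 R)) := by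
  unfold Real.circleAverage
  refine (intervalIntegral.tendsto_integral_filter_of_dominated_convergence (fun _ => B)
    ?_ ?_ (by simp) ?_).const_smul _
  · filter_upwards [hf] with i hi using hi.aestronglyMeasurable
  · filter_upwards [hB] with i hi using .of_forall fun θ _ => hi θ
  · filter_upwards [hlim] with θ hθ using fun _ => hθ

theorem summable_norm_mul_pow {a : ℕ → ℂ} {F : ℂ → ℂ}
    (hF : ∀ z ∈ Metric.ball (0 : ℂ) 1, HasSum (fun k => a k * z ^ k) (F z))
    {r : ℝ} (hr0 : 0 ≤ r) (hr1 : r < 1) : Summable fun k => ‖a k‖ * r ^ k := by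
  have := (hF r (by simpa [abs_of_nonneg hr0] using hr1)).summable.norm
  simpa [abs_of_nonneg hr0] using this

theorem circleMap_mem_unitBall {r : ℝ} (hr0 : 0 ≤ r) (hr1 : r < 1) (θ : ℝ) :
    circleMap 0 r θ ∈ Metric.ball (0 : ℂ) 1 := by
  simpa [abs_of_nonneg hr0] using hr1

/-- **Parseval's identity** for power series on the unit disc. -/
theorem hasSum_sq_norm_coeff_eq_circleAverage {a : ℕ → ℂ} {F : ℂ → ℂ}
    (hF : ∀ z ∈ Metric.ball (0 : ℂ) 1, HasSum (fun k => a k * z ^ k) (F z))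
    {r : ℝ} (hr0 : 0 ≤ r) (hr1 : r < 1) :
    HasSum (fun k => ‖a k‖ ^ 2 * r ^ (2 * k)) (Real.circleAverage (fun z => ‖F z‖ ^ 2) 0 r) := by
  have hs := summable_norm_mul_pow hF hr0 hr1
  rw [hasSum_iff_tendsto_nat_of_nonneg (fun k => by positivity)]
  have key : ∀ K : ℕ, ∑ k ∈ Finset.range K, ‖a k‖ ^ 2 * r ^ (2 * k)
      = Real.circleAverage (fun z => ‖∑ k ∈ Finset.range K, a k * z ^ k‖ ^ 2) 0 r := by
    intro K
    let P : Polynomial ℂ := ∑ k ∈ Finset.range K, Polynomial.monomial k (a k * (r : ℂ) ^ k)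
    have hc : ∀ k, P.coeff k = if k < K then a k * (r : ℂ) ^ k else 0 := by
      intro k
      simp [P, Polynomial.finsetSum_coeff, Polynomial.coeff_monomial]
    have h := P.sum_sq_norm_coeff_eq_circleAverage
    rw [Finset.sum_subset (s₂ := Finset.range K)] at h
    · convert h using 1
      · refine Finset.sum_congr rfl fun k hk => ?_
        rw [hc, if_pos (Finset.mem_range.mp hk)]
        simp [abs_of_nonneg hr0, mul_pow, pow_mul']
      · rw [Real.circleAverage_eq_circleAverage_zero_one]
        congr 1
        ext z
        simp [P, Polynomial.eval_finsetSum, mul_pow, mul_assoc]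
    · intro k hk
      rw [Polynomial.mem_support_iff, hc] at hk
      simp only [Finset.mem_range]
      by_contra h'
      simp [h'] at hk
    · intro k _ hk
      simp [Polynomial.notMem_support_iff.mp hk]
  simp_rw [key]
  refine Real.tendsto_circleAverage_of_bounded (B := (∑' k, ‖a k‖ * r ^ k) ^ 2)
    (.of_forall fun K => by fun_prop) (.of_forall fun K θ => ?_) (.of_forall fun θ => ?_)
  · rw [norm_pow, norm_norm]
    gcongr
    refine (norm_sum_le _ _).trans ?_
    simp only [norm_mul, norm_pow, norm_circleMap_zero, abs_of_nonneg hr0]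
    exact hs.sum_le_tsum _ fun k _ => by positivity
  · exact ((hF _ (circleMap_mem_unitBall hr0 hr1 θ)).tendsto_sum_nat.norm).pow 2

theorem tendsto_sum_sq_norm_coeff (a : ℕ → ℂ) (K : ℕ) :
    Tendsto (fun r : ℝ => ∑ k ∈ Finset.range K, ‖a k‖ ^ 2 * r ^ (2 * k)) (𝓝[<] 1)
      (𝓝 (∑ k ∈ Finset.range K, ‖a k‖ ^ 2)) := by
  refine tendsto_nhdsWithin_of_tendsto_nhds ?_
  have : Continuous fun r : ℝ => ∑ k ∈ Finset.range K, ‖a k‖ ^ 2 * r ^ (2 * k) := by fun_prop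
  simpa using this.tendsto 1

theorem eventually_mem_Ico_zero_one : ∀ᶠ r : ℝ in 𝓝[<] 1, r ∈ Set.Ico (0 : ℝ) 1 :=
  mem_of_superset (Ioo_mem_nhdsLT zero_lt_one) Set.Ioo_subset_Ico_self

theorem continuous_comp_circleMap {F : ℂ → ℂ}
    (hF : ContinuousOn F (Metric.ball (0 : ℂ) 1)) {r : ℝ} (hr0 : 0 ≤ r) (hr1 : r < 1) :
    Continuous fun θ => F (circleMap 0 r θ) :=
  hF.comp_continuous (continuous_circleMap 0 r) fun θ => circleMap_mem_unitBall hr0 hr1 θ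

/-- The coefficients of a bounded power series on the unit disc are square summable. -/
theorem sum_sq_norm_coeff_le {a : ℕ → ℂ} {F : ℂ → ℂ} {M : ℝ}
    (hF : ∀ z ∈ Metric.ball (0 : ℂ) 1, HasSum (fun k => a k * z ^ k) (F z))
    (hc : ContinuousOn F (Metric.ball (0 : ℂ) 1))
    (hM : ∀ z ∈ Metric.ball (0 : ℂ) 1, ‖F z‖ ≤ M) (K : ℕ) :
    ∑ k ∈ Finset.range K, ‖a k‖ ^ 2 ≤ M ^ 2 := by
  refine le_of_tendsto (tendsto_sum_sq_norm_coeff a K) ?_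
  filter_upwards [eventually_mem_Ico_zero_one] with r hr
  refine ((hasSum_sq_norm_coeff_eq_circleAverage hF hr.1 hr.2).summable.sum_le_tsum _
    fun k _ => ?_).trans ?_
  · have := hr.1
    positivity
  rw [(hasSum_sq_norm_coeff_eq_circleAverage hF hr.1 hr.2).tsum_eq]
  refine Real.circleAverage_mono_on_of_le_circle ?_ fun z hz => ?_
  · refine Continuous.intervalIntegrable ?_ _ _
    exact (continuous_comp_circleMap hc hr.1 hr.2).norm.pow 2
  · have hz' : z ∈ Metric.ball (0 : ℂ) 1 := by
      rw [mem_sphere_zero_iff_norm, abs_of_nonneg hr.1] at hz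
      simpa [hz] using hr.2
    gcongr
    exact hM z hz'

theorem le_tsum_sq_norm_coeff {a : ℕ → ℂ} {F : ℂ → ℂ} {L : ℝ}
    (hF : ∀ z ∈ Metric.ball (0 : ℂ) 1, HasSum (fun k => a k * z ^ k) (F z))
    (ha : Summable fun k => ‖a k‖ ^ 2)
    (hL : Tendsto (fun r => Real.circleAverage (fun z => ‖F z‖ ^ 2) 0 r) (𝓝[<] 1) (𝓝 L)) :
    L ≤ ∑' k, ‖a k‖ ^ 2 := by
  refine le_of_tendsto hL ?_
  filter_upwards [eventually_mem_Ico_zero_one] with r hr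
  have h := hasSum_sq_norm_coeff_eq_circleAverage hF hr.1 hr.2
  rw [← h.tsum_eq]
  refine h.summable.tsum_le_tsum (fun k => ?_) ha
  exact mul_le_of_le_one_right (by positivity) (pow_le_one₀ hr.1 hr.2.le)

/-! ### The space `ℋ²` -/

theorem H2_norm_sq (x : H2) : ‖x‖ ^ 2 = ∑' n, ‖x n‖ ^ 2 := by
  have := lp.norm_rpow_eq_tsum (p := 2) (by simp) x
  simpa using this

theorem H2_summable_sq (x : H2) : Summable fun n => ‖x n‖ ^ 2 := by
  have := (lp.memℓp x).summable (by simp)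
  simpa using this

theorem summable_pnat_rpow_neg {σ : ℝ} (hσ : 1 / 2 < σ) :
    Summable fun n : ℕ+ => ((n : ℝ) ^ (-σ)) ^ 2 := by
  have h : Summable fun n : ℕ => (n : ℝ) ^ (-(2 * σ)) :=
    Real.summable_nat_rpow.mpr (by linarith)
  refine (h.comp_injective PNat.coe_injective).congr fun n => ?_
  simp only [Function.comp_apply]
  rw [← Real.rpow_natCast, ← Real.rpow_mul (by positivity)]
  congr 1
  push_cast
  ring

theorem H2_summable_norm_mul_rpow (x : H2) {σ : ℝ} (hσ : 1 / 2 < σ) :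
    Summable (fun n : ℕ+ => ‖x n‖ * (n : ℝ) ^ (-σ)) ∧
      ∑' n : ℕ+, ‖x n‖ * (n : ℝ) ^ (-σ) ≤ √(∑' n : ℕ+, ((n : ℝ) ^ (-σ)) ^ 2) * ‖x‖ := by
  have h := Real.summable_and_inner_le_Lp_mul_Lq_tsum_of_nonneg Real.HolderConjugate.two_two
    (f := fun n : ℕ+ => ‖x n‖) (g := fun n : ℕ+ => (n : ℝ) ^ (-σ)) (fun n => norm_nonneg _)
    (fun n => by positivity) (by simpa using H2_summable_sq x)
    (by simpa using summable_pnat_rpow_neg hσ)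
  refine ⟨h.1, h.2.trans_eq ?_⟩
  simp only [Real.rpow_ofNat]
  rw [← H2_norm_sq, ← Real.sqrt_eq_rpow, ← Real.sqrt_eq_rpow, Real.sqrt_sq (norm_nonneg _), mul_comm]

theorem norm_H2series_term_le (x : H2) {σ : ℝ} {s : ℂ} (hs : σ ≤ s.re) (n : ℕ+) :
    ‖x n * (n : ℂ) ^ (-s)‖ ≤ ‖x n‖ * (n : ℝ) ^ (-σ) := by
  rw [norm_mul, Complex.norm_natCast_cpow_of_pos n.pos, neg_re]
  gcongr
  exact_mod_cast n.pos

theorem H2series_summable (x : H2) {s : ℂ} (hs : 1 / 2 < s.re) :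
    Summable fun n : ℕ+ => x n * (n : ℂ) ^ (-s) :=
  (H2_summable_norm_mul_rpow x hs).1.of_norm_bounded (norm_H2series_term_le x le_rfl)

theorem H2series_add (x y : H2) {s : ℂ} (hs : 1 / 2 < s.re) :
    H2series (x + y) s = H2series x s + H2series y s := by
  simp only [H2series, lp.coeFn_add, Pi.add_apply, add_mul]
  exact (H2series_summable x hs).tsum_add (H2series_summable y hs)

theorem H2series_smul (c : ℂ) (x : H2) (s : ℂ) :
    H2series (c • x) s = c * H2series x s := by
  simp only [H2series, lp.coeFn_smul, Pi.smul_apply, smul_eq_mul, mul_assoc]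
  exact tsum_mul_left

/-! ### The composition operator -/

/-- The Cayley transform of the unit disc onto the right half-plane. -/
def cayley (z : ℂ) : ℂ := (1 + z) / (1 - z)

theorem one_sub_ne_zero_of_mem_unitBall {z : ℂ} (hz : z ∈ Metric.ball (0 : ℂ) 1) : 1 - z ≠ 0 := by
  rintro h
  rw [← sub_eq_zero.mp h] at hz
  simp at hz

theorem cayley_re (z : ℂ) : (cayley z).re = (1 - ‖z‖ ^ 2) / ‖1 - z‖ ^ 2 := by
  rw [cayley, div_re, ← add_div, ← normSq_eq_norm_sq, ← normSq_eq_norm_sq]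
  congr 1
  simp [normSq_apply]
  ring

theorem cayley_re_nonneg {z : ℂ} (hz : z ∈ Metric.ball (0 : ℂ) 1) : 0 ≤ (cayley z).re := by
  rw [cayley_re]
  have : ‖z‖ < 1 := by simpa using hz
  have : ‖z‖ ^ 2 ≤ 1 := pow_le_one₀ (norm_nonneg _) this.le
  exact div_nonneg (by linarith) (by positivity)

theorem differentiableOn_cayley : DifferentiableOn ℂ cayley (Metric.ball 0 1) :=
  (differentiableOn_id.const_add 1).div (differentiableOn_id.const_sub 1)
    fun _ hz => one_sub_ne_zero_of_mem_unitBall hz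

/-- The function `z ↦ f(c₁ + (1 + z) / (1 - z))` on the unit disc, for `f ∈ ℋ²`. -/
def discLift (c₁ : ℂ) (x : H2) (z : ℂ) : ℂ := H2series x (c₁ + cayley z)

theorem le_re_add_cayley (c₁ : ℂ) {z : ℂ} (hz : z ∈ Metric.ball (0 : ℂ) 1) :
    c₁.re ≤ (c₁ + cayley z).re := by
  simpa using cayley_re_nonneg hz

section CompositionOperator

variable {c₁ : ℂ} (h : 1 / 2 < c₁.re)
include h

theorem differentiableOn_discLift (x : H2) :
    DifferentiableOn ℂ (discLift c₁ x) (Metric.ball 0 1) := by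
  refine differentiableOn_tsum_of_summable_norm (H2_summable_norm_mul_rpow x h).1 (fun n => ?_)
    Metric.isOpen_ball fun n z hz => norm_H2series_term_le x (le_re_add_cayley c₁ hz) n
  exact ((differentiableOn_cayley.const_add c₁).neg.const_cpow
    (.inl (by exact_mod_cast n.ne_zero))).const_mul _

theorem norm_discLift_le (x : H2) {z : ℂ} (hz : z ∈ Metric.ball (0 : ℂ) 1) :
    ‖discLift c₁ x z‖ ≤ √(∑' n : ℕ+, ((n : ℝ) ^ (-c₁.re)) ^ 2) * ‖x‖ :=
  (tsum_of_norm_bounded (H2_summable_norm_mul_rpow x h).1.hasSum fun n =>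
    norm_H2series_term_le x (le_re_add_cayley c₁ hz) n).trans (H2_summable_norm_mul_rpow x h).2

omit h in
/-- The Taylor coefficients at `0` of `discLift c₁ x`. -/
def discCoeff (c₁ : ℂ) (x : H2) (k : ℕ) : ℂ := (k ! : ℂ)⁻¹ * iteratedDeriv k (discLift c₁ x) 0

theorem hasSum_discCoeff (x : H2) :
    ∀ z ∈ Metric.ball (0 : ℂ) 1, HasSum (fun k => discCoeff c₁ x k * z ^ k) (discLift c₁ x z) := by
  intro z hz
  convert! Complex.hasSum_taylorSeries_on_ball (differentiableOn_discLift h x) hz using 2 with k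
  simp [discCoeff]
  ring

theorem contDiffAt_discLift (x : H2) (k : ℕ) : ContDiffAt ℂ k (discLift c₁ x) 0 :=
  ((differentiableOn_discLift h x).analyticAt (Metric.ball_mem_nhds 0 one_pos)).contDiffAt

theorem discCoeff_add (x y : H2) (k : ℕ) :
    discCoeff c₁ (x + y) k = discCoeff c₁ x k + discCoeff c₁ y k := by
  have : discLift c₁ (x + y) =ᶠ[𝓝 0] discLift c₁ x + discLift c₁ y := by
    filter_upwards [Metric.ball_mem_nhds (0 : ℂ) one_pos] with z hz
    exact H2series_add x y (h.trans_le (le_re_add_cayley c₁ hz))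
  rw [discCoeff, this.iteratedDeriv_eq,
    iteratedDeriv_add (contDiffAt_discLift h x k) (contDiffAt_discLift h y k), mul_add]
  rfl

omit h in
theorem discCoeff_smul (c : ℂ) (x : H2) (k : ℕ) :
    discCoeff c₁ (c • x) k = c * discCoeff c₁ x k := by
  have : discLift c₁ (c • x) = fun z => c * discLift c₁ x z := by
    ext z
    exact H2series_smul c x _
  rw [discCoeff, this, iteratedDeriv_const_mul_field, discCoeff]
  ring

theorem sum_sq_norm_discCoeff_le (x : H2) (K : ℕ) :
    ∑ k ∈ Finset.range K, ‖discCoeff c₁ x k‖ ^ 2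
      ≤ (√(∑' n : ℕ+, ((n : ℝ) ^ (-c₁.re)) ^ 2) * ‖x‖) ^ 2 :=
  sum_sq_norm_coeff_le (hasSum_discCoeff h x) (differentiableOn_discLift h x).continuousOn
    (fun _ hz => norm_discLift_le h x hz) K

theorem summable_sq_norm_discCoeff (x : H2) : Summable fun k => ‖discCoeff c₁ x k‖ ^ 2 :=
  summable_of_sum_range_le (fun _ => by positivity) (sum_sq_norm_discCoeff_le h x)

omit h in
theorem two_pow_pnat_injective : Function.Injective fun k : ℕ => (2 : ℕ+) ^ k := by
  intro i j hij
  have : (2 : ℕ) ^ i = 2 ^ j := by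
    simpa using congrArg PNat.val hij
  exact Nat.pow_right_injective le_rfl this

omit h in
/-- The Dirichlet coefficients of `∑ a k * 2 ^ (-k s)`. -/
def twoPowExtend (a : ℕ → ℂ) : ℕ+ → ℂ := Function.extend (fun k : ℕ => (2 : ℕ+) ^ k) a 0

omit h in
theorem twoPowExtend_pow (a : ℕ → ℂ) (k : ℕ) : twoPowExtend a (2 ^ k) = a k :=
  two_pow_pnat_injective.extend_apply a 0 k

omit h in
theorem twoPowExtend_of_notMem (a : ℕ → ℂ) {n : ℕ+}
    (hn : n ∉ Set.range fun k : ℕ => (2 : ℕ+) ^ k) : twoPowExtend a n = 0 :=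
  Function.extend_apply' _ _ _ hn

omit h in
theorem hasSum_comp_twoPowExtend {E : Type*} [AddCommMonoid E] [TopologicalSpace E] (a : ℕ → ℂ)
    {g : ℕ+ → ℂ → E} (hg : ∀ n, g n 0 = 0) {L : E} :
    HasSum (fun n => g n (twoPowExtend a n)) L ↔ HasSum (fun k => g (2 ^ k) (a k)) L := by
  rw [← two_pow_pnat_injective.hasSum_iff]
  · simp only [Function.comp_def, twoPowExtend_pow]
  · intro n hn
    rw [twoPowExtend_of_notMem a hn, hg]

omit h in
theorem memℓp_twoPowExtend {a : ℕ → ℂ} (ha : Summable fun k => ‖a k‖ ^ 2) :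
    Memℓp (twoPowExtend a) 2 := by
  refine memℓp_gen ?_
  simpa using ((hasSum_comp_twoPowExtend a (g := fun _ z => ‖z‖ ^ 2) (by simp)).mpr
    ha.hasSum).summable

/-- The composition operator with symbol `c₁ + (1 + 2 ^ (-s)) / (1 - 2 ^ (-s))`, as a linear map. -/
def compLinearMap : H2 →ₗ[ℂ] H2 where
  toFun x := ⟨twoPowExtend (discCoeff c₁ x), memℓp_twoPowExtend (summable_sq_norm_discCoeff h x)⟩
  map_add' x y := by
    ext n
    change twoPowExtend _ n = twoPowExtend _ n + twoPowExtend _ n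
    by_cases hn : n ∈ Set.range fun k : ℕ => (2 : ℕ+) ^ k
    · obtain ⟨k, rfl⟩ := hn
      simp only [twoPowExtend_pow, discCoeff_add h]
    · simp only [twoPowExtend_of_notMem _ hn, add_zero]
  map_smul' c x := by
    ext n
    change twoPowExtend _ n = c * twoPowExtend _ n
    by_cases hn : n ∈ Set.range fun k : ℕ => (2 : ℕ+) ^ k
    · obtain ⟨k, rfl⟩ := hn
      simp only [twoPowExtend_pow, discCoeff_smul]
    · simp only [twoPowExtend_of_notMem _ hn, mul_zero]

theorem compLinearMap_apply (x : H2) (n : ℕ+) :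
    compLinearMap h x n = twoPowExtend (discCoeff c₁ x) n := rfl

theorem norm_sq_compLinearMap (x : H2) :
    ‖compLinearMap h x‖ ^ 2 = ∑' k, ‖discCoeff c₁ x k‖ ^ 2 := by
  rw [H2_norm_sq]
  exact ((hasSum_comp_twoPowExtend _ (g := fun _ z => ‖z‖ ^ 2) (by simp)).mpr
    (summable_sq_norm_discCoeff h x).hasSum).tsum_eq

theorem norm_compLinearMap_le (x : H2) :
    ‖compLinearMap h x‖ ≤ √(∑' n : ℕ+, ((n : ℝ) ^ (-c₁.re)) ^ 2) * ‖x‖ := by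
  refine le_of_sq_le_sq ?_ (by positivity)
  rw [norm_sq_compLinearMap]
  exact Real.tsum_le_of_sum_range_le (fun _ => by positivity) (sum_sq_norm_discCoeff_le h x)

/-- The composition operator with symbol `c₁ + (1 + 2 ^ (-s)) / (1 - 2 ^ (-s))`. -/
def compOperator : H2 →L[ℂ] H2 :=
  (compLinearMap h).mkContinuous _ (norm_compLinearMap_le h)

theorem isCompOp_compOperator :
    IsCompOp (fun s => c₁ + (1 + (2 : ℂ) ^ (-s)) / (1 - (2 : ℂ) ^ (-s))) (compOperator h) := by
  intro x s hs
  have hz : (2 : ℂ) ^ (-s) ∈ Metric.ball (0 : ℂ) 1 := by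
    have : ‖(2 : ℂ) ^ (-s)‖ = (2 : ℝ) ^ (-s.re) :=
      Complex.norm_cpow_eq_rpow_re_of_pos two_pos _
    rw [mem_ball_zero_iff, this]
    exact Real.rpow_lt_one_of_one_lt_of_neg one_lt_two (by linarith)
  change ∑' n : ℕ+, twoPowExtend (discCoeff c₁ x) n * (n : ℂ) ^ (-s) = discLift c₁ x (2 ^ (-s))
  refine ((hasSum_comp_twoPowExtend _ (g := fun n z => z * (n : ℂ) ^ (-s)) (by simp)).mpr
    ?_).tsum_eq
  convert! hasSum_discCoeff h x _ hz using 3 with k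
  rw [← Complex.cpow_nat_mul, PNat.pow_coe]
  simpa using (Complex.natCast_cpow_natCast_mul 2 k (-s)).symm

end CompositionOperator

/-! ### The Gram matrix of the singular inner functions -/

/-- The singular inner function `exp (-t (1 + z) / (1 - z))`. -/
def singularInner (t : ℝ) (z : ℂ) : ℂ := exp (-t * cayley z)

theorem norm_singularInner_le_one {t : ℝ} (ht : 0 ≤ t) {z : ℂ} (hz : z ∈ Metric.ball (0 : ℂ) 1) :
    ‖singularInner t z‖ ≤ 1 := by
  rw [singularInner, Complex.norm_exp, Real.exp_le_one_iff]
  have := mul_nonneg ht (cayley_re_nonneg hz)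
  simpa using this

theorem differentiableOn_singularInner (t : ℝ) :
    DifferentiableOn ℂ (singularInner t) (Metric.ball 0 1) :=
  (differentiableOn_cayley.const_mul _).cexp

theorem continuousAt_singularInner (t : ℝ) {z : ℂ} (hz : z ≠ 1) :
    ContinuousAt (singularInner t) z := by
  have : 1 - z ≠ 0 := sub_ne_zero.mpr hz.symm
  unfold singularInner cayley
  fun_prop (disch := assumption)

theorem singularInner_zero (t : ℝ) : singularInner t 0 = Real.exp (-t) := by
  simp [singularInner, cayley]

theorem conj_cayley_of_norm_eq_one {z : ℂ} (hz : ‖z‖ = 1) : conj (cayley z) = -cayley z := by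
  have : (cayley z).re = 0 := by rw [cayley_re, hz]; simp
  apply Complex.ext <;> simp [this]

theorem singularInner_mul_conj {z : ℂ} (hz : ‖z‖ = 1) (s t : ℝ) :
    singularInner s z * conj (singularInner t z) = singularInner (s - t) z := by
  simp only [singularInner, ← exp_conj, ← exp_add, map_mul, map_neg, conj_ofReal,
    conj_cayley_of_norm_eq_one hz]
  congr 1
  push_cast
  ring

theorem ae_circleMap_ne_one : ∀ᵐ θ : ℝ, circleMap 0 1 θ ≠ 1 := by
  have hc : (Set.range fun n : ℤ => (n : ℝ) * (2 * Real.pi)).Countable := Set.countable_range _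
  filter_upwards [hc.ae_notMem volume] with θ hθ h1
  apply hθ
  simp only [circleMap, ofReal_one, one_mul, zero_add, Complex.exp_eq_one_iff] at h1
  obtain ⟨n, hn⟩ := h1
  refine ⟨n, ?_⟩
  have : (θ : ℂ) = n * (2 * Real.pi) := by
    apply mul_right_cancel₀ I_ne_zero
    rw [hn]
    ring
  exact_mod_cast this.symm

theorem tendsto_circleMap_radius (θ : ℝ) :
    Tendsto (fun r : ℝ => circleMap 0 r θ) (𝓝[<] 1) (𝓝 (circleMap 0 1 θ)) := by
  have : Continuous fun r : ℝ => circleMap 0 r θ := by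
    unfold circleMap
    fun_prop
  exact (this.tendsto 1).mono_left nhdsWithin_le_nhds

theorem circleAverage_re_mul_singularInner (β : ℂ) (t : ℝ) {r : ℝ} (hr0 : 0 ≤ r) (hr1 : r < 1) :
    Real.circleAverage (fun z => (β * singularInner t z).re) 0 r = β.re * Real.exp (-t) := by
  have hd : DifferentiableOn ℂ (fun z => β * singularInner t z) (Metric.ball 0 1) :=
    (differentiableOn_singularInner t).const_mul β
  have hint : CircleIntegrable (fun z => β * singularInner t z) 0 r :=
    (continuous_comp_circleMap hd.continuousOn hr0 hr1).intervalIntegrable _ _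
  have hdc : DiffContOnCl ℂ (fun z => β * singularInner t z) (Metric.ball 0 |r|) := by
    refine (hd.mono ?_).diffContOnCl
    refine Metric.closure_ball_subset_closedBall.trans (Metric.closedBall_subset_ball ?_)
    rwa [abs_of_nonneg hr0]
  have := reCLM.circleAverage_comp_comm hint
  rw [hdc.circleAverage, singularInner_zero, reCLM_apply, re_mul_ofReal] at this
  exact this

theorem tendsto_circleAverage_singularInner (β : ℂ) {s t : ℝ} (ht : 0 ≤ t) (hst : t ≤ s) :
    Tendsto (fun r => Real.circleAverage
        (fun z => (β * (singularInner s z * conj (singularInner t z))).re) 0 r)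
      (𝓝[<] 1) (𝓝 (β.re * Real.exp (-(s - t)))) := by
  have hcont : ∀ u, ContinuousOn (singularInner u) (Metric.ball 0 1) := fun u =>
    (differentiableOn_singularInner u).continuousOn
  have hlim : ∀ u θ, circleMap 0 1 θ ≠ 1 →
      Tendsto (fun r => singularInner u (circleMap 0 r θ)) (𝓝[<] 1)
        (𝓝 (singularInner u (circleMap 0 1 θ))) := fun u θ hθ =>
    (continuousAt_singularInner u hθ).tendsto.comp (tendsto_circleMap_radius θ)
  have h1 : Tendsto (fun r => Real.circleAverage (fun z => (β * singularInner (s - t) z).re) 0 r)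
      (𝓝[<] 1) (𝓝 (Real.circleAverage (fun z => (β * singularInner (s - t) z).re) 0 1)) := by
    refine Real.tendsto_circleAverage_of_bounded (B := ‖β‖) ?_ ?_ ?_
    · filter_upwards [eventually_mem_Ico_zero_one] with r hr
      exact continuous_re.comp
        (continuous_const.mul (continuous_comp_circleMap (hcont _) hr.1 hr.2))
    · filter_upwards [eventually_mem_Ico_zero_one] with r hr θ
      refine (abs_re_le_norm _).trans ?_
      rw [norm_mul]
      exact mul_le_of_le_one_right (norm_nonneg _)
        (norm_singularInner_le_one (by linarith) (circleMap_mem_unitBall hr.1 hr.2 θ))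
    · filter_upwards [ae_circleMap_ne_one] with θ hθ
      exact (continuous_re.tendsto _).comp ((hlim _ _ hθ).const_mul β)
  have h2 : β.re * Real.exp (-(s - t))
      = Real.circleAverage (fun z => (β * singularInner (s - t) z).re) 0 1 := by
    refine tendsto_nhds_unique (tendsto_const_nhds.congr' ?_) h1
    filter_upwards [eventually_mem_Ico_zero_one] with r hr
    rw [circleAverage_re_mul_singularInner β _ hr.1 hr.2]
  rw [h2]
  refine Real.tendsto_circleAverage_of_bounded (B := ‖β‖) ?_ ?_ ?_
  · filter_upwards [eventually_mem_Ico_zero_one] with r hr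
    exact continuous_re.comp (continuous_const.mul
      ((continuous_comp_circleMap (hcont _) hr.1 hr.2).mul
        (continuous_conj.comp (continuous_comp_circleMap (hcont _) hr.1 hr.2))))
  · filter_upwards [eventually_mem_Ico_zero_one] with r hr θ
    refine (abs_re_le_norm _).trans ?_
    have hz := circleMap_mem_unitBall hr.1 hr.2 θ
    rw [norm_mul, norm_mul, RCLike.norm_conj]
    exact mul_le_of_le_one_right (norm_nonneg _)
      (mul_le_one₀ (norm_singularInner_le_one (ht.trans hst) hz) (norm_nonneg _)
        (norm_singularInner_le_one ht hz))
  · filter_upwards [ae_circleMap_ne_one] with θ hθ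
    rw [← singularInner_mul_conj (by simp)]
    exact (continuous_re.tendsto _).comp
      (((hlim _ _ hθ).mul ((continuous_conj.tendsto _).comp (hlim _ _ hθ))).const_mul β)

theorem tendsto_circleAverage_singularInner_abs (β : ℂ) {s t : ℝ} (hs : 0 ≤ s) (ht : 0 ≤ t) :
    Tendsto (fun r => Real.circleAverage
        (fun z => (β * (singularInner s z * conj (singularInner t z))).re) 0 r)
      (𝓝[<] 1) (𝓝 (β.re * Real.exp (-|s - t|))) := by
  rcases le_total t s with hst | hst
  · rw [abs_of_nonneg (sub_nonneg.mpr hst)]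
    exact tendsto_circleAverage_singularInner β ht hst
  · rw [abs_of_nonpos (sub_nonpos.mpr hst), neg_sub]
    have hconj : ∀ z, (β * (singularInner s z * conj (singularInner t z))).re
        = (conj β * (singularInner t z * conj (singularInner s z))).re := by
      intro z
      rw [← conj_re (conj β * _)]
      simp only [map_mul, conj_conj]
      ring_nf
    simp_rw [hconj]
    rw [← conj_re β]
    exact tendsto_circleAverage_singularInner (conj β) hs hst

theorem norm_sq_sum_eq_sum_re {ι : Type*} (S : Finset ι) (f : ι → ℂ) :
    ‖∑ i ∈ S, f i‖ ^ 2 = ∑ i ∈ S, ∑ j ∈ S, (f i * conj (f j)).re := by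
  have : ((‖∑ i ∈ S, f i‖ ^ 2 : ℝ) : ℂ) = ∑ i ∈ S, ∑ j ∈ S, f i * conj (f j) := by
    rw [← Finset.sum_mul_sum, ← map_sum, mul_conj, normSq_eq_norm_sq]
  have h := congrArg re this
  simpa only [ofReal_re, re_sum] using h

theorem tendsto_circleAverage_norm_sq_sum {ι : Type*} (S : Finset ι) (b : ι → ℂ) {t : ι → ℝ}
    (ht : ∀ i, 0 ≤ t i) :
    Tendsto (fun r => Real.circleAverage
        (fun z => ‖∑ i ∈ S, b i * singularInner (t i) z‖ ^ 2) 0 r) (𝓝[<] 1)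
      (𝓝 (∑ i ∈ S, ∑ j ∈ S, (b i * conj (b j)).re * Real.exp (-|t i - t j|))) := by
  refine (tendsto_finsetSum S fun i _ => tendsto_finsetSum S fun j _ =>
    tendsto_circleAverage_singularInner_abs (b i * conj (b j)) (ht i) (ht j)).congr' ?_
  filter_upwards [eventually_mem_Ico_zero_one] with r hr
  have hcont : ∀ u, Continuous fun θ => singularInner u (circleMap 0 r θ) := fun u =>
    continuous_comp_circleMap (differentiableOn_singularInner u).continuousOn hr.1 hr.2
  have hint : ∀ i j, CircleIntegrable (fun z => (b i * conj (b j) *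
      (singularInner (t i) z * conj (singularInner (t j) z))).re) 0 r := fun i j =>
    (continuous_re.comp (continuous_const.mul ((hcont _).mul
      (continuous_conj.comp (hcont _))))).intervalIntegrable _ _
  simp_rw [norm_sq_sum_eq_sum_re]
  rw [Real.circleAverage_fun_sum fun i _ => ?_]
  · refine Finset.sum_congr rfl fun i _ => ?_
    rw [Real.circleAverage_fun_sum fun j _ => ?_]
    · refine Finset.sum_congr rfl fun j _ => ?_
      congr 1
      ext z
      rw [map_mul]
      ring_nf
    · convert! hint i j using 3 with z
      rw [map_mul]
      ring
  · refine CircleIntegrable.fun_sum _ fun j _ => ?_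
    convert! hint i j using 3 with z
    rw [map_mul]
    ring

/-! ### Lower bound for the Gram matrix -/

theorem exp_neg_abs_log_sub_log {a b : ℝ} (ha : 0 < a) (hb : 0 < b) :
    Real.exp (-|Real.log a - Real.log b|) = min a b ^ 2 / (a * b) := by
  rcases le_total a b with hab | hab
  · rw [abs_of_nonpos (sub_nonpos.mpr (Real.log_le_log ha hab)), neg_neg, Real.exp_sub,
      Real.exp_log ha, Real.exp_log hb, min_eq_left hab]
    field_simp
  · rw [abs_of_nonneg (sub_nonneg.mpr (Real.log_le_log hb hab)), neg_sub, Real.exp_sub,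
      Real.exp_log ha, Real.exp_log hb, min_eq_right hab]
    field_simp

theorem sum_two_mul_add_one_eq_min_sq {n i j : ℕ} (hi : i < n) :
    ∑ k ∈ Finset.range n, (if k ≤ i ∧ k ≤ j then (2 * k + 1 : ℝ) else 0)
      = min ((i : ℝ) + 1) (j + 1) ^ 2 := by
  have hm : ∀ m : ℕ, ∑ k ∈ Finset.range m, (2 * k + 1 : ℝ) = (m : ℝ) ^ 2 := by
    intro m
    induction m with
    | zero => simp
    | succ m ih =>
      rw [Finset.sum_range_succ, ih]
      push_cast
      ring
  rw [← Finset.sum_filter]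
  have : Finset.filter (fun k => k ≤ i ∧ k ≤ j) (Finset.range n)
      = Finset.range (min (i + 1) (j + 1)) := by
    ext k
    simp only [Finset.mem_filter, Finset.mem_range]
    omega
  rw [this, hm]
  push_cast
  rfl

theorem sum_min_sq_eq (n : ℕ) (β : ℕ → ℂ) :
    ∑ i ∈ Finset.range n, ∑ j ∈ Finset.range n,
        (β i * conj (β j)).re * min ((i : ℝ) + 1) (j + 1) ^ 2
      = ∑ k ∈ Finset.range n, (2 * k + 1) * ‖∑ i ∈ Finset.Ico k n, β i‖ ^ 2 := by
  have hfilter : ∀ k, Finset.Ico k n = (Finset.range n).filter (k ≤ ·) := by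
    intro k
    ext i
    simp only [Finset.mem_Ico, Finset.mem_filter, Finset.mem_range]
    omega
  have hR : ∀ k ∈ Finset.range n, (2 * k + 1 : ℝ) * ‖∑ i ∈ Finset.Ico k n, β i‖ ^ 2
      = ∑ i ∈ Finset.range n, ∑ j ∈ Finset.range n,
        (β i * conj (β j)).re * (if k ≤ i ∧ k ≤ j then (2 * k + 1 : ℝ) else 0) := by
    intro k _
    rw [norm_sq_sum_eq_sum_re, hfilter, Finset.mul_sum, Finset.sum_filter]
    refine Finset.sum_congr rfl fun i _ => ?_
    split_ifs with hi
    · rw [Finset.sum_filter, Finset.mul_sum]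
      refine Finset.sum_congr rfl fun j _ => ?_
      by_cases hj : k ≤ j <;> simp [hi, hj, mul_comm]
    · simp [hi]
  rw [Finset.sum_congr rfl hR]
  symm
  rw [Finset.sum_comm]
  refine Finset.sum_congr rfl fun i hi => ?_
  rw [Finset.sum_comm]
  refine Finset.sum_congr rfl fun j _ => ?_
  rw [← Finset.mul_sum, sum_two_mul_add_one_eq_min_sq (Finset.mem_range.mp hi)]

theorem sum_norm_sq_le_sum_min_sq (n : ℕ) (β : ℕ → ℂ) :
    ∑ i ∈ Finset.range n, ‖β i‖ ^ 2 ≤ 4 * ∑ i ∈ Finset.range n, ∑ j ∈ Finset.range n,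
        (β i * conj (β j)).re * min ((i : ℝ) + 1) (j + 1) ^ 2 := by
  rw [sum_min_sq_eq]
  set d : ℕ → ℂ := fun k => ∑ i ∈ Finset.Ico k n, β i with hd
  have h1 : ∀ k ∈ Finset.range n, ‖β k‖ ^ 2 ≤ 2 * ‖d k‖ ^ 2 + 2 * ‖d (k + 1)‖ ^ 2 := by
    intro k hk
    have : β k = d k - d (k + 1) := by
      simp only [hd]
      rw [Finset.sum_eq_sum_Ico_succ_bot (Finset.mem_range.mp hk)]
      ring
    have h2 : ‖β k‖ ≤ ‖d k‖ + ‖d (k + 1)‖ := this ▸ norm_sub_le _ _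
    nlinarith [sq_nonneg (‖d k‖ - ‖d (k + 1)‖), norm_nonneg (β k)]
  have h2 : ∑ k ∈ Finset.range n, ‖d (k + 1)‖ ^ 2 ≤ ∑ k ∈ Finset.range n, ‖d k‖ ^ 2 := by
    have h3 := Finset.sum_range_succ (fun k => ‖d k‖ ^ 2) n
    have h4 := Finset.sum_range_succ' (fun k => ‖d k‖ ^ 2) n
    have h5 : d n = 0 := by simp [hd]
    rw [h5] at h3
    simp only [norm_zero] at h3
    nlinarith [sq_nonneg ‖d 0‖]
  have h3 : ∑ k ∈ Finset.range n, ‖d k‖ ^ 2 ≤ ∑ k ∈ Finset.range n, (2 * k + 1) * ‖d k‖ ^ 2 := by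
    refine Finset.sum_le_sum fun k _ => le_mul_of_one_le_left (by positivity) ?_
    linarith [(Nat.cast_nonneg k : (0 : ℝ) ≤ k)]
  have h4 := Finset.sum_le_sum h1
  rw [Finset.sum_add_distrib, ← Finset.mul_sum, ← Finset.mul_sum] at h4
  linarith

/-! ### Lower bound for the composition operator -/

theorem hasSum_of_support_lt {E : Type*} [AddCommMonoid E] [TopologicalSpace E] {n : ℕ}
    {f : ℕ+ → E} (hf : ∀ m : ℕ+, n < m → f m = 0) :
    HasSum f (∑ i ∈ Finset.range n, f i.succPNat) := by
  have := hasSum_sum_of_ne_finset_zero (f := f)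
    (s := (Finset.range n).map ⟨Nat.succPNat, Nat.succPNat_injective⟩) (L := .unconditional _) ?_
  · simpa using this
  · intro m hm
    refine hf m ?_
    by_contra! hmn
    refine hm (Finset.mem_map.mpr ⟨m.natPred, ?_, by simp⟩)
    have := m.natPred_add_one
    simp only [Finset.mem_range]
    omega

section LowerBound

variable {c₁ : ℂ} {n : ℕ} {x : H2} (hx : ∀ m : ℕ+, n < m → x m = 0)
include hx

theorem discLift_eq_sum_singularInner (z : ℂ) :
    discLift c₁ x z = ∑ i ∈ Finset.range n,
      x i.succPNat * ((i : ℂ) + 1) ^ (-c₁) * singularInner (Real.log (i + 1)) z := by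
  rw [discLift, H2series, (hasSum_of_support_lt fun m hm => by rw [hx m hm, zero_mul]).tsum_eq]
  refine Finset.sum_congr rfl fun i _ => ?_
  have h0 : ((i : ℂ) + 1) ≠ 0 := by exact_mod_cast i.succ_ne_zero
  have hlog : ((Real.log (i + 1) : ℝ) : ℂ) = Complex.log ((i : ℂ) + 1) := by
    rw [Complex.ofReal_log (by positivity)]
    push_cast
    rfl
  rw [mul_assoc, singularInner, hlog, Nat.succPNat_coe, Nat.cast_succ, neg_add, cpow_add _ _ h0,
    cpow_def_of_ne_zero h0 (-cayley z)]
  ring_nf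

theorem le_norm_sq_compLinearMap (h : 1 / 2 < c₁.re) :
    (1 / 2 * (n : ℝ) ^ (-(c₁.re + 1)) * ‖x‖) ^ 2 ≤ ‖compLinearMap h x‖ ^ 2 := by
  set b : ℕ → ℂ := fun i => x i.succPNat * ((i : ℂ) + 1) ^ (-c₁) with hb
  have hL := le_tsum_sq_norm_coeff (hasSum_discCoeff h x) (summable_sq_norm_discCoeff h x)
    (L := _) (by
      simp_rw [discLift_eq_sum_singularInner hx]
      exact tendsto_circleAverage_norm_sq_sum (Finset.range n) b
        (t := fun i => Real.log (i + 1)) fun i => Real.log_nonneg (by simp))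
  rw [norm_sq_compLinearMap]
  refine le_trans ?_ hL
  have hpos : ∀ i : ℕ, (0 : ℝ) < i + 1 := fun i => by positivity
  have hQ := sum_norm_sq_le_sum_min_sq n fun i => b i / ((i + 1 : ℝ) : ℂ)
  have hG : ∀ i j : ℕ, (b i * conj (b j)).re *
        Real.exp (-|Real.log ((i : ℝ) + 1) - Real.log (j + 1)|)
      = (b i / ((i + 1 : ℝ) : ℂ) * conj (b j / ((j + 1 : ℝ) : ℂ))).re
        * min ((i : ℝ) + 1) (j + 1) ^ 2 := by
    intro i j
    rw [exp_neg_abs_log_sub_log (hpos i) (hpos j), map_div₀, conj_ofReal, div_mul_div_comm,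
      ← ofReal_mul, div_ofReal_re]
    ring
  simp_rw [hG]
  have hN : ‖x‖ ^ 2 = ∑ i ∈ Finset.range n, ‖x i.succPNat‖ ^ 2 := by
    rw [H2_norm_sq]
    exact (hasSum_of_support_lt fun m hm => by simp [hx m hm]).tsum_eq
  have hterm : ∀ i ∈ Finset.range n,
      ((n : ℝ) ^ (-(c₁.re + 1))) ^ 2 * ‖x i.succPNat‖ ^ 2 ≤ ‖b i / ((i + 1 : ℝ) : ℂ)‖ ^ 2 := by
    intro i hi
    rw [← mul_pow]
    have hin : (i : ℝ) + 1 ≤ n := by exact_mod_cast Finset.mem_range.mp hi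
    have hnorm : ‖b i / ((i + 1 : ℝ) : ℂ)‖ = ‖x i.succPNat‖ * ((i : ℝ) + 1) ^ (-(c₁.re + 1)) := by
      have : ‖((i : ℂ) + 1) ^ (-c₁)‖ = ((i : ℝ) + 1) ^ (-c₁.re) := by
        exact_mod_cast Complex.norm_natCast_cpow_of_pos i.succ_pos (-c₁)
      rw [norm_div, norm_real, Real.norm_of_nonneg (hpos i).le, hb, norm_mul, this, neg_add,
        Real.rpow_add (hpos i), Real.rpow_neg_one]
      ring
    rw [hnorm, mul_comm]
    gcongr ?_ ^ 2
    exact mul_le_mul_of_nonneg_left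
      (Real.rpow_le_rpow_of_nonpos (hpos i) hin (by linarith)) (norm_nonneg _)
  have hS := Finset.sum_le_sum hterm
  rw [← Finset.mul_sum, ← hN] at hS
  rw [mul_pow, mul_pow]
  linarith

theorem le_norm_compLinearMap (h : 1 / 2 < c₁.re) :
    1 / 2 * (n : ℝ) ^ (-(c₁.re + 1)) * ‖x‖ ≤ ‖compLinearMap h x‖ :=
  le_of_sq_le_sq (le_norm_sq_compLinearMap hx h) (norm_nonneg _)

end LowerBound

/-! ### Approximation numbers -/

/-- A lower bound for an operator on an `n`-dimensional subspace bounds its `n`-th approximation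
number from below. -/
theorem le_approxNumber {E F : Type*} [NormedAddCommGroup E] [NormedSpace ℂ E]
    [NormedAddCommGroup F] [NormedSpace ℂ F] (T : E →L[ℂ] F) {n : ℕ} (hn : 1 ≤ n) {δ : ℝ}
    (ι : (Fin n → ℂ) →ₗ[ℂ] E) (hι : Function.Injective ι)
    (hδ : ∀ v, δ * ‖ι v‖ ≤ ‖T (ι v)‖) : δ ≤ approxNumber T n := by
  refine le_csInf ⟨‖T - 0‖, 0, ?_, ?_, rfl⟩ ?_
  · rw [ContinuousLinearMap.toLinearMap_zero, LinearMap.range_zero]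
    infer_instance
  · rw [ContinuousLinearMap.toLinearMap_zero, LinearMap.range_zero, finrank_bot]
    omega
  rintro _ ⟨R, hfin, hrank, rfl⟩
  obtain ⟨v, hv, hRv⟩ : ∃ v : Fin n → ℂ, v ≠ 0 ∧ R (ι v) = 0 := by
    have hker : LinearMap.ker ((R : E →ₗ[ℂ] F).rangeRestrict ∘ₗ ι) ≠ ⊥ :=
      LinearMap.ker_ne_bot_of_finrank_lt (by simpa using hrank)
    obtain ⟨v, hv, hv0⟩ := Submodule.exists_mem_ne_zero_of_ne_bot hker
    exact ⟨v, hv0, congrArg Subtype.val (LinearMap.mem_ker.mp hv)⟩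
  have hpos : 0 < ‖ι v‖ := norm_pos_iff.mpr ((map_ne_zero_iff ι hι).mpr hv)
  refine le_of_mul_le_mul_right ((hδ v).trans ?_) hpos
  simpa [hRv] using (T - R).le_opNorm (ι v)

/-- The inclusion of `ℂⁿ` into `ℋ²` as the first `n` coefficients. -/
def finInclusion (n : ℕ) : (Fin n → ℂ) →ₗ[ℂ] H2 :=
  ∑ i : Fin n, lp.lsingle (𝕜 := ℂ) (E := fun _ : ℕ+ => ℂ) 2 (i : ℕ).succPNat ∘ₗ LinearMap.proj i

theorem finInclusion_apply {n : ℕ} (v : Fin n → ℂ) (m : ℕ+) :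
    finInclusion n v m = ∑ i : Fin n, if m = (i : ℕ).succPNat then v i else 0 := by
  rw [finInclusion, LinearMap.sum_apply, lp.coeFn_sum, Finset.sum_apply]
  exact Finset.sum_congr rfl fun i _ => Pi.single_apply _ (v i) m

theorem finInclusion_injective (n : ℕ) : Function.Injective (finInclusion n) := by
  refine (injective_iff_map_eq_zero _).mpr fun v hv => ?_
  ext i
  have h := finInclusion_apply v (i : ℕ).succPNat
  simpa [hv, Nat.succPNat_inj, Fin.val_inj] using h.symm

theorem finInclusion_apply_of_lt {n : ℕ} (v : Fin n → ℂ) (m : ℕ+) (hm : n < m) :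
    finInclusion n v m = 0 := by
  rw [finInclusion_apply]
  refine Finset.sum_eq_zero fun i _ => if_neg ?_
  rintro rfl
  have := i.isLt
  simp at hm
  omega

theorem stmt17 (c₁ : ℂ) (h : 1 / 2 < c₁.re) :
    ∃ T : H2 →L[ℂ] H2,
      IsCompOp (fun s => c₁ + (1 + (2 : ℂ) ^ (-s)) / (1 - (2 : ℂ) ^ (-s))) T ∧
      ∃ A : ℝ, 0 < A ∧ ∃ C : ℝ, 0 < C ∧ ∀ n : ℕ, 1 ≤ n →
        C * (n : ℝ) ^ (-A) ≤ approxNumber T n := by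
  refine ⟨compOperator h, isCompOp_compOperator h, c₁.re + 1, by linarith, 1 / 2, by norm_num,
    fun n hn => le_approxNumber _ hn (finInclusion n) (finInclusion_injective n) fun v => ?_⟩
  exact le_norm_compLinearMap (finInclusion_apply_of_lt v) h
end
end
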